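/- Let f be a tempered distribution on gl₃(𝕂) (viewed as a finite-dimensional real vector space). Suppose that: (i) for every a ∈ 𝕂ˣ (with l = diag(a,1,a) ∈ GL₃(𝕂)), every g₁, g₂ ∈ N₃, and every Schwartz function φ on gl₃(𝕂), one has f(x ↦ φ(l·g₁·x·g₂^τ·l⁻¹)) = χ_{N₃}(g₁)⁻¹·χ_{N₃}(g₂)⁻¹·f(φ); and (ii) for every Schwartz function φ, f(x ↦ φ(x^τ)) = −f(φ). Then f = 0. -/

import Mathlib

open Matrix

attribute [local instance] Matrix.normedAddCommGroup Matrix.normedSpace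

/-- The subgroup `N₃ ⊆ GL₃(𝕂)` of matrices of the form `[[1,0,d],[0,1,c],[0,0,1]]`;
its character is `χ_{N₃}(g) = ψ(d)`, read off from the `(1,3)` entry of `g`. -/
def N3 (𝕂 : Type*) [RCLike 𝕂] : Set (Matrix (Fin 3) (Fin 3) 𝕂) :=
  {g | ∃ c d : 𝕂, g = !![1, 0, d; 0, 1, c; 0, 0, 1]}

open scoped SchwartzMap ContDiff LineDeriv FourierTransform ComplexConjugate
open Filter Topology MeasureTheory

namespace SchwartzMap

universe u v

section Montel

variable {V F ι : Type*} [NormedAddCommGroup V] [NormedSpace ℝ V]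
  [NormedAddCommGroup F] [NormedSpace ℝ F]

/-- A family of Schwartz functions bounded in every Schwartz seminorm. -/
def IsSeminormBounded (φ : ι → 𝓢(V, F)) : Prop :=
  ∀ k n, ∃ C, ∀ i, SchwartzMap.seminorm ℝ k n (φ i) ≤ C

theorem seminorm_fderivCLM_le (k n : ℕ) (φ : 𝓢(V, F)) :
    SchwartzMap.seminorm ℝ k n (fderivCLM ℝ V F φ) ≤ SchwartzMap.seminorm ℝ k (n + 1) φ := by
  refine seminorm_le_bound ℝ k n _ (apply_nonneg _ _) fun x => ?_
  have h : ((fderivCLM ℝ V F φ : 𝓢(V, V →L[ℝ] F)) : V → V →L[ℝ] F) = fderiv ℝ φ := by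
    ext1 y; rfl
  rw [h, norm_iteratedFDeriv_fderiv]
  exact le_seminorm ℝ k (n + 1) φ x

theorem IsSeminormBounded.fderivCLM {φ : ι → 𝓢(V, F)} (h : IsSeminormBounded φ) :
    IsSeminormBounded fun i => SchwartzMap.fderivCLM ℝ V F (φ i) := fun k n => by
  obtain ⟨C, hC⟩ := h k (n + 1)
  exact ⟨C, fun i => (seminorm_fderivCLM_le k n _).trans (hC i)⟩

theorem IsSeminormBounded.norm_image_sub_le {φ : ι → 𝓢(V, F)} (h : IsSeminormBounded φ) :
    ∃ C, 0 < C ∧ ∀ i x y, ‖φ i y - φ i x‖ ≤ C * ‖y - x‖ := by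
  obtain ⟨C, hC⟩ := h 0 1
  refine ⟨max C 1, by positivity, fun i x y => ?_⟩
  refine Convex.norm_image_sub_le_of_norm_fderiv_le (𝕜 := ℝ) (s := Set.univ)
    (fun z _ => (φ i).differentiableAt) (fun z _ => ?_) convex_univ trivial trivial
  have := (norm_iteratedFDeriv_le_seminorm ℝ (φ i) 1 z).trans (hC i)
  rw [norm_iteratedFDeriv_one] at this
  exact this.trans (le_max_left _ _)

theorem IsSeminormBounded.eventually_pow_mul_norm_le [ProperSpace V]
    {φ : ι → 𝓢(V, F)} (h : IsSeminormBounded φ) {l : Filter ι} (h0 : ∀ x, Tendsto (fun i => φ i x) l (𝓝 0))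
    (k : ℕ) {ε : ℝ} (hε : 0 < ε) : ∀ᶠ i in l, ∀ x, ‖x‖ ^ k * ‖φ i x‖ ≤ ε := by
  obtain ⟨L, hL, hlip⟩ := h.norm_image_sub_le
  obtain ⟨C, hC⟩ := h (k + 1) 0
  obtain ⟨R, hR1, hRC⟩ : ∃ R : ℝ, 1 ≤ R ∧ C ≤ R * ε :=
    ⟨max 1 (C / ε), le_max_left _ _, by
      rw [← div_le_iff₀ hε]; exact le_max_right _ _⟩
  have hR0 : 0 < R := by linarith
  set δ := ε / R ^ k with hδ
  have hδ0 : 0 < δ := by positivity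
  obtain ⟨t, -, htf, hcov⟩ := (isCompact_closedBall (0 : V) R).finite_cover_balls
    (show 0 < δ / (2 * L) by positivity)
  have hev : ∀ᶠ i in l, ∀ c ∈ t, ‖φ i c‖ < δ / 2 := by
    rw [eventually_all_finite htf]
    intro c _
    have := (h0 c).norm
    rw [norm_zero] at this
    exact this.eventually_lt_const (by positivity)
  filter_upwards [hev] with i hi x
  by_cases hx : ‖x‖ ≤ R
  · have : x ∈ Metric.closedBall (0 : V) R := by simpa using hx
    obtain ⟨c, hct, hxc⟩ := Set.mem_iUnion₂.1 (hcov this)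
    rw [Metric.mem_ball, dist_eq_norm] at hxc
    have h1 : ‖φ i x‖ ≤ δ := by
      have h2 := hlip i c x
      have h3 : L * ‖x - c‖ ≤ δ / 2 := by
        calc L * ‖x - c‖ ≤ L * (δ / (2 * L)) := by gcongr
          _ = δ / 2 := by field_simp
      calc ‖φ i x‖ = ‖(φ i x - φ i c) + φ i c‖ := by simp
        _ ≤ ‖φ i x - φ i c‖ + ‖φ i c‖ := norm_add_le _ _
        _ ≤ δ := by linarith [hi c hct]
    calc ‖x‖ ^ k * ‖φ i x‖ ≤ R ^ k * δ := by gcongr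
      _ = ε := by rw [hδ]; field_simp
  · push Not at hx
    have h1 := (norm_pow_mul_le_seminorm ℝ (φ i) (k + 1) x).trans (hC i)
    have h2 : R * (‖x‖ ^ k * ‖φ i x‖) ≤ R * ε := by
      calc R * (‖x‖ ^ k * ‖φ i x‖) ≤ ‖x‖ * (‖x‖ ^ k * ‖φ i x‖) := by gcongr
        _ = ‖x‖ ^ (k + 1) * ‖φ i x‖ := by ring
        _ ≤ R * ε := h1.trans hRC
    exact le_of_mul_le_mul_left h2 hR0

theorem IsSeminormBounded.tendsto_fderivCLM_apply [ProperSpace V] {φ : ι → 𝓢(V, F)}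
    (h : IsSeminormBounded φ) {l : Filter ι} (h0 : ∀ x, Tendsto (fun i => φ i x) l (𝓝 0))
    (x : V) : Tendsto (fun i => SchwartzMap.fderivCLM ℝ V F (φ i) x) l (𝓝 0) := by
  obtain ⟨L, hL, hlip⟩ := h.fderivCLM.norm_image_sub_le
  rw [tendsto_zero_iff_norm_tendsto_zero, Metric.tendsto_nhds]
  intro ε hε
  set r := ε / (4 * L) with hr
  have hr0 : 0 < r := by positivity
  filter_upwards [h.eventually_pow_mul_norm_le h0 0 (show 0 < ε * r / 16 by positivity)] with i hi
  simp only [pow_zero, one_mul] at hi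
  rw [dist_zero_right, norm_norm]
  refine lt_of_le_of_lt (b := ε / 2) ?_ (by linarith)
  refine ContinuousLinearMap.opNorm_le_of_shell' (ε := r) (c := (1 / 2 : ℝ)) hr0 (by positivity) (by norm_num) fun v hv1 hv2 => ?_
  have hv1' : r / 2 ≤ ‖v‖ := by
    have : ‖(1 / 2 : ℝ)‖ = 1 / 2 := by norm_num
    rw [this] at hv1; linarith
  have key := Convex.norm_image_sub_le_of_norm_fderiv_le' (𝕜 := ℝ) (f := φ i)
    (φ := SchwartzMap.fderivCLM ℝ V F (φ i) x) (s := Metric.closedBall x r) (C := L * r)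
    (fun z _ => (φ i).differentiableAt) (fun z hz => by
      have := hlip i x z
      rw [Metric.mem_closedBall, dist_eq_norm] at hz
      exact this.trans (by gcongr)) (convex_closedBall _ _)
      (Metric.mem_closedBall_self hr0.le) (y := x + v) (by simpa using hv2.le)
  rw [add_sub_cancel_left] at key
  have h3 : ‖SchwartzMap.fderivCLM ℝ V F (φ i) x v‖ ≤ L * r * ‖v‖ + ε * r / 16 + ε * r / 16 := by
    calc ‖SchwartzMap.fderivCLM ℝ V F (φ i) x v‖
        = ‖φ i (x + v) - φ i x -
            (φ i (x + v) - φ i x - SchwartzMap.fderivCLM ℝ V F (φ i) x v)‖ := by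
          congr 1; abel
      _ ≤ ‖φ i (x + v)‖ + ‖φ i x‖ +
            ‖φ i (x + v) - φ i x - SchwartzMap.fderivCLM ℝ V F (φ i) x v‖ :=
          (norm_sub_le _ _).trans (by gcongr; exact norm_sub_le _ _)
      _ ≤ _ := by linarith [hi (x + v), hi x]
  have h4 : L * r = ε / 4 := by rw [hr]; field_simp
  rw [h4] at h3
  nlinarith

theorem IsSeminormBounded.eventually_norm_iteratedFDeriv_le {V : Type u} {F : Type (max u v)}
    [NormedAddCommGroup V] [NormedSpace ℝ V] [ProperSpace V] [NormedAddCommGroup F]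
    [NormedSpace ℝ F] {φ : ι → 𝓢(V, F)} (h : IsSeminormBounded φ) {l : Filter ι}
    (h0 : ∀ x, Tendsto (fun i => φ i x) l (𝓝 0)) (k n : ℕ) {ε : ℝ} (hε : 0 < ε) :
    ∀ᶠ i in l, ∀ x, ‖x‖ ^ k * ‖iteratedFDeriv ℝ n (φ i) x‖ ≤ ε := by
  induction n generalizing F with
  | zero =>
    filter_upwards [h.eventually_pow_mul_norm_le h0 k hε] with i hi x
    rw [norm_iteratedFDeriv_zero]
    exact hi x
  | succ n ih =>
    filter_upwards [ih h.fderivCLM (h.tendsto_fderivCLM_apply h0)] with i hi x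
    have h1 : ((SchwartzMap.fderivCLM ℝ V F (φ i) : 𝓢(V, V →L[ℝ] F)) : V → V →L[ℝ] F) =
        fderiv ℝ (φ i) := by
      ext1 y; rfl
    have := hi x
    rwa [h1, norm_iteratedFDeriv_fderiv] at this

/-- A seminorm-bounded family of Schwartz functions tending to zero pointwise tends to zero. -/
theorem IsSeminormBounded.tendsto_seminorm {V : Type u} {F : Type v}
    [NormedAddCommGroup V] [NormedSpace ℝ V] [ProperSpace V] [NormedAddCommGroup F]
    [NormedSpace ℝ F] {φ : ι → 𝓢(V, F)}
    (h : IsSeminormBounded φ) {l : Filter ι} (h0 : ∀ x, Tendsto (fun i => φ i x) l (𝓝 0))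
    (k n : ℕ) : Tendsto (fun i => SchwartzMap.seminorm ℝ k n (φ i)) l (𝓝 0) := by
  let L : F ≃ₗᵢ[ℝ] ULift.{u} F := LinearIsometryEquiv.ulift ℝ F |>.symm
  let φ' : ι → 𝓢(V, ULift.{u} F) := fun i =>
    postcompCLM (𝕜 := ℝ) (L : F →L[ℝ] ULift.{u} F) (φ i)
  have hnorm : ∀ i m x, ‖iteratedFDeriv ℝ m (φ' i) x‖ = ‖iteratedFDeriv ℝ m (φ i) x‖ :=
    fun i m x => L.norm_iteratedFDeriv_comp_left (φ i) x m
  have hb : IsSeminormBounded φ' := fun k n => by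
    obtain ⟨C, hC⟩ := h k n
    refine ⟨max C 0, fun i => seminorm_le_bound ℝ k n _ (le_max_right _ _) fun x => ?_⟩
    rw [hnorm]
    exact ((le_seminorm ℝ k n (φ i) x).trans (hC i)).trans (le_max_left _ _)
  have h0' : ∀ x, Tendsto (fun i => φ' i x) l (𝓝 0) := fun x => by
    have := (L.continuous.tendsto 0).comp (h0 x)
    rw [map_zero] at this
    exact this
  rw [Metric.tendsto_nhds]
  intro ε hε
  filter_upwards [IsSeminormBounded.eventually_norm_iteratedFDeriv_le.{u, v} hb h0' k n (half_pos hε)] with i hi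
  rw [dist_zero_right, Real.norm_of_nonneg (apply_nonneg _ _)]
  refine (seminorm_le_bound ℝ k n _ (half_pos hε).le fun x => ?_).trans_lt (half_lt_self hε)
  rw [← hnorm]
  exact hi x

theorem IsSeminormBounded.tendsto_zero [ProperSpace V] {φ : ι → 𝓢(V, F)}
    (h : IsSeminormBounded φ) {l : Filter ι} (h0 : ∀ x, Tendsto (fun i => φ i x) l (𝓝 0)) :
    Tendsto φ l (𝓝 0) := by
  rw [(schwartz_withSeminorms ℝ V F).tendsto_nhds]
  rintro ⟨k, n⟩ ε hε
  filter_upwards [(h.tendsto_seminorm h0 k n).eventually_lt_const hε] with i hi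
  simpa using hi

theorem IsSeminormBounded.sub {φ φ' : ι → 𝓢(V, F)} (h : IsSeminormBounded φ)
    (h' : IsSeminormBounded φ') : IsSeminormBounded fun i => φ i - φ' i := fun k n => by
  obtain ⟨C, hC⟩ := h k n
  obtain ⟨C', hC'⟩ := h' k n
  exact ⟨C + C', fun i => (map_sub_le_add _ _ _).trans (add_le_add (hC i) (hC' i))⟩

theorem isSeminormBounded_const (φ : 𝓢(V, F)) : IsSeminormBounded fun _ : ι => φ :=
  fun _ _ => ⟨_, fun _ => le_rfl⟩

theorem IsSeminormBounded.tendsto [ProperSpace V] {φ : ι → 𝓢(V, F)}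
    (h : IsSeminormBounded φ) {l : Filter ι} {φ₀ : 𝓢(V, F)}
    (h0 : ∀ x, Tendsto (fun i => φ i x) l (𝓝 (φ₀ x))) :
    Tendsto φ l (𝓝 φ₀) := by
  have := (h.sub (isSeminormBounded_const φ₀)).tendsto_zero (l := l) fun x => by
    simpa using (h0 x).sub_const (φ₀ x)
  simpa using this.add_const φ₀

end Montel

end SchwartzMap

namespace SchwartzMap

section Multipliers

variable {V W ι : Type*} [NormedAddCommGroup V] [NormedSpace ℝ V]
  [NormedAddCommGroup W] [NormedSpace ℝ W]

theorem seminorm_le_of_eq_mul (k n K : ℕ) {C : ℝ} (hC : 0 ≤ C) {g : V → ℂ} (hg : ContDiff ℝ ∞ g)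
    (hbound : ∀ j ≤ n, ∀ x, ‖iteratedFDeriv ℝ j g x‖ ≤ C * (1 + ‖x‖) ^ K) {φ φ' : 𝓢(V, ℂ)}
    (h : ∀ x, φ' x = g x * φ x) :
    SchwartzMap.seminorm ℝ k n φ' ≤ C * 2 ^ n * (2 ^ (k + K) *
      ((Finset.Iic (k + K, n)).sup fun m => SchwartzMap.seminorm ℝ m.1 m.2) φ) := by
  set p := ((Finset.Iic (k + K, n)).sup fun m => SchwartzMap.seminorm ℝ m.1 m.2) φ with hp
  have hp0 : 0 ≤ p := apply_nonneg _ _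
  refine seminorm_le_bound ℝ k n _ (by positivity) fun x => ?_
  have hfun : (φ' : V → ℂ) = fun x => g x * φ x := funext h
  rw [hfun]
  have h1 := norm_iteratedFDeriv_mul_le (𝕜 := ℝ) (N := ∞) hg (φ.smooth ⊤) x (n := n)
    (by exact_mod_cast le_top)
  have h2 : ∀ j ∈ Finset.range (n + 1), ‖x‖ ^ k * ((n.choose j : ℝ) * ‖iteratedFDeriv ℝ j g x‖ *
      ‖iteratedFDeriv ℝ (n - j) φ x‖) ≤ (n.choose j : ℝ) * (C * (2 ^ (k + K) * p)) := by
    intro j hj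
    have hjn : j ≤ n := Nat.lt_succ_iff.1 (Finset.mem_range.1 hj)
    have h3 : (1 + ‖x‖) ^ (k + K) * ‖iteratedFDeriv ℝ (n - j) φ x‖ ≤ 2 ^ (k + K) * p :=
      one_add_le_sup_seminorm_apply (𝕜 := ℝ) (m := (k + K, n)) le_rfl (Nat.sub_le n j) φ x
    have h4 : ‖x‖ ^ k ≤ (1 + ‖x‖) ^ k := by gcongr; linarith
    calc ‖x‖ ^ k * ((n.choose j : ℝ) * ‖iteratedFDeriv ℝ j g x‖ * ‖iteratedFDeriv ℝ (n - j) φ x‖)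
        ≤ (1 + ‖x‖) ^ k * ((n.choose j : ℝ) * (C * (1 + ‖x‖) ^ K) *
            ‖iteratedFDeriv ℝ (n - j) φ x‖) := by gcongr; exact hbound j hjn x
      _ = (n.choose j : ℝ) * (C * ((1 + ‖x‖) ^ (k + K) * ‖iteratedFDeriv ℝ (n - j) φ x‖)) := by
          ring
      _ ≤ _ := by gcongr
  calc ‖x‖ ^ k * ‖iteratedFDeriv ℝ n (fun x => g x * φ x) x‖
      ≤ ‖x‖ ^ k * ∑ j ∈ Finset.range (n + 1), (n.choose j : ℝ) * ‖iteratedFDeriv ℝ j g x‖ *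
          ‖iteratedFDeriv ℝ (n - j) φ x‖ := by gcongr
    _ ≤ ∑ j ∈ Finset.range (n + 1), (n.choose j : ℝ) * (C * (2 ^ (k + K) * p)) := by
        rw [Finset.mul_sum]; exact Finset.sum_le_sum h2
    _ = C * 2 ^ n * (2 ^ (k + K) * p) := by
        rw [← Finset.sum_mul, ← Nat.cast_sum, Nat.sum_range_choose]; push_cast; ring

/-- A family of functions whose derivatives have polynomial growth, uniformly in the family. -/
def IsUniformlyTemperate (g : ι → V → ℂ) : Prop :=
  (∀ i, ContDiff ℝ ∞ (g i)) ∧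
    ∀ n, ∃ (K : ℕ) (C : ℝ), ∀ i x, ‖iteratedFDeriv ℝ n (g i) x‖ ≤ C * (1 + ‖x‖) ^ K

theorem IsUniformlyTemperate.exists_le {g : ι → V → ℂ} (hg : IsUniformlyTemperate g) (n : ℕ) :
    ∃ (K : ℕ) (C : ℝ), 0 ≤ C ∧
      ∀ i, ∀ j ≤ n, ∀ x, ‖iteratedFDeriv ℝ j (g i) x‖ ≤ C * (1 + ‖x‖) ^ K := by
  choose K C h using hg.2
  refine ⟨∑ j ∈ Finset.range (n + 1), K j, ∑ j ∈ Finset.range (n + 1), |C j|,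
    Finset.sum_nonneg fun _ _ => abs_nonneg _, fun i j hj x => ?_⟩
  have hj' : j ∈ Finset.range (n + 1) := Finset.mem_range.2 (by omega)
  have h1 : C j ≤ ∑ j ∈ Finset.range (n + 1), |C j| :=
    (le_abs_self _).trans
      (Finset.single_le_sum (f := fun j => |C j|) (fun _ _ => abs_nonneg _) hj')
  have h2 : K j ≤ ∑ j ∈ Finset.range (n + 1), K j :=
    Finset.single_le_sum (f := K) (fun _ _ => Nat.zero_le _) hj'
  refine (h j i x).trans ?_
  have h3 : (1 + ‖x‖) ^ K j ≤ (1 + ‖x‖) ^ (∑ j ∈ Finset.range (n + 1), K j) :=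
    pow_le_pow_right₀ (by linarith [norm_nonneg x]) h2
  calc C j * (1 + ‖x‖) ^ K j ≤ (∑ j ∈ Finset.range (n + 1), |C j|) * (1 + ‖x‖) ^ K j := by gcongr
    _ ≤ _ := by
      gcongr

theorem IsSeminormBounded.exists_sup_le {φ : ι → 𝓢(V, ℂ)} (h : IsSeminormBounded φ) (m : ℕ × ℕ) :
    ∃ C, 0 ≤ C ∧
      ∀ i, ((Finset.Iic m).sup fun m => SchwartzMap.seminorm ℝ m.1 m.2) (φ i) ≤ C := by
  choose C hC using h
  have hsum : 0 ≤ ∑ m ∈ Finset.Iic m, |C m.1 m.2| := Finset.sum_nonneg fun _ _ => abs_nonneg _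
  refine ⟨∑ m ∈ Finset.Iic m, |C m.1 m.2|, hsum, fun i => ?_⟩
  refine Seminorm.finset_sup_apply_le hsum fun j hj => ?_
  exact (hC j.1 j.2 i).trans ((le_abs_self _).trans
    (Finset.single_le_sum (f := fun m : ℕ × ℕ => |C m.1 m.2|) (fun _ _ => abs_nonneg _) hj))

theorem IsSeminormBounded.of_eq_mul {φ φ' : ι → 𝓢(V, ℂ)} (h : IsSeminormBounded φ)
    {g : ι → V → ℂ} (hg : IsUniformlyTemperate g) (hφ : ∀ i x, φ' i x = g i x * φ i x) :
    IsSeminormBounded φ' := fun k n => by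
  obtain ⟨K, C, hC, hle⟩ := hg.exists_le n
  obtain ⟨D, hD, hDle⟩ := h.exists_sup_le (k + K, n)
  refine ⟨C * 2 ^ n * (2 ^ (k + K) * D), fun i => ?_⟩
  refine (seminorm_le_of_eq_mul k n K hC (hg.1 i) (hle i) (hφ i)).trans ?_
  gcongr
  exact hDle i

theorem norm_iteratedFDeriv_comp_clm_le {θ : W → ℂ} (hθ : ContDiff ℝ ∞ θ) (ℓ : V →L[ℝ] W) (n : ℕ)
    (x : V) :
    ‖iteratedFDeriv ℝ n (fun x => θ (ℓ x)) x‖ ≤ ‖iteratedFDeriv ℝ n θ (ℓ x)‖ * ‖ℓ‖ ^ n := by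
  have := ℓ.iteratedFDeriv_comp_right (f := θ) (n := ∞) (hθ) x (i := n) (by exact_mod_cast le_top)
  change ‖iteratedFDeriv ℝ n (θ ∘ ℓ) x‖ ≤ _
  rw [this]
  refine (ContinuousMultilinearMap.norm_compContinuousLinearMap_le _ _).trans ?_
  simp

theorem exists_norm_iteratedFDeriv_le_of_hasCompactSupport {θ : W → ℂ} (hθ : ContDiff ℝ ∞ θ)
    (hc : HasCompactSupport θ) (n : ℕ) : ∃ C, 0 ≤ C ∧ ∀ x, ‖iteratedFDeriv ℝ n θ x‖ ≤ C := by
  obtain ⟨C, hC⟩ := (hc.iteratedFDeriv (𝕜 := ℝ) n).exists_bound_of_continuous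
    (hθ.continuous_iteratedFDeriv (m := n) (by exact_mod_cast le_top))
  exact ⟨max C 0, le_max_right _ _, fun x => (hC x).trans (le_max_left _ _)⟩

theorem isUniformlyTemperate_comp_clm {θ : W → ℂ} (hθ : ContDiff ℝ ∞ θ)
    (hc : HasCompactSupport θ) {ℓ : ι → V →L[ℝ] W} {M : ℝ} (hℓ : ∀ i, ‖ℓ i‖ ≤ M) :
    IsUniformlyTemperate fun i x => θ (ℓ i x) := by
  refine ⟨fun i => hθ.comp (ℓ i).contDiff, fun n => ?_⟩
  obtain ⟨C, hC, hle⟩ := exists_norm_iteratedFDeriv_le_of_hasCompactSupport hθ hc n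
  refine ⟨0, C * M ^ n, fun i x => (norm_iteratedFDeriv_comp_clm_le hθ (ℓ i) n x).trans ?_⟩
  rw [pow_zero, mul_one]
  gcongr
  · exact hle _
  · exact hℓ i

end Multipliers

section WeakIntegral

variable {V : Type*} [NormedAddCommGroup V] [NormedSpace ℝ V]

theorem IsSeminormBounded.norm_le {ι : Type*} {φ : ι → 𝓢(V, ℂ)} (h : IsSeminormBounded φ) :
    ∃ C, ∀ i x, ‖φ i x‖ ≤ C := by
  obtain ⟨C, hC⟩ := h 0 0
  exact ⟨C, fun i x => (norm_le_seminorm ℝ (φ i) x).trans (hC i)⟩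

/-- If a tempered distribution kills every member of a seminorm-bounded, pointwise continuous
family of Schwartz functions, then it kills pointwise averages of that family. -/
theorem apply_eq_zero_of_eq_integral [ProperSpace V] {Ω : Type*} [PseudoMetricSpace Ω] [MeasurableSpace Ω]
    [BorelSpace Ω] [SecondCountableTopology Ω] [Nonempty Ω] (μ : Measure Ω) [IsFiniteMeasure μ]
    (T : 𝓢(V, ℂ) →L[ℂ] ℂ) {Φ : Ω → 𝓢(V, ℂ)} (hb : IsSeminormBounded Φ)
    (hcont : ∀ x, Continuous fun t => Φ t x) (hT : ∀ t, T (Φ t) = 0) {φ : 𝓢(V, ℂ)}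
    (hφ : ∀ x, φ x = ∫ t, Φ t x ∂μ) : T φ = 0 := by
  let s : ℕ → SimpleFunc Ω Ω := SimpleFunc.nearestPt (TopologicalSpace.denseSeq Ω)
  have hs : ∀ t, Tendsto (fun N => s N t) atTop (𝓝 t) := fun t =>
    SimpleFunc.tendsto_nearestPt (TopologicalSpace.denseRange_denseSeq Ω t)
  let S : ℕ → 𝓢(V, ℂ) := fun N =>
    ∑ c ∈ (s N).range, (μ.real (s N ⁻¹' {c}) : ℂ) • Φ c
  have hTS : ∀ N, T (S N) = 0 := fun N => by
    simp only [S, map_sum, map_smul, hT, smul_zero, Finset.sum_const_zero]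
  have hS : ∀ N x, S N x = ∫ t, Φ (s N t) x ∂μ := fun N x => by
    have h1 : ∀ t, Φ (s N t) x =
        ∑ c ∈ (s N).range, (s N ⁻¹' {c}).indicator (fun _ => Φ c x) t := fun t => by
      rw [Finset.sum_eq_single_of_mem (s N t) (SimpleFunc.mem_range_self _ _)]
      · simp
      · intro c _ hc
        exact Set.indicator_of_notMem (fun h => hc (by simpa using h.symm)) _
    simp_rw [h1]
    rw [integral_finsetSum]
    · simp only [S, _root_.sum_apply, _root_.smul_apply]
      refine Finset.sum_congr rfl fun c _ => ?_
      rw [integral_indicator_const _ ((s N).measurableSet_fiber c)]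
      rfl
    · exact fun c _ => (integrable_const _).indicator ((s N).measurableSet_fiber c)
  have hSb : IsSeminormBounded S := fun k n => by
    obtain ⟨C, hC⟩ := hb k n
    refine ⟨μ.real Set.univ * C, fun N => ?_⟩
    refine (Finset.le_sum_of_subadditive (SchwartzMap.seminorm ℝ k n) (map_zero _).le
      (map_add_le_add _) _ _).trans ?_
    have huniv : μ.real Set.univ = ∑ c ∈ (s N).range, μ.real (s N ⁻¹' {c}) := by
      simp only [Measure.real]
      rw [← (s N).sum_range_measure_preimage_singleton,
        ENNReal.toReal_sum fun _ _ => measure_ne_top _ _]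
    rw [huniv, Finset.sum_mul]
    refine Finset.sum_le_sum fun c _ => ?_
    have h2 : (μ.real (s N ⁻¹' {c}) : ℂ) • Φ c = μ.real (s N ⁻¹' {c}) • Φ c := by
      ext x; simp
    rw [h2, map_smul_eq_mul, Real.norm_of_nonneg measureReal_nonneg]
    gcongr
    exact hC c
  obtain ⟨C, hC⟩ := hb.norm_le
  have hlim : Tendsto S atTop (𝓝 φ) := hSb.tendsto fun x => by
    simp only [hS, hφ]
    refine tendsto_integral_of_dominated_convergence (fun _ => C) (fun N => ?_)
      (integrable_const C) (fun N => Eventually.of_forall fun t => hC _ _)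
      (Eventually.of_forall fun t => ((hcont x).tendsto t).comp (hs t))
    exact ((s N).map (fun c => Φ c x)).aestronglyMeasurable
  have := (T.continuous.tendsto φ).comp hlim
  simp only [Function.comp_def, hTS] at this
  exact (tendsto_nhds_unique this tendsto_const_nhds)

end WeakIntegral

end SchwartzMap

section CexpGrowth

variable {V : Type*} [NormedAddCommGroup V] [NormedSpace ℝ V]

theorem Function.HasTemperateGrowth.exists_norm_iteratedFDeriv_cexp_le {f : V → ℂ}
    (hf : f.HasTemperateGrowth) (n : ℕ) : ∃ (K : ℕ) (C : ℝ), 0 ≤ C ∧ ∀ x,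
      ‖iteratedFDeriv ℝ n (fun x => Complex.exp (f x)) x‖ ≤
        C * (1 + ‖x‖) ^ K * Real.exp (f x).re := by
  induction n using Nat.strong_induction_on with
  | _ n ih =>
    cases n with
    | zero =>
      refine ⟨0, 1, zero_le_one, fun x => ?_⟩
      rw [norm_iteratedFDeriv_zero, Complex.norm_exp]
      simp
    | succ n =>
      choose! K C hC hKC using ih
      obtain ⟨K', C', hC', h'⟩ := hf.norm_iteratedFDeriv_le_uniform (n + 1)
      have hsm : ContDiff ℝ ∞ fun x => Complex.exp (f x) := hf.1.cexp
      have hd : fderiv ℝ (fun x => Complex.exp (f x)) =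
          fun x => Complex.exp (f x) • fderiv ℝ f x := by
        ext1 x
        exact ((hf.1.differentiable (by simp)) x).hasFDerivAt.cexp.fderiv
      refine ⟨∑ j ∈ Finset.range (n + 1), K j + K',
        ∑ j ∈ Finset.range (n + 1), n.choose j * C j * C',
        Finset.sum_nonneg fun j hj => ?_, fun x => ?_⟩
      · have := hC j (Finset.mem_range.1 hj)
        positivity
      · rw [← norm_iteratedFDeriv_fderiv, hd]
        refine (norm_iteratedFDeriv_smul_le (𝕜 := ℝ) (N := ∞) hsm
          (hf.1.fderiv_right (m := ∞) (by simp)) x (n := n) (by exact_mod_cast le_top)).trans ?_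
        rw [Finset.sum_mul, Finset.sum_mul]
        refine Finset.sum_le_sum fun j hj => ?_
        have hj' := Finset.mem_range.1 hj
        have h1 := hKC j hj' x
        have h2 : ‖iteratedFDeriv ℝ (n - j) (fderiv ℝ f) x‖ ≤ C' * (1 + ‖x‖) ^ K' := by
          rw [norm_iteratedFDeriv_fderiv]
          exact h' _ (by omega) x
        have hCj := hC j hj'
        have hx1 : 1 ≤ 1 + ‖x‖ := by linarith [norm_nonneg x]
        have h3 : (1 + ‖x‖) ^ K j ≤ (1 + ‖x‖) ^ (∑ j ∈ Finset.range (n + 1), K j) :=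
          pow_le_pow_right₀ hx1
            (Finset.single_le_sum (f := K) (fun _ _ => Nat.zero_le _) hj)
        calc (n.choose j : ℝ) * ‖iteratedFDeriv ℝ j (fun x => Complex.exp (f x)) x‖ *
              ‖iteratedFDeriv ℝ (n - j) (fderiv ℝ f) x‖
            ≤ n.choose j * (C j * (1 + ‖x‖) ^ K j * Real.exp (f x).re) *
                (C' * (1 + ‖x‖) ^ K') := by gcongr
          _ ≤ n.choose j * (C j * (1 + ‖x‖) ^ (∑ j ∈ Finset.range (n + 1), K j) *
                Real.exp (f x).re) * (C' * (1 + ‖x‖) ^ K') := by gcongr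
          _ = _ := by rw [pow_add]; ring

theorem Function.HasTemperateGrowth.cexp_of_re_eq_zero {f : V → ℂ} (hf : f.HasTemperateGrowth)
    (h : ∀ x, (f x).re = 0) : (fun x => Complex.exp (f x)).HasTemperateGrowth := by
  refine ⟨hf.1.cexp, fun n => ?_⟩
  obtain ⟨K, C, -, hC⟩ := hf.exists_norm_iteratedFDeriv_cexp_le n
  refine ⟨K, C, fun x => ?_⟩
  simpa [h x] using hC x

theorem Function.HasTemperateGrowth.ofReal {f : V → ℝ} (hf : f.HasTemperateGrowth) :
    (fun x => (f x : ℂ)).HasTemperateGrowth :=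
  Complex.hasTemperateGrowth_ofReal.comp hf

theorem Function.HasTemperateGrowth.cexp_I_mul {f : V → ℝ} (hf : f.HasTemperateGrowth) :
    (fun x => Complex.exp (Complex.I * f x)).HasTemperateGrowth := by
  refine Function.HasTemperateGrowth.cexp_of_re_eq_zero ?_ (by simp)
  have := hf.ofReal
  fun_prop

theorem Function.HasTemperateGrowth.of_hasCompactSupport {f : V → ℂ} (hf : ContDiff ℝ ∞ f)
    (hc : HasCompactSupport f) : f.HasTemperateGrowth :=
  ⟨hf, fun n => by
    obtain ⟨C, -, hC⟩ := SchwartzMap.exists_norm_iteratedFDeriv_le_of_hasCompactSupport hf hc n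
    exact ⟨0, C, fun x => by simpa using hC x⟩⟩

end CexpGrowth

theorem exists_pow_mul_exp_neg_sq_le (K : ℕ) {c : ℝ} (hc : 0 < c) (b : ℝ) :
    ∃ C, ∀ t, 0 ≤ t → (1 + t) ^ K * Real.exp (b * t - c * t ^ 2) ≤ C := by
  have hbd : ∃ D, ∀ t : ℝ, 0 ≤ t → ((K : ℝ) + b) * t - c * t ^ 2 ≤ D :=
    ⟨((K : ℝ) + b) ^ 2 / (4 * c), fun t _ => by
      rw [le_div_iff₀ (by positivity)]
      nlinarith [sq_nonneg ((K : ℝ) + b - 2 * c * t)]⟩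
  obtain ⟨D, hD⟩ := hbd
  refine ⟨Real.exp D, fun t ht => ?_⟩
  have h1 : (1 + t) ^ K ≤ Real.exp (K * t) := by
    rw [Real.exp_nat_mul]
    gcongr
    linarith [Real.add_one_le_exp t]
  calc (1 + t) ^ K * Real.exp (b * t - c * t ^ 2)
      ≤ Real.exp (K * t) * Real.exp (b * t - c * t ^ 2) := by gcongr
    _ = Real.exp ((K + b) * t - c * t ^ 2) := by rw [← Real.exp_add]; ring_nf
    _ ≤ _ := Real.exp_le_exp.2 (hD t ht)

namespace SchwartzMap

section Gaussian

variable {V : Type*} [NormedAddCommGroup V] [InnerProductSpace ℝ V]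

theorem hasTemperateGrowth_neg_mul_norm_sq (c : ℝ) :
    (fun x : V => ((-(c * ‖x‖ ^ 2) : ℝ) : ℂ)).HasTemperateGrowth := by
  refine Function.HasTemperateGrowth.ofReal ?_
  have := Function.hasTemperateGrowth_norm_sq V
  fun_prop

/-- The Gaussian `exp (-c ‖x‖ ^ 2)` as a Schwartz function. -/
noncomputable def gaussian (V : Type*) [NormedAddCommGroup V] [InnerProductSpace ℝ V]
    (c : ℝ) (hc : 0 < c) : 𝓢(V, ℂ) where
  toFun x := Complex.exp ((-(c * ‖x‖ ^ 2) : ℝ) : ℂ)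
  smooth' := (hasTemperateGrowth_neg_mul_norm_sq (V := V) c).1.cexp
  decay' k n := by
    obtain ⟨K, C, hC0, hC⟩ :=
      (hasTemperateGrowth_neg_mul_norm_sq (V := V) c).exists_norm_iteratedFDeriv_cexp_le n
    obtain ⟨D, hD⟩ := exists_pow_mul_exp_neg_sq_le (k + K) hc 0
    refine ⟨C * D, fun x => ?_⟩
    have h1 : ‖x‖ ^ k ≤ (1 + ‖x‖) ^ k := by gcongr; linarith
    have h2 := hD ‖x‖ (norm_nonneg x)
    rw [zero_mul, zero_sub] at h2
    calc ‖x‖ ^ k * ‖iteratedFDeriv ℝ n (fun x : V => Complex.exp ((-(c * ‖x‖ ^ 2) : ℝ) : ℂ)) x‖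
        ≤ (1 + ‖x‖) ^ k * (C * (1 + ‖x‖) ^ K * Real.exp (-(c * ‖x‖ ^ 2))) := by
          gcongr
          simpa only [Complex.ofReal_re] using hC x
      _ = C * ((1 + ‖x‖) ^ (k + K) * Real.exp (-(c * ‖x‖ ^ 2))) := by ring
      _ ≤ C * D := by gcongr

theorem gaussian_apply {c : ℝ} (hc : 0 < c) (x : V) :
    gaussian V c hc x = Complex.exp ((-(c * ‖x‖ ^ 2) : ℝ) : ℂ) := rfl

end Gaussian

section ExpPartialSums

/-- Taylor polynomials of `exp (i t)`. -/
noncomputable def expTaylor (K : ℕ) (t : ℝ) : ℂ :=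
  ∑ m ∈ Finset.range K, (Complex.I * t) ^ m / m.factorial

theorem contDiff_expTaylor (K : ℕ) : ContDiff ℝ ∞ (expTaylor K) := by
  unfold expTaylor
  have : ContDiff ℝ ∞ fun t : ℝ => (t : ℂ) := Complex.ofRealCLM.contDiff
  fun_prop

theorem deriv_expTaylor_succ (K : ℕ) :
    deriv (expTaylor (K + 1)) = fun t => Complex.I * expTaylor K t := by
  ext1 t
  refine HasDerivAt.deriv ?_
  induction K with
  | zero =>
    have h1 : expTaylor (0 + 1) = fun _ => 1 := by ext1; simp [expTaylor]
    rw [h1]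
    simpa [expTaylor] using hasDerivAt_const t (1 : ℂ)
  | succ K ih =>
    have h : HasDerivAt (fun t : ℝ => (Complex.I * t) ^ (K + 1) / ((K + 1).factorial : ℂ))
        (Complex.I * ((Complex.I * t) ^ K / K.factorial)) t := by
      have h1 : HasDerivAt (fun t : ℝ => Complex.I * (t : ℂ)) Complex.I t := by
        simpa using (Complex.ofRealCLM.hasDerivAt (x := t)).const_mul Complex.I
      have h3 := (h1.pow (K + 1)).div_const ((K + 1).factorial : ℂ)
      refine h3.congr_deriv ?_
      rw [Nat.factorial_succ]
      push_cast
      have := Nat.cast_add_one_ne_zero (R := ℂ) K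
      have h2 : (K.factorial : ℂ) ≠ 0 := by exact_mod_cast K.factorial_ne_zero
      field_simp
    have := ih.add h
    convert this using 1
    · ext1 s
      simp [expTaylor, Finset.sum_range_succ]
    · simp [expTaylor, Finset.sum_range_succ, mul_add]

theorem norm_iteratedDeriv_expTaylor_le (n K : ℕ) (t : ℝ) :
    ‖iteratedDeriv n (expTaylor K) t‖ ≤ Real.exp |t| := by
  induction n generalizing K with
  | zero =>
    rw [iteratedDeriv_zero]
    calc ‖expTaylor K t‖ ≤ ∑ m ∈ Finset.range K, |t| ^ m / m.factorial := by
          refine (norm_sum_le _ _).trans (le_of_eq (Finset.sum_congr rfl fun m _ => ?_))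
          simp
      _ ≤ _ := Real.sum_le_exp_of_nonneg (abs_nonneg t) K
  | succ n ih =>
    rw [iteratedDeriv_succ']
    cases K with
    | zero =>
      have : deriv (expTaylor 0) = fun _ => 0 := by
        ext1 t
        have : expTaylor 0 = fun _ => 0 := by ext1; simp [expTaylor]
        simp [this]
      rw [this]
      simp [Real.exp_nonneg]
    | succ K =>
      rw [deriv_expTaylor_succ, iteratedDeriv_const_mul_field]
      simpa using ih K

theorem tendsto_expTaylor (t : ℝ) :
    Tendsto (fun K => expTaylor K t) atTop (𝓝 (Complex.exp (Complex.I * t))) := by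
  rw [Complex.exp_eq_exp_ℂ]
  exact (NormedSpace.expSeries_div_hasSum_exp (Complex.I * (t : ℂ))).tendsto_sum_nat

end ExpPartialSums

end SchwartzMap

namespace SchwartzMap

section Density

variable {V : Type*} [NormedAddCommGroup V] [InnerProductSpace ℝ V] [FiniteDimensional ℝ V]

theorem exists_contDiff_bump (W : Type*) [NormedAddCommGroup W] [InnerProductSpace ℝ W]
    [FiniteDimensional ℝ W] : ∃ B : W → ℂ, ContDiff ℝ ∞ B ∧ HasCompactSupport B ∧
      (∀ x, ‖x‖ ≤ 1 → B x = 1) ∧ ∀ x, ‖B x‖ ≤ 1 := by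
  let b : ContDiffBump (0 : W) := ⟨1, 2, one_pos, one_lt_two⟩
  refine ⟨fun x => (b x : ℂ), Complex.ofRealCLM.contDiff.comp b.contDiff, ?_, fun x hx => ?_,
    fun x => ?_⟩
  · exact b.hasCompactSupport.comp_left (g := fun t : ℝ => (t : ℂ)) (by simp)
  · simp [b.one_of_mem_closedBall (show x ∈ Metric.closedBall 0 b.rIn by simpa using hx)]
  · rw [Complex.norm_real, Real.norm_of_nonneg b.nonneg]
    exact b.le_one

/-- A tempered distribution killing all smooth compactly supported functions is zero. -/
theorem clm_eq_zero_of_forall_hasCompactSupport (T : 𝓢(V, ℂ) →L[ℂ] ℂ)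
    (hT : ∀ φ : 𝓢(V, ℂ), HasCompactSupport φ → T φ = 0) : T = 0 := by
  obtain ⟨B, hB, hBc, hB1, -⟩ := exists_contDiff_bump V
  ext φ
  let ℓ : ℕ → V →L[ℝ] V := fun n => ((n : ℝ) + 1)⁻¹ • ContinuousLinearMap.id ℝ V
  have hℓ : ∀ n, ‖ℓ n‖ ≤ 1 := fun n => by
    have h1 : ((n : ℝ) + 1)⁻¹ ≤ 1 := inv_le_one_of_one_le₀ (by linarith [n.cast_nonneg (α := ℝ)])
    calc ‖ℓ n‖ = ((n : ℝ) + 1)⁻¹ * ‖ContinuousLinearMap.id ℝ V‖ := by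
          rw [norm_smul, Real.norm_of_nonneg (by positivity)]
      _ ≤ 1 * 1 := by gcongr; exact ContinuousLinearMap.norm_id_le
      _ = 1 := one_mul 1
  have hg := isUniformlyTemperate_comp_clm hB hBc hℓ
  have hcs : ∀ n, HasCompactSupport fun x => B (ℓ n x) := fun n =>
    hBc.comp_smul (c := ((n : ℝ) + 1)⁻¹) (by positivity)
  have htg : ∀ n, (fun x => B (ℓ n x)).HasTemperateGrowth := fun n =>
    .of_hasCompactSupport (hg.1 n) (hcs n)
  let Φ : ℕ → 𝓢(V, ℂ) := fun n => smulLeftCLM ℂ (fun x => B (ℓ n x)) φ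
  have hΦ : ∀ n x, Φ n x = B (ℓ n x) * φ x := fun n x => by
    rw [smulLeftCLM_apply_apply (htg n), smul_eq_mul]
  have hb : IsSeminormBounded Φ := (isSeminormBounded_const φ).of_eq_mul hg hΦ
  have hlim : Tendsto Φ atTop (𝓝 φ) := hb.tendsto fun x => by
    refine tendsto_const_nhds.congr' ?_
    obtain ⟨N, hN⟩ := exists_nat_ge ‖x‖
    filter_upwards [eventually_ge_atTop N] with n hn
    rw [hΦ, hB1, one_mul]
    have hn' : (N : ℝ) ≤ n := by exact_mod_cast hn
    have : ‖ℓ n x‖ = ((n : ℝ) + 1)⁻¹ * ‖x‖ := by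
      simp only [ℓ, _root_.smul_apply, ContinuousLinearMap.id_apply]
      rw [norm_smul, Real.norm_of_nonneg (by positivity)]
    rw [this, inv_mul_le_iff₀ (by positivity)]
    linarith
  have h0 : ∀ n, T (Φ n) = 0 := fun n => hT _ (by
    have : (Φ n : V → ℂ) = (fun x => B (ℓ n x)) * φ := by ext x; exact hΦ n x
    rw [this]
    exact (hcs n).mul_right)
  have := (T.continuous.tendsto φ).comp hlim
  simp only [Function.comp_def, h0] at this
  exact tendsto_nhds_unique this tendsto_const_nhds

end Density

section GaussianMoments

variable {V : Type*} [NormedAddCommGroup V] [InnerProductSpace ℝ V]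

theorem contDiff_expTaylor_inner (K : ℕ) (y : V) :
    ContDiff ℝ ∞ fun x : V => expTaylor K (inner ℝ x y) :=
  (contDiff_expTaylor K).comp (contDiff_id.inner ℝ contDiff_const)

theorem norm_iteratedFDeriv_expTaylor_inner_le (n K : ℕ) (x y : V) :
    ‖iteratedFDeriv ℝ n (fun x : V => expTaylor K (inner ℝ x y)) x‖ ≤
      Real.exp (‖y‖ * ‖x‖) * ‖y‖ ^ n := by
  have h := norm_iteratedFDeriv_comp_clm_le (contDiff_expTaylor K) (innerSL ℝ y) n x
  have h1 : (fun x : V => expTaylor K (inner ℝ x y)) = fun x => expTaylor K (innerSL ℝ y x) := by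
    ext1 x; rw [innerSL_apply_apply, real_inner_comm]
  rw [h1]
  refine h.trans ?_
  rw [innerSL_apply_norm, norm_iteratedFDeriv_eq_norm_iteratedDeriv]
  gcongr
  refine (norm_iteratedDeriv_expTaylor_le n K _).trans (Real.exp_le_exp.2 ?_)
  rw [innerSL_apply_apply]
  exact abs_real_inner_le_norm y x

theorem isUniformlyTemperate_expTaylor_mul_gaussian (y : V) {c : ℝ} (hc : 0 < c) :
    IsUniformlyTemperate fun (K : ℕ) (x : V) => expTaylor K (inner ℝ x y) * gaussian V c hc x := by
  refine ⟨fun K => (contDiff_expTaylor_inner K y).mul ((gaussian V c hc).smooth ⊤), fun n => ?_⟩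
  obtain ⟨M, C, hC0, hC⟩ : ∃ (M : ℕ) (C : ℝ), 0 ≤ C ∧ ∀ j ≤ n, ∀ x,
      ‖iteratedFDeriv ℝ j (gaussian V c hc) x‖ ≤
        C * (1 + ‖x‖) ^ M * Real.exp (-(c * ‖x‖ ^ 2)) := by
    have := fun n => (hasTemperateGrowth_neg_mul_norm_sq (V := V) c).exists_norm_iteratedFDeriv_cexp_le n
    choose M C hC0 hC using this
    refine ⟨∑ j ∈ Finset.range (n + 1), M j, ∑ j ∈ Finset.range (n + 1), C j,
      Finset.sum_nonneg fun j _ => hC0 j, fun j hj x => ?_⟩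
    have hj' : j ∈ Finset.range (n + 1) := Finset.mem_range.2 (by omega)
    refine (hC j x).trans ?_
    rw [Complex.ofReal_re]
    have h1 : C j ≤ ∑ j ∈ Finset.range (n + 1), C j :=
      Finset.single_le_sum (f := C) (fun j _ => hC0 j) hj'
    have h2 : (1 + ‖x‖) ^ M j ≤ (1 + ‖x‖) ^ (∑ j ∈ Finset.range (n + 1), M j) :=
      pow_le_pow_right₀ (by linarith [norm_nonneg x])
        (Finset.single_le_sum (f := M) (fun _ _ => Nat.zero_le _) hj')
    have := h1.trans' (hC0 j)
    gcongr
  obtain ⟨D, hD⟩ := exists_pow_mul_exp_neg_sq_le M hc ‖y‖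
  refine ⟨0, ∑ j ∈ Finset.range (n + 1), n.choose j * ‖y‖ ^ j * (C * D), fun K x => ?_⟩
  rw [pow_zero, mul_one]
  refine (norm_iteratedFDeriv_mul_le (𝕜 := ℝ) (N := ∞) (contDiff_expTaylor_inner K y)
    ((gaussian V c hc).smooth ⊤) x (n := n) (by exact_mod_cast le_top)).trans ?_
  refine Finset.sum_le_sum fun j _ => ?_
  calc (n.choose j : ℝ) * ‖iteratedFDeriv ℝ j (fun x : V => expTaylor K (inner ℝ x y)) x‖ *
        ‖iteratedFDeriv ℝ (n - j) (gaussian V c hc) x‖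
      ≤ n.choose j * (Real.exp (‖y‖ * ‖x‖) * ‖y‖ ^ j) *
          (C * (1 + ‖x‖) ^ M * Real.exp (-(c * ‖x‖ ^ 2))) := by
        gcongr
        · exact norm_iteratedFDeriv_expTaylor_inner_le j K x y
        · exact hC _ (Nat.sub_le _ _) x
    _ = n.choose j * ‖y‖ ^ j *
          (C * ((1 + ‖x‖) ^ M * Real.exp (‖y‖ * ‖x‖ - c * ‖x‖ ^ 2))) := by
        rw [sub_eq_add_neg, Real.exp_add]; ring
    _ ≤ _ := by
        gcongr
        exact hD ‖x‖ (norm_nonneg x)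

theorem hasTemperateGrowth_inner_pow (y : V) (k : ℕ) :
    (fun x : V => ((inner ℝ x y : ℝ) : ℂ) ^ k).HasTemperateGrowth := by
  have : (fun x : V => ((inner ℝ x y : ℝ) : ℂ)).HasTemperateGrowth :=
    (Function.hasTemperateGrowth_inner_left y).ofReal
  fun_prop

theorem hasTemperateGrowth_cexp_inner (y : V) :
    (fun x : V => Complex.exp (Complex.I * ((inner ℝ x y : ℝ) : ℂ))).HasTemperateGrowth :=
  (Function.hasTemperateGrowth_inner_left y).cexp_I_mul

theorem apply_cexp_mul_gaussian_eq_zero [FiniteDimensional ℝ V] (T : 𝓢(V, ℂ) →L[ℂ] ℂ)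
    (hT : ∀ (y : V) (k : ℕ),
      T (smulLeftCLM ℂ (fun x : V => ((inner ℝ x y : ℝ) : ℂ) ^ k) (gaussian V 1 one_pos)) = 0)
    (y : V) :
    T (smulLeftCLM ℂ (fun x : V => Complex.exp (Complex.I * ((inner ℝ x y : ℝ) : ℂ)))
      (gaussian V 1 one_pos)) = 0 := by
  let S : ℕ → 𝓢(V, ℂ) := fun K => ∑ m ∈ Finset.range K, (Complex.I ^ m / m.factorial) •
    smulLeftCLM ℂ (fun x : V => ((inner ℝ x y : ℝ) : ℂ) ^ m) (gaussian V 1 one_pos)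
  have hS : ∀ K x, S K x = expTaylor K (inner ℝ x y) * gaussian V 1 one_pos x := fun K x => by
    simp only [S, _root_.sum_apply, _root_.smul_apply, smulLeftCLM_apply_apply (hasTemperateGrowth_inner_pow y _),
      expTaylor, Finset.sum_mul, smul_eq_mul]
    refine Finset.sum_congr rfl fun m _ => ?_
    rw [mul_pow]; ring
  have hhalf : ∀ x : V, gaussian V 1 one_pos x =
      gaussian V (1 / 2) (by norm_num) x * gaussian V (1 / 2) (by norm_num) x := fun x => by
    simp only [gaussian_apply, ← Complex.exp_add]
    congr 1
    push_cast
    ring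
  have hb : IsSeminormBounded S :=
    (isSeminormBounded_const (gaussian V (1 / 2) (by norm_num))).of_eq_mul
      (isUniformlyTemperate_expTaylor_mul_gaussian y (c := 1 / 2) (by norm_num)) fun K x => by
        rw [hS, hhalf, mul_assoc]
  have hlim : Tendsto S atTop (𝓝 _) := hb.tendsto
    (φ₀ := smulLeftCLM ℂ (fun x : V => Complex.exp (Complex.I * ((inner ℝ x y : ℝ) : ℂ)))
      (gaussian V 1 one_pos)) fun x => by
    simp only [hS, smulLeftCLM_apply_apply (hasTemperateGrowth_cexp_inner y), smul_eq_mul]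
    exact (tendsto_expTaylor _).mul_const _
  have := (T.continuous.tendsto _).comp hlim
  simp only [Function.comp_def, S, map_sum, map_smul, hT, smul_zero, Finset.sum_const_zero] at this
  exact tendsto_nhds_unique this tendsto_const_nhds

end GaussianMoments

end SchwartzMap

namespace SchwartzMap

section GaussianMoments

variable {V : Type*} [NormedAddCommGroup V] [InnerProductSpace ℝ V]

theorem exists_norm_iteratedFDeriv_cexp_inner_le (n : ℕ) : ∃ (K : ℕ) (C : ℝ), 0 ≤ C ∧ ∀ x y : V,
    ‖iteratedFDeriv ℝ n (fun x : V => Complex.exp (Complex.I * ((inner ℝ x y : ℝ) : ℂ))) x‖ ≤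
      C * (1 + ‖y‖) ^ K * (1 + ‖x‖) ^ K := by
  have hθ : (fun t : ℝ => Complex.exp (Complex.I * (t : ℂ))).HasTemperateGrowth :=
    Function.HasTemperateGrowth.id'.cexp_I_mul
  obtain ⟨K, C, hC⟩ := hθ.2 n
  have hC0 : 0 ≤ C := by
    have := hC 0
    simp only [norm_zero, add_zero, one_pow, mul_one] at this
    exact (norm_nonneg _).trans this
  refine ⟨K + n, C, hC0, fun x y => ?_⟩
  have h1 : (fun x : V => Complex.exp (Complex.I * ((inner ℝ x y : ℝ) : ℂ))) =
      fun x => (fun t : ℝ => Complex.exp (Complex.I * (t : ℂ))) (innerSL ℝ y x) := by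
    ext1 x; rw [innerSL_apply_apply, real_inner_comm]
  rw [h1]
  refine (norm_iteratedFDeriv_comp_clm_le hθ.1 (innerSL ℝ y) n x).trans ?_
  rw [innerSL_apply_norm]
  have h2 : ‖innerSL ℝ y x‖ ≤ ‖y‖ * ‖x‖ := by
    rw [innerSL_apply_apply]; exact abs_real_inner_le_norm y x
  have hx := norm_nonneg x
  have hy := norm_nonneg y
  have h3 : 1 + ‖innerSL ℝ y x‖ ≤ (1 + ‖y‖) * (1 + ‖x‖) := by nlinarith
  calc ‖iteratedFDeriv ℝ n (fun t : ℝ => Complex.exp (Complex.I * (t : ℂ))) (innerSL ℝ y x)‖ *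
        ‖y‖ ^ n ≤ C * ((1 + ‖y‖) * (1 + ‖x‖)) ^ K * (1 + ‖y‖) ^ n := by
        gcongr
        · refine (hC _).trans ?_
          gcongr
        · linarith
    _ = C * (1 + ‖y‖) ^ (K + n) * (1 + ‖x‖) ^ K := by
        rw [mul_pow, pow_add]; ring
    _ ≤ _ := by
        gcongr
        · linarith
        · omega

variable [FiniteDimensional ℝ V] [MeasurableSpace V] [BorelSpace V]

theorem apply_smulLeftCLM_eq_zero_of_cexp (T : 𝓢(V, ℂ) →L[ℂ] ℂ) (G : 𝓢(V, ℂ))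
    (hT : ∀ y : V, T (smulLeftCLM ℂ
      (fun x : V => Complex.exp (Complex.I * ((inner ℝ x y : ℝ) : ℂ))) G) = 0)
    (b : 𝓢(V, ℂ)) : T (smulLeftCLM ℂ b G) = 0 := by
  set r : ℕ := Module.finrank ℝ V + 1 with hr
  set β : 𝓢(V, ℂ) := 𝓕 b with hβ
  let w : V → ℝ := fun y => (1 + ‖y‖) ^ (-(r : ℝ))
  have hw0 : ∀ y, 0 < w y := fun y => by positivity
  have hwint : Integrable w := integrable_one_add_norm (by rw [hr]; push_cast; linarith)
  have hwc : Continuous w := by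
    refine Continuous.rpow_const (by fun_prop) fun y => Or.inl (by positivity)
  have hwr : ∀ y, w y * (1 + ‖y‖) ^ r = 1 := fun y => by
    have : 0 < 1 + ‖y‖ := by positivity
    simp only [w]
    rw [Real.rpow_neg this.le, Real.rpow_natCast, inv_mul_cancel₀ (by positivity)]
  let μ : Measure V := volume.withDensity fun y => ENNReal.ofReal (w y)
  have hμ : IsFiniteMeasure μ := isFiniteMeasure_withDensity_ofReal hwint.2
  have htg := fun y : V => hasTemperateGrowth_cexp_inner ((2 * Real.pi) • y)
  let g : V → V → ℂ := fun y x => (((1 + ‖y‖) ^ r : ℝ) : ℂ) * β y *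
    Complex.exp (Complex.I * ((inner ℝ x ((2 * Real.pi) • y) : ℝ) : ℂ))
  let Φ : V → 𝓢(V, ℂ) := fun y => ((((1 + ‖y‖) ^ r : ℝ) : ℂ) * β y) •
    smulLeftCLM ℂ (fun x : V => Complex.exp
      (Complex.I * ((inner ℝ x ((2 * Real.pi) • y) : ℝ) : ℂ))) G
  have hΦ : ∀ y x, Φ y x = g y x * G x := fun y x => by
    simp only [Φ, g, _root_.smul_apply, smulLeftCLM_apply_apply (htg y), smul_eq_mul]
    ring
  have hg : IsUniformlyTemperate g := by
    refine ⟨fun y => contDiff_const.mul (htg y).1, fun n => ?_⟩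
    obtain ⟨K, C, hC0, hC⟩ := exists_norm_iteratedFDeriv_cexp_inner_le (V := V) n
    obtain ⟨D, hD0, hD⟩ : ∃ D, 0 ≤ D ∧ ∀ y, (1 + ‖y‖) ^ (r + K) * ‖β y‖ ≤ D := by
      refine ⟨2 ^ (r + K) * ((Finset.Iic (r + K, 0)).sup
        fun m => SchwartzMap.seminorm ℝ m.1 m.2) β, ?_, fun y => ?_⟩
      rotate_left
      · have := one_add_le_sup_seminorm_apply (𝕜 := ℝ) (m := (r + K, 0)) (k := r + K) (n := 0)
          le_rfl le_rfl β y
        rwa [norm_iteratedFDeriv_zero] at this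
      · have : 0 ≤ ((Finset.Iic (r + K, 0)).sup
          fun m => SchwartzMap.seminorm ℝ m.1 m.2) β := apply_nonneg _ _
        positivity
    refine ⟨K, D * C * (1 + 2 * Real.pi) ^ K, fun y x => ?_⟩
    have hpi := Real.pi_pos
    have h1 : iteratedFDeriv ℝ n (g y) x = ((((1 + ‖y‖) ^ r : ℝ) : ℂ) * β y) •
        iteratedFDeriv ℝ n (fun x : V => Complex.exp
          (Complex.I * ((inner ℝ x ((2 * Real.pi) • y) : ℝ) : ℂ))) x := by
      have := iteratedFDeriv_const_smul_apply (𝕜 := ℝ) (i := n) (x := x)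
        (a := (((1 + ‖y‖) ^ r : ℝ) : ℂ) * β y)
        (((htg y).1.of_le (m := (n : WithTop ℕ∞)) (mod_cast le_top)).contDiffAt)
      exact this
    rw [h1, norm_smul, norm_mul, Complex.norm_real, Real.norm_of_nonneg (by positivity)]
    have h2 : ‖(2 * Real.pi) • y‖ = 2 * Real.pi * ‖y‖ := by
      rw [norm_smul, Real.norm_of_nonneg (by positivity)]
    have h3 : 1 + 2 * Real.pi * ‖y‖ ≤ (1 + 2 * Real.pi) * (1 + ‖y‖) := by
      nlinarith [norm_nonneg y]
    calc (1 + ‖y‖) ^ r * ‖β y‖ * _ ≤ (1 + ‖y‖) ^ r * ‖β y‖ *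
          (C * ((1 + 2 * Real.pi) * (1 + ‖y‖)) ^ K * (1 + ‖x‖) ^ K) := by
          gcongr
          refine (hC x _).trans ?_
          rw [h2]
          gcongr
      _ = ((1 + ‖y‖) ^ (r + K) * ‖β y‖) * C * (1 + 2 * Real.pi) ^ K * (1 + ‖x‖) ^ K := by
          rw [mul_pow, pow_add]; ring
      _ ≤ _ := by
          gcongr
          exact hD y
  have hb : IsSeminormBounded Φ := (isSeminormBounded_const G).of_eq_mul hg hΦ
  refine apply_eq_zero_of_eq_integral μ T hb (fun x => ?_) (fun y => ?_) fun x => ?_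
  · simp only [hΦ, g]
    have := β.continuous
    fun_prop
  · simp only [Φ, map_smul, hT, smul_zero]
  · rw [smulLeftCLM_apply_apply b.hasTemperateGrowth, smul_eq_mul]
    have h1 : b x = ∫ y, Complex.exp (Complex.I * ((inner ℝ x ((2 * Real.pi) • y) : ℝ) : ℂ)) *
        β y := by
      have h2 : b = 𝓕⁻ β := (FourierTransform.fourierInv_fourier_eq b).symm
      rw [h2, fourierInv_coe, Real.fourierInv_eq']
      refine integral_congr_ae (Eventually.of_forall fun y => ?_)
      simp only [smul_eq_mul, real_inner_smul_right]
      rw [real_inner_comm]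
      congr 2
      push_cast
      ring
    rw [integral_withDensity_eq_integral_toReal_smul₀ (by fun_prop) (by simp)]
    simp only [ENNReal.toReal_ofReal (hw0 _).le]
    rw [h1, ← integral_mul_const]
    refine integral_congr_ae (Eventually.of_forall fun y => ?_)
    simp only [hΦ, g, Complex.real_smul]
    have := hwr y
    have h3 : (w y : ℂ) * (((1 + ‖y‖) ^ r : ℝ) : ℂ) = 1 := by exact_mod_cast this
    linear_combination (-(Complex.exp (Complex.I * ((inner ℝ x ((2 * Real.pi) • y) : ℝ) : ℂ)) *
        β y * G x)) * h3

/-- A tempered distribution is determined by its values on polynomial multiples of the standard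
Gaussian. -/
theorem clm_eq_zero_of_gaussian_moments (T : 𝓢(V, ℂ) →L[ℂ] ℂ)
    (hT : ∀ (y : V) (k : ℕ),
      T (smulLeftCLM ℂ (fun x : V => ((inner ℝ x y : ℝ) : ℂ) ^ k) (gaussian V 1 one_pos)) = 0) :
    T = 0 := by
  refine clm_eq_zero_of_forall_hasCompactSupport T fun φ hφ => ?_
  have hsm : ContDiff ℝ ∞ fun x : V => Complex.exp ((‖x‖ ^ 2 : ℝ) : ℂ) * φ x := by
    refine ContDiff.mul ?_ (φ.smooth ⊤)
    exact (Function.hasTemperateGrowth_norm_sq V).ofReal.1.cexp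
  have hcs : HasCompactSupport fun x : V => Complex.exp ((‖x‖ ^ 2 : ℝ) : ℂ) * φ x :=
    HasCompactSupport.mul_left hφ
  have h := apply_smulLeftCLM_eq_zero_of_cexp T (gaussian V 1 one_pos)
    (apply_cexp_mul_gaussian_eq_zero T hT) (hcs.toSchwartzMap hsm)
  convert h using 2
  ext x
  rw [smulLeftCLM_apply_apply (SchwartzMap.hasTemperateGrowth _), gaussian_apply]
  change φ x = (Complex.exp ((‖x‖ ^ 2 : ℝ) : ℂ) * φ x) * _
  rw [mul_right_comm, ← Complex.exp_add]
  simp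

end GaussianMoments

end SchwartzMap

namespace SchwartzMap

section FirstOrder

variable {V : Type*} [NormedAddCommGroup V] [NormedSpace ℝ V]

/-- `T.Annihilates g W`: the tempered distribution `T` vanishes on the image of the first order
differential operator `φ ↦ g φ + W φ`. -/
def Annihilates (T : 𝓢(V, ℂ) →L[ℂ] ℂ) (g : V → ℂ) (W : V → V) : Prop :=
  ∀ φ φ' : 𝓢(V, ℂ), (∀ x, φ' x = g x * φ x + fderiv ℝ φ x (W x)) → T φ' = 0

theorem exists_mul {g : V → ℂ} (hg : g.HasTemperateGrowth) (φ : 𝓢(V, ℂ)) :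
    ∃ φ' : 𝓢(V, ℂ), ∀ x, φ' x = g x * φ x :=
  ⟨smulLeftCLM ℂ g φ, fun x => by rw [smulLeftCLM_apply_apply hg, smul_eq_mul]⟩

theorem exists_fderiv_apply {W : V → V} (hW : W.HasTemperateGrowth) (φ : 𝓢(V, ℂ)) :
    ∃ φ' : 𝓢(V, ℂ), ∀ x, φ' x = fderiv ℝ φ x (W x) :=
  ⟨bilinLeftCLM (ContinuousLinearMap.id ℝ (V →L[ℝ] ℂ)) hW (fderivCLM ℝ V ℂ φ), fun x => by
    rw [bilinLeftCLM_apply]; rfl⟩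

theorem exists_firstOrder {g : V → ℂ} (hg : g.HasTemperateGrowth) {W : V → V}
    (hW : W.HasTemperateGrowth) (φ : 𝓢(V, ℂ)) :
    ∃ φ' : 𝓢(V, ℂ), ∀ x, φ' x = g x * φ x + fderiv ℝ φ x (W x) := by
  obtain ⟨φ₁, h₁⟩ := exists_mul hg φ
  obtain ⟨φ₂, h₂⟩ := exists_fderiv_apply hW φ
  exact ⟨φ₁ + φ₂, fun x => by rw [_root_.add_apply, h₁, h₂]⟩

theorem exists_comp_equiv (a : V ≃L[ℝ] V) (φ : 𝓢(V, ℂ)) : ∃ φ' : 𝓢(V, ℂ), ∀ x, φ' x = φ (a x) :=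
  ⟨compCLMOfContinuousLinearEquiv ℝ a φ, fun _ => rfl⟩

namespace Annihilates

variable {T : 𝓢(V, ℂ) →L[ℂ] ℂ} {g g₁ g₂ h : V → ℂ} {W W₁ W₂ : V → V}

theorem congr (H : Annihilates T g₁ W₁) (hg : ∀ x, g₂ x = g₁ x) (hW : ∀ x, W₂ x = W₁ x) :
    Annihilates T g₂ W₂ := fun φ φ' hφ => H φ φ' fun x => by rw [hφ, hg, hW]

theorem add (H₁ : Annihilates T g₁ W₁) (H₂ : Annihilates T g₂ W₂) (hg₁ : g₁.HasTemperateGrowth)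
    (hW₁ : W₁.HasTemperateGrowth) :
    Annihilates T (fun x => g₁ x + g₂ x) (fun x => W₁ x + W₂ x) := fun φ φ' hφ => by
  obtain ⟨φ₁, h₁⟩ := exists_firstOrder hg₁ hW₁ φ
  have h₂ := H₂ φ (φ' - φ₁) fun x => by rw [_root_.sub_apply, hφ, h₁, map_add]; ring
  rw [map_sub, H₁ φ φ₁ h₁, sub_zero] at h₂
  exact h₂

theorem smul (H : Annihilates T g W) {k : V → ℝ} (hk : k.HasTemperateGrowth)
    (hkW : ∀ x, fderiv ℝ k x (W x) = 0) :
    Annihilates T (fun x => k x * g x) (fun x => k x • W x) := fun φ φ' hφ => by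
  obtain ⟨φ₁, h₁⟩ := exists_mul hk.ofReal φ
  refine H φ₁ φ' fun x => ?_
  have h2 : (φ₁ : V → ℂ) = fun x => k x • φ x := by ext x; rw [h₁, Complex.real_smul]
  have h3 : fderiv ℝ φ₁ x = k x • fderiv ℝ φ x + (fderiv ℝ k x).smulRight (φ x) := by
    rw [h2]
    exact fderiv_fun_smul (hk.1.differentiable (by simp) x) φ.differentiableAt
  rw [hφ, h3, h₁]
  simp only [_root_.add_apply, ContinuousLinearMap.smulRight_apply, hkW, map_smul, zero_smul]
  rw [_root_.smul_apply, Complex.real_smul]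
  ring

theorem comp_smulLeftCLM (H : Annihilates T g₁ W) (hh : h.HasTemperateGrowth)
    (hg : ∀ x, h x * g₂ x = h x * g₁ x + fderiv ℝ h x (W x)) :
    Annihilates (T.comp (smulLeftCLM ℂ h)) g₂ W := fun φ φ' hφ => by
  obtain ⟨φ₁, h₁⟩ := exists_mul hh φ
  refine H φ₁ (smulLeftCLM ℂ h φ') fun x => ?_
  have h2 : (φ₁ : V → ℂ) = fun x => h x * φ x := by ext x; rw [h₁]
  have h3 : fderiv ℝ φ₁ x = h x • fderiv ℝ φ x + φ x • fderiv ℝ h x := by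
    rw [h2]
    exact fderiv_fun_mul (hh.1.differentiable (by simp) x) φ.differentiableAt
  rw [smulLeftCLM_apply_apply hh, smul_eq_mul, hφ, h3, h₁]
  simp only [_root_.add_apply, _root_.smul_apply, smul_eq_mul]
  linear_combination φ x * hg x

theorem of_eq_on_support (H : Annihilates (T.comp (smulLeftCLM ℂ h)) g₁ W₁)
    (hh : h.HasTemperateGrowth) (hg₁ : g₁.HasTemperateGrowth) (hW₁ : W₁.HasTemperateGrowth)
    (hg : ∀ x, h x ≠ 0 → g₂ x = g₁ x) (hW : ∀ x, h x ≠ 0 → W₂ x = W₁ x) :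
    Annihilates (T.comp (smulLeftCLM ℂ h)) g₂ W₂ := fun φ φ' hφ => by
  obtain ⟨φ₁, h₁⟩ := exists_firstOrder hg₁ hW₁ φ
  rw [← H φ φ₁ h₁]
  simp only [ContinuousLinearMap.coe_comp, Function.comp_apply]
  congr 1
  ext x
  rw [smulLeftCLM_apply_apply hh, smulLeftCLM_apply_apply hh, hφ, h₁]
  by_cases hx : h x = 0
  · simp [hx]
  · rw [hg x hx, hW x hx]

end Annihilates

/-- Multiplication by the temperate function `g` is sent to zero by `T`. -/
structure Kills (T : 𝓢(V, ℂ) →L[ℂ] ℂ) (g : V → ℂ) : Prop where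
  temperate : g.HasTemperateGrowth
  apply_eq_zero : ∀ φ φ' : 𝓢(V, ℂ), (∀ x, φ' x = g x * φ x) → T φ' = 0

namespace Kills

variable {T : 𝓢(V, ℂ) →L[ℂ] ℂ} {g g₁ g₂ h : V → ℂ}

theorem congr (H : Kills T g₁) (hg : ∀ x, g₂ x = g₁ x) : Kills T g₂ := by
  rwa [show g₂ = g₁ from funext hg]

theorem add (H₁ : Kills T g₁) (H₂ : Kills T g₂) : Kills T (fun x => g₁ x + g₂ x) := by
  refine ⟨H₁.1.add H₂.1, fun φ φ' hφ => ?_⟩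
  obtain ⟨φ₁, h₁⟩ := exists_mul H₁.1 φ
  have h₂ := H₂.2 φ (φ' - φ₁) fun x => by rw [_root_.sub_apply, hφ, h₁]; ring
  rw [map_sub, H₁.2 φ φ₁ h₁, sub_zero] at h₂
  exact h₂

theorem mul_left (H : Kills T g) (hh : h.HasTemperateGrowth) : Kills T (fun x => h x * g x) := by
  refine ⟨hh.mul H.1, fun φ φ' hφ => ?_⟩
  obtain ⟨φ₁, h₁⟩ := exists_mul hh φ
  exact H.2 φ₁ φ' fun x => by rw [hφ, h₁]; ring

theorem const_mul (H : Kills T g) (c : ℂ) : Kills T (fun x => c * g x) :=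
  H.mul_left (.const c)

theorem sub (H₁ : Kills T g₁) (H₂ : Kills T g₂) : Kills T (fun x => g₁ x - g₂ x) :=
  (H₁.add (H₂.const_mul (-1))).congr fun x => by ring

end Kills

theorem IsSeminormBounded.comp_equiv {ι : Type*} {φ : ι → 𝓢(V, ℂ)} (χ : 𝓢(V, ℂ)) (c : ι → ℂ)
    (a b : ι → V →L[ℝ] V) (M : ℝ) (hc : ∀ i, ‖c i‖ ≤ M) (ha : ∀ i, ‖a i‖ ≤ M)
    (hb : ∀ i, ‖b i‖ ≤ M) (hba : ∀ i x, b i (a i x) = x) (hφ : ∀ i x, φ i x = c i * χ (a i x)) :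
    IsSeminormBounded φ := by
  intro k n
  rcases isEmpty_or_nonempty ι with h | ⟨⟨i₀⟩⟩
  · exact ⟨0, fun i => h.elim i⟩
  have hM : 0 ≤ M := (norm_nonneg _).trans (hc i₀)
  refine ⟨M ^ (k + n + 1) * SchwartzMap.seminorm ℝ k n χ, fun i => ?_⟩
  refine seminorm_le_bound ℝ k n _ (by positivity) fun x => ?_
  have h1 : iteratedFDeriv ℝ n (φ i) x = c i • iteratedFDeriv ℝ n (fun x => χ (a i x)) x := by
    have h : (φ i : V → ℂ) = c i • (fun x => χ (a i x)) := by
      ext x; rw [hφ]; rfl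
    rw [h]
    refine iteratedFDeriv_const_smul_apply ?_
    exact ((χ.smooth n).comp (a i).contDiff).contDiffAt
  have h2 := norm_iteratedFDeriv_comp_clm_le (χ.smooth ⊤) (a i) n x
  have h3 : ‖x‖ ≤ M * ‖a i x‖ := by
    calc ‖x‖ = ‖b i (a i x)‖ := by rw [hba]
      _ ≤ ‖b i‖ * ‖a i x‖ := (b i).le_opNorm _
      _ ≤ _ := by gcongr; exact hb i
  rw [h1, norm_smul]
  calc ‖x‖ ^ k * (‖c i‖ * ‖iteratedFDeriv ℝ n (fun x => χ (a i x)) x‖)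
      ≤ (M * ‖a i x‖) ^ k * (M * (‖iteratedFDeriv ℝ n χ (a i x)‖ * M ^ n)) := by
        gcongr
        · exact hc i
        · exact h2.trans (by gcongr; exact ha i)
    _ = M ^ (k + n + 1) * (‖a i x‖ ^ k * ‖iteratedFDeriv ℝ n χ (a i x)‖) := by
        rw [mul_pow]; ring
    _ ≤ _ := by
        gcongr
        exact le_seminorm ℝ k n χ _

variable [FiniteDimensional ℝ V]

/-- If `T` is an eigenvector of the flow of a linear vector field, it is annihilated by the
corresponding first order operator. -/
theorem annihilates_of_flow (T : 𝓢(V, ℂ) →L[ℂ] ℂ) (N : V →L[ℝ] V) (a : ℝ → V →L[ℝ] V) (c : ℂ)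
    (ha0 : ∀ x, a 0 x = x) (hinv : ∀ s x, a (-s) (a s x) = x)
    (hd : ∀ s x, HasDerivAt (fun s => a s x) (N (a s x)) s)
    (hT : ∀ (s : ℝ) (φ φ' : 𝓢(V, ℂ)), (∀ x, φ' x = φ (a s x)) →
      T φ' = Complex.exp (c * s) * T φ) :
    Annihilates T (fun _ => -c) N := by
  intro φ χ hχ
  have hcont : Continuous a := by
    rw [continuous_clm_apply]
    exact fun x => continuous_iff_continuousAt.2 fun s => (hd s x).continuousAt
  obtain ⟨M₁, hM₁⟩ := (isCompact_Icc (a := (-1 : ℝ)) (b := 1)).exists_bound_of_continuousOn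
    hcont.continuousOn
  obtain ⟨M₂, hM₂⟩ := (isCompact_Icc (a := (-1 : ℝ)) (b := 1)).exists_bound_of_continuousOn
    (f := fun s : ℝ => Complex.exp (-(c * s))) (by fun_prop)
  have hex : ∀ s (φ : 𝓢(V, ℂ)), ∃ φ' : 𝓢(V, ℂ), ∀ x, φ' x = φ (a s x) := fun s φ =>
    exists_comp_equiv (ContinuousLinearEquiv.equivOfInverse (a s) (a (-s)) (hinv s)
      (fun x => by simpa using hinv (-s) x)) φ
  choose κ hκ using hex
  let cl : ℝ → ℝ := fun s => max 0 (min s 1)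
  have hcl : ∀ s, cl s ∈ Set.Icc (-1 : ℝ) 1 := fun s =>
    ⟨by linarith [le_max_left 0 (min s 1)], max_le (by norm_num) (min_le_right _ _)⟩
  have hcl' : ∀ s, -cl s ∈ Set.Icc (-1 : ℝ) 1 := fun s => by
    have := hcl s; constructor <;> linarith [this.1, this.2]
  have hclc : Continuous cl := by fun_prop
  have hcl1 : ∀ s ∈ Set.Icc (0 : ℝ) 1, cl s = s := fun s hs => by
    simp [cl, hs.1, hs.2]
  let Φ₀ : ℝ → 𝓢(V, ℂ) := fun s => Complex.exp (-(c * cl s)) • κ (cl s) χ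
  let Φ : ℝ → 𝓢(V, ℂ) := fun s => Φ₀ s - χ
  have hb₀ : IsSeminormBounded Φ₀ := by
    refine IsSeminormBounded.comp_equiv χ (fun s => Complex.exp (-(c * cl s)))
      (fun s => a (cl s)) (fun s => a (-cl s)) (max M₁ M₂)
      (fun s => (hM₂ _ (hcl s)).trans (le_max_right _ _))
      (fun s => (hM₁ _ (hcl s)).trans (le_max_left _ _))
      (fun s => (hM₁ _ (hcl' s)).trans (le_max_left _ _)) (fun s x => hinv _ x) fun s x => ?_
    simp only [Φ₀, _root_.smul_apply, hκ, smul_eq_mul]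
  have hb : IsSeminormBounded Φ := hb₀.sub (isSeminormBounded_const χ)
  have hΦ : ∀ s x, Φ s x = Complex.exp (-(c * cl s)) * χ (a (cl s) x) - χ x := fun s x => by
    simp only [Φ, Φ₀, _root_.sub_apply, _root_.smul_apply, hκ, smul_eq_mul]
  have hac : ∀ x, Continuous fun s => a s x := fun x => by fun_prop
  have key := apply_eq_zero_of_eq_integral (volume.restrict (Set.Ioc (0 : ℝ) 1)) T hb
    (fun x => by
      simp only [hΦ]
      have := χ.continuous
      have := (hac x).comp hclc
      fun_prop)
    (fun s => by
      simp only [Φ, Φ₀, map_sub, map_smul, smul_eq_mul]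
      rw [hT _ _ _ (hκ (cl s) χ), ← mul_assoc, ← Complex.exp_add]
      simp)
    (φ := Complex.exp (-c) • κ 1 φ - φ - χ) (fun x => by
      have hder : ∀ s : ℝ, HasDerivAt (fun s : ℝ => Complex.exp (-(c * s)) * φ (a s x))
          (Complex.exp (-(c * s)) * χ (a s x)) s := fun s => by
        have h1 : HasDerivAt (fun s : ℝ => φ (a s x)) (fderiv ℝ φ (a s x) (N (a s x))) s :=
          (φ.differentiableAt (x := a s x)).hasFDerivAt.comp_hasDerivAt s (hd s x)
        have h2 : HasDerivAt (fun s : ℝ => Complex.exp (-(c * s)))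
            (Complex.exp (-(c * s)) * (-(c * 1))) s :=
          (((hasDerivAt_id (s : ℂ)).const_mul c).neg.cexp).comp_ofReal
        refine (h2.mul h1).congr_deriv ?_
        rw [hχ]; ring
      have hint := intervalIntegral.integral_eq_sub_of_hasDerivAt (a := 0) (b := 1)
        (fun s _ => hder s) (by
          refine Continuous.intervalIntegrable ?_ _ _
          have := χ.continuous
          have := hac x
          fun_prop)
      rw [intervalIntegral.integral_of_le zero_le_one] at hint
      have h3 : ∫ s in Set.Ioc (0 : ℝ) 1, Φ s x =
          ∫ s in Set.Ioc (0 : ℝ) 1, (Complex.exp (-(c * s)) * χ (a s x) - χ x) := by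
        refine setIntegral_congr_fun measurableSet_Ioc fun s hs => ?_
        simp only [hΦ]
        rw [hcl1 s ⟨hs.1.le, hs.2⟩]
      rw [h3, integral_sub, hint]
      · simp [hκ, ha0]
      · refine (Continuous.integrableOn_Icc ?_).mono_set Set.Ioc_subset_Icc_self
        have := χ.continuous
        have := hac x
        fun_prop
      · simp)
  rw [map_sub, map_sub, map_smul, hT 1 _ _ (hκ 1 φ), smul_eq_mul, ← mul_assoc, ← Complex.exp_add]
    at key
  simpa using key

end FirstOrder

/-- Continuous unitary characters of the real line. -/
theorem exists_eq_cexp_of_map_add {h : ℝ → ℂ} (hc : Continuous h) (ha : ∀ s t, h (s + t) = h s * h t)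
    (hu : ∀ t, ‖h t‖ = 1) : ∃ r : ℝ, ∀ t, h t = Complex.exp (Complex.I * ((r * t : ℝ) : ℂ)) := by
  have hne : ∀ t, h t ≠ 0 := fun t => by rw [← norm_ne_zero_iff, hu]; exact one_ne_zero
  have h0 : h 0 = 1 := by
    have := ha 0 0
    rw [add_zero] at this
    exact (mul_eq_left₀ (hne 0)).1 this.symm
  have hprim : ∀ t, HasDerivAt (fun t => ∫ s in (0 : ℝ)..t, h s) (h t) t := fun t =>
    intervalIntegral.integral_hasDerivAt_right (hc.intervalIntegrable _ _)
      (hc.stronglyMeasurableAtFilter _ _) hc.continuousAt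
  obtain ⟨δ, hδ⟩ : ∃ δ, ∫ s in (0 : ℝ)..δ, h s ≠ 0 := by
    by_contra! H
    have h1 := hprim 0
    rw [funext H] at h1
    exact hne 0 (h1.unique (hasDerivAt_const _ _))
  set I₀ := ∫ s in (0 : ℝ)..δ, h s
  have h2 : ∀ t, h t = ((∫ s in (0 : ℝ)..(t + δ), h s) - ∫ s in (0 : ℝ)..t, h s) / I₀ := fun t => by
    rw [eq_div_iff hδ, intervalIntegral.integral_interval_sub_left (hc.intervalIntegrable _ _)
      (hc.intervalIntegrable _ _), ← intervalIntegral.integral_const_mul]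
    simp only [← ha]
    rw [intervalIntegral.integral_comp_add_left, add_zero]
  have h3 : ∀ t, HasDerivAt h ((h (t + δ) - h t) / I₀) t := fun t => by
    have := (((hprim (t + δ)).comp_add_const t δ).sub (hprim t)).div_const I₀
    exact this.congr_of_eventuallyEq (Eventually.of_forall h2)
  obtain ⟨c, hcd⟩ : ∃ c : ℂ, ∀ t, HasDerivAt h (c * h t) t :=
    ⟨(h δ - 1) / I₀, fun t => (h3 t).congr_deriv (by rw [ha]; ring)⟩
  have h4 : ∀ t : ℝ, HasDerivAt (fun t : ℝ => h t * Complex.exp (-(c * t))) 0 t := fun t => by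
    have h5 : HasDerivAt (fun s : ℝ => Complex.exp (-(c * s)))
        (Complex.exp (-(c * t)) * (-(c * 1))) t :=
      (((hasDerivAt_id (t : ℂ)).const_mul c).neg.cexp).comp_ofReal
    exact ((hcd t).mul h5).congr_deriv (by ring)
  have h6 : ∀ t : ℝ, h t = Complex.exp (c * t) := fun t => by
    have h7 := is_const_of_deriv_eq_zero (fun t => (h4 t).differentiableAt)
      (fun t => (h4 t).deriv) t 0
    simp only [h0, Complex.ofReal_zero, mul_zero, neg_zero, Complex.exp_zero, mul_one] at h7
    rw [Complex.exp_neg, mul_inv_eq_one₀ (Complex.exp_ne_zero _)] at h7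
    exact h7
  have h8 : c.re = 0 := by
    have := hu 1
    rw [h6, Complex.norm_exp, Complex.ofReal_one, mul_one, Real.exp_eq_one_iff] at this
    exact this
  refine ⟨c.im, fun t => ?_⟩
  rw [h6]
  congr 1
  apply Complex.ext <;> simp [h8]

end SchwartzMap

namespace SchwartzMap

section Chirp

variable {V : Type*} [NormedAddCommGroup V] [InnerProductSpace ℝ V] (J : V →L[ℝ] V)

/-- The oscillating Gaussian attached to the quadratic form `⟪J x, x⟫`. -/
noncomputable def chirp (x : V) : ℂ := Complex.exp (Complex.I * ((Real.pi * inner ℝ (J x) x : ℝ) : ℂ))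

theorem chirp_hasTemperateGrowth : (chirp J).HasTemperateGrowth := by
  have h : (fun x : V => Real.pi * inner ℝ (J x) x : V → ℝ).HasTemperateGrowth := by
    have h1 : (fun x : V => (innerSL ℝ (J x) x : ℝ)).HasTemperateGrowth :=
      (innerSL ℝ (E := V)).bilinear_hasTemperateGrowth J.hasTemperateGrowth
        (ContinuousLinearMap.id ℝ V).hasTemperateGrowth
    exact (Function.HasTemperateGrowth.const Real.pi).mul h1
  exact h.cexp_I_mul

variable {J}

theorem chirp_comp {A : V → V}
    (hA : ∀ x, (inner ℝ (J (A x)) (A x) : ℝ) = inner ℝ (J x) x) (x : V) :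
    chirp J (A x) = chirp J x := by
  rw [chirp, chirp, hA]

theorem fderiv_chirp (hJ : ∀ x y, (inner ℝ (J x) y : ℝ) = inner ℝ x (J y)) (x w : V) :
    fderiv ℝ (chirp J) x w =
      2 * Real.pi * Complex.I * ((inner ℝ x (J w) : ℝ) : ℂ) * chirp J x := by
  have h1 : HasFDerivAt (fun x : V => (inner ℝ (J x) x : ℝ))
      ((fderivInnerCLM ℝ (J x, x)).comp (J.prod (ContinuousLinearMap.id ℝ V))) x :=
    J.hasFDerivAt.inner ℝ (hasFDerivAt_id x)
  have h2 := ((Complex.ofRealCLM.hasFDerivAt.comp x (h1.const_mul Real.pi)).const_mul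
    Complex.I).cexp
  have h3 : chirp J =
    fun x => Complex.exp (Complex.I * ((Real.pi * inner ℝ (J x) x : ℝ) : ℂ)) := rfl
  have h4 : (inner ℝ w (J x) : ℝ) = inner ℝ x (J w) := by rw [← hJ, real_inner_comm]
  have h2' : fderiv ℝ (chirp J) x = _ := h2.fderiv
  rw [h2', h3]
  simp [hJ, h4]
  ring

theorem smulLeftCLM_chirp_surjective (φ : 𝓢(V, ℂ)) : ∃ φ', smulLeftCLM ℂ (chirp J) φ' = φ := by
  refine ⟨smulLeftCLM ℂ (chirp (-J)) φ, ?_⟩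
  ext x
  rw [smulLeftCLM_apply_apply (chirp_hasTemperateGrowth J),
    smulLeftCLM_apply_apply (chirp_hasTemperateGrowth _), chirp, chirp, smul_smul,
    ← Complex.exp_add]
  simp

theorem smulLeftCLM_chirp_comp {A : V ≃L[ℝ] V}
    (hA : ∀ x, (inner ℝ (J (A x)) (A x) : ℝ) = inner ℝ (J x) x) (φ : 𝓢(V, ℂ)) :
    smulLeftCLM ℂ (chirp J) (compCLMOfContinuousLinearEquiv ℂ A φ) =
      compCLMOfContinuousLinearEquiv ℂ A (smulLeftCLM ℂ (chirp J) φ) := by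
  ext x
  simp only [smulLeftCLM_apply_apply (chirp_hasTemperateGrowth J),
    compCLMOfContinuousLinearEquiv_apply, Function.comp_apply, chirp_comp hA]

theorem smulLeftCLM_inner_comm {g : V → ℂ} (hg : g.HasTemperateGrowth) (w : V) (φ : 𝓢(V, ℂ)) :
    smulLeftCLM ℂ (inner ℝ · w) (smulLeftCLM ℂ g φ) =
      smulLeftCLM ℂ g (smulLeftCLM ℂ (inner ℝ · w) φ) := by
  have h : (inner ℝ · w : V → ℝ).HasTemperateGrowth := by fun_prop
  ext x
  simp only [smulLeftCLM_apply_apply h, smulLeftCLM_apply_apply hg, smul_eq_mul, Complex.real_smul]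
  ring

theorem lineDerivOp_smulLeftCLM_chirp (hJ : ∀ x y, (inner ℝ (J x) y : ℝ) = inner ℝ x (J y)) (w : V)
    (φ : 𝓢(V, ℂ)) : ∂_{w} (smulLeftCLM ℂ (chirp J) φ) = smulLeftCLM ℂ (chirp J)
      (∂_{w} φ + (2 * Real.pi * Complex.I) • smulLeftCLM ℂ (inner ℝ · (J w)) φ) := by
  have h : (inner ℝ · (J w) : V → ℝ).HasTemperateGrowth := by fun_prop
  have hc := chirp_hasTemperateGrowth J
  ext x
  have h2 : (smulLeftCLM ℂ (chirp J) φ : V → ℂ) = fun x => chirp J x * φ x := by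
    ext x; rw [smulLeftCLM_apply_apply hc, smul_eq_mul]
  have h3 : fderiv ℝ (smulLeftCLM ℂ (chirp J) φ) x =
      chirp J x • fderiv ℝ φ x + φ x • fderiv ℝ (chirp J) x := by
    rw [h2]
    exact fderiv_fun_mul (hc.1.differentiable (by simp) x) φ.differentiableAt
  rw [lineDerivOp_apply_eq_fderiv, h3, smulLeftCLM_apply_apply hc]
  simp only [_root_.add_apply, _root_.smul_apply, smulLeftCLM_apply_apply h, lineDerivOp_apply_eq_fderiv,
    fderiv_chirp hJ]
  simp only [smul_eq_mul, Complex.real_smul]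
  ring

end Chirp

section PartialFourier

variable {V : Type*} [NormedAddCommGroup V] [InnerProductSpace ℝ V] [FiniteDimensional ℝ V]
  [MeasurableSpace V] [BorelSpace V]

theorem fourier_compCLMOfContinuousLinearEquiv {A B : V ≃L[ℝ] V}
    (hdet : |LinearMap.det (A : V →ₗ[ℝ] V)| = 1)
    (hAB : ∀ x ξ, (inner ℝ (A x) (B ξ) : ℝ) = inner ℝ x ξ) (φ : 𝓢(V, ℂ)) :
    𝓕 (compCLMOfContinuousLinearEquiv ℂ A φ) = compCLMOfContinuousLinearEquiv ℂ B (𝓕 φ) := by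
  have hmp : MeasurePreserving A (volume : Measure V) volume := by
    refine ⟨A.continuous.measurable, ?_⟩
    have h := Measure.map_linearMap_addHaar_eq_smul_addHaar (volume : Measure V)
      (f := (A : V →ₗ[ℝ] V)) (by intro h; rw [h] at hdet; simp at hdet)
    rw [abs_inv, hdet] at h
    simpa using h
  ext ξ
  rw [compCLMOfContinuousLinearEquiv_apply, Function.comp_apply, fourier_coe, fourier_coe,
    Real.fourier_eq', Real.fourier_eq']
  refine Eq.trans ?_ (hmp.integral_comp A.toHomeomorph.measurableEmbedding
    (fun v => Complex.exp (↑(-2 * Real.pi * inner ℝ v (B ξ)) * Complex.I) • φ v))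
  refine integral_congr_ae (Eventually.of_forall fun x => ?_)
  simp only [hAB, compCLMOfContinuousLinearEquiv_apply, Function.comp_apply]

variable {J : V →L[ℝ] V}

theorem fourierInv_compCLMOfContinuousLinearEquiv {A B : V ≃L[ℝ] V}
    (hdet : |LinearMap.det (A : V →ₗ[ℝ] V)| = 1)
    (hAB : ∀ x ξ, (inner ℝ (A x) (B ξ) : ℝ) = inner ℝ x ξ) (φ : 𝓢(V, ℂ)) :
    𝓕⁻ (compCLMOfContinuousLinearEquiv ℂ B φ) = compCLMOfContinuousLinearEquiv ℂ A (𝓕⁻ φ) := by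
  have h := fourier_compCLMOfContinuousLinearEquiv hdet hAB (𝓕⁻ φ)
  rw [FourierTransform.fourier_fourierInv_eq] at h
  rw [← h, FourierTransform.fourierInv_fourier_eq]

variable (J) in
/-- Conjugating multiplication by a chirp with the Fourier transform and multiplying by chirps on
both sides gives a partial Fourier transform. -/
noncomputable def partialFourier : 𝓢(V, ℂ) →L[ℂ] 𝓢(V, ℂ) :=
  (smulLeftCLM ℂ (chirp J)).comp ((FourierTransform.fourierInvCLM ℂ 𝓢(V, ℂ)).comp ((smulLeftCLM ℂ (chirp J)).comp
    ((FourierTransform.fourierCLM ℂ 𝓢(V, ℂ)).comp (smulLeftCLM ℂ (chirp J)))))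

theorem partialFourier_apply (φ : 𝓢(V, ℂ)) : partialFourier J φ = smulLeftCLM ℂ (chirp J)
    (𝓕⁻ (smulLeftCLM ℂ (chirp J) (𝓕 (smulLeftCLM ℂ (chirp J) φ)))) := rfl

theorem partialFourier_surjective (φ : 𝓢(V, ℂ)) : ∃ φ', partialFourier J φ' = φ := by
  obtain ⟨φ₁, h₁⟩ := smulLeftCLM_chirp_surjective (J := J) φ
  obtain ⟨φ₂, h₂⟩ := smulLeftCLM_chirp_surjective (J := J) (𝓕 φ₁)
  obtain ⟨φ₃, h₃⟩ := smulLeftCLM_chirp_surjective (J := J) (𝓕⁻ φ₂)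
  refine ⟨φ₃, ?_⟩
  rw [partialFourier_apply, h₃, FourierTransform.fourier_fourierInv_eq, h₂,
    FourierTransform.fourierInv_fourier_eq, h₁]

theorem partialFourier_compCLMOfContinuousLinearEquiv {A B : V ≃L[ℝ] V}
    (hdet : |LinearMap.det (A : V →ₗ[ℝ] V)| = 1)
    (hAB : ∀ x ξ, (inner ℝ (A x) (B ξ) : ℝ) = inner ℝ x ξ)
    (hA : ∀ x, (inner ℝ (J (A x)) (A x) : ℝ) = inner ℝ (J x) x)
    (hB : ∀ x, (inner ℝ (J (B x)) (B x) : ℝ) = inner ℝ (J x) x) (φ : 𝓢(V, ℂ)) :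
    partialFourier J (compCLMOfContinuousLinearEquiv ℂ A φ) =
      compCLMOfContinuousLinearEquiv ℂ A (partialFourier J φ) := by
  rw [partialFourier_apply, smulLeftCLM_chirp_comp hA,
    fourier_compCLMOfContinuousLinearEquiv hdet hAB, smulLeftCLM_chirp_comp hB,
    fourierInv_compCLMOfContinuousLinearEquiv hdet hAB, smulLeftCLM_chirp_comp hA,
    partialFourier_apply]

theorem fourier_smulLeftCLM_inner (w : V) (φ : 𝓢(V, ℂ)) :
    𝓕 (smulLeftCLM ℂ (inner ℝ · w) φ) = -(2 * Real.pi * Complex.I)⁻¹ • ∂_{w} (𝓕 φ) := by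
  rw [lineDerivOp_fourier_eq, FourierTransform.fourier_smul, smul_smul]
  field_simp [Complex.two_pi_I_ne_zero]
  simp

/-- Multiplication by the quadratic chirp on the Fourier side. -/
theorem lineDerivOp_chirpMultiplier (w : V) (φ : 𝓢(V, ℂ)) :
    ∂_{w} (𝓕⁻ (smulLeftCLM ℂ (chirp J) (𝓕 φ))) = 𝓕⁻ (smulLeftCLM ℂ (chirp J) (𝓕 (∂_{w} φ))) := by
  rw [lineDerivOp_fourierInv_eq, smulLeftCLM_inner_comm (chirp_hasTemperateGrowth J),
    fourier_lineDerivOp_eq, map_smul]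

theorem smulLeftCLM_inner_chirpMultiplier (hJ : ∀ x y, (inner ℝ (J x) y : ℝ) = inner ℝ x (J y))
    (w : V) (φ : 𝓢(V, ℂ)) :
    smulLeftCLM ℂ (inner ℝ · w) (𝓕⁻ (smulLeftCLM ℂ (chirp J) (𝓕 φ))) =
      𝓕⁻ (smulLeftCLM ℂ (chirp J) (𝓕 (smulLeftCLM ℂ (inner ℝ · w) φ -
        (2 * Real.pi * Complex.I)⁻¹ • ∂_{J w} φ))) := by
  have h1 := fourierInv_lineDerivOp_eq (smulLeftCLM ℂ (chirp J) (𝓕 φ)) w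
  have h2 : smulLeftCLM ℂ (inner ℝ · w) (𝓕⁻ (smulLeftCLM ℂ (chirp J) (𝓕 φ))) =
      -(2 * Real.pi * Complex.I)⁻¹ • 𝓕⁻ (∂_{w} (smulLeftCLM ℂ (chirp J) (𝓕 φ))) := by
    rw [h1, smul_smul]
    field_simp [Complex.two_pi_I_ne_zero]
    simp
  rw [h2, lineDerivOp_smulLeftCLM_chirp hJ, ← FourierTransform.fourierInv_smul, ← map_smul]
  congr 2
  have h3 := fourier_lineDerivOp_eq φ (J w)
  rw [← h3, sub_eq_add_neg, ← neg_smul, FourierTransform.fourier_add, fourier_smulLeftCLM_inner,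
    FourierTransform.fourier_smul, smul_add]

/-- The partial Fourier transform turns derivatives in the directions of the transformed variables
into multiplications. -/
theorem lineDerivOp_partialFourier_of_involutive
    (hJ : ∀ x y, (inner ℝ (J x) y : ℝ) = inner ℝ x (J y)) {w : V} (hw : J (J w) = w)
    (φ : 𝓢(V, ℂ)) : ∂_{w} (partialFourier J φ) =
      partialFourier J ((2 * Real.pi * Complex.I) • smulLeftCLM ℂ (inner ℝ · (J w)) φ) := by
  rw [partialFourier_apply, lineDerivOp_smulLeftCLM_chirp hJ, lineDerivOp_chirpMultiplier,
    smulLeftCLM_inner_chirpMultiplier hJ, hw, partialFourier_apply]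
  congr 1
  rw [← FourierTransform.fourierInv_smul, ← map_smul, ← FourierTransform.fourier_smul,
    ← FourierTransform.fourierInv_add, ← map_add, ← FourierTransform.fourier_add]
  congr 3
  rw [smul_sub, smul_smul, mul_inv_cancel₀ Complex.two_pi_I_ne_zero, one_smul, add_sub_cancel,
    smulLeftCLM_inner_comm (chirp_hasTemperateGrowth J), map_smul]

theorem lineDerivOp_partialFourier_of_map_eq_zero
    (hJ : ∀ x y, (inner ℝ (J x) y : ℝ) = inner ℝ x (J y)) {w : V} (hw : J w = 0)
    (φ : 𝓢(V, ℂ)) : ∂_{w} (partialFourier J φ) = partialFourier J (∂_{w} φ) := by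
  have h0 : ∀ φ : 𝓢(V, ℂ), smulLeftCLM ℂ (inner ℝ · (J w) : V → ℝ) φ = 0 := fun φ => by
    have h : (inner ℝ · (J w) : V → ℝ).HasTemperateGrowth := by fun_prop
    ext x
    rw [smulLeftCLM_apply_apply h, hw, inner_zero_right, zero_smul, _root_.zero_apply]
  rw [partialFourier_apply, lineDerivOp_smulLeftCLM_chirp hJ, lineDerivOp_chirpMultiplier,
    lineDerivOp_smulLeftCLM_chirp hJ, h0, h0, smul_zero, add_zero, add_zero, partialFourier_apply]

theorem smulLeftCLM_inner_partialFourier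
    (hJ : ∀ x y, (inner ℝ (J x) y : ℝ) = inner ℝ x (J y)) {w : V} (hw : J w = 0)
    (φ : 𝓢(V, ℂ)) : smulLeftCLM ℂ (inner ℝ · w) (partialFourier J φ) =
      partialFourier J (smulLeftCLM ℂ (inner ℝ · w) φ) := by
  have hc := chirp_hasTemperateGrowth J
  have h0 : ∀ φ : 𝓢(V, ℂ), ∂_{J w} φ = 0 := fun φ => by
    ext x
    rw [lineDerivOp_apply_eq_fderiv, hw, map_zero, _root_.zero_apply]
  rw [partialFourier_apply, smulLeftCLM_inner_comm hc, smulLeftCLM_inner_chirpMultiplier hJ,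
    h0, smul_zero, sub_zero, smulLeftCLM_inner_comm hc, partialFourier_apply]

end PartialFourier

end SchwartzMap

namespace GL3

section Coordinates

variable (𝕂 : Type*) [RCLike 𝕂]

/-- The embedding of `𝕂` into the complex numbers. -/
noncomputable def cx : 𝕂 →⋆ₐ[ℝ] ℂ where
  toFun := RCLike.map 𝕂 ℂ
  map_one' := by simp [RCLike.map]
  map_zero' := map_zero _
  map_add' := map_add _
  map_mul' x y := by
    rcases RCLike.I_mul_I (K := 𝕂) with h | h
    · have : ∀ z : 𝕂, RCLike.im z = 0 := fun z => by
        rw [← RCLike.mul_im_I_ax z, h]; simp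
      apply Complex.ext <;> simp [this]
    · apply Complex.ext <;> simp
  commutes' r := by simp [RCLike.algebraMap_eq_ofReal]
  map_star' x := by
    apply Complex.ext <;> simp

/-- The space of `3 × 3` matrices with its Euclidean structure. -/
abbrev E : Type _ := EuclideanSpace 𝕂 (Fin 3 × Fin 3)

variable {𝕂}

theorem cx_apply (x : 𝕂) : cx 𝕂 x = RCLike.re x + RCLike.im x * Complex.I := by
  simp [cx]

theorem norm_cx (x : 𝕂) : ‖cx 𝕂 x‖ = ‖x‖ := by
  rw [← sq_eq_sq₀ (norm_nonneg _) (norm_nonneg _), ← RCLike.normSq_eq_def' x, Complex.sq_norm,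
    RCLike.normSq_apply, Complex.normSq_apply]
  simp [cx_apply]

theorem cx_injective : Function.Injective (cx 𝕂) := by
  exact (injective_iff_map_eq_zero (cx 𝕂)).2 fun x hx => by rw [← norm_eq_zero, ← norm_cx, hx, norm_zero]

theorem re_cx (x : 𝕂) : (cx 𝕂 x).re = RCLike.re x := by simp [cx]
theorem im_cx (x : 𝕂) : (cx 𝕂 x).im = RCLike.im x := by simp [cx]

/-- The complex coordinate functions. -/
noncomputable def X (i : Fin 3 × Fin 3) (x : E 𝕂) : ℂ := cx 𝕂 (x i)

theorem X_temperate (i : Fin 3 × Fin 3) : (X i : E 𝕂 → ℂ).HasTemperateGrowth :=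
  ((RCLike.map 𝕂 ℂ).comp ((PiLp.proj 2 (𝕜 := ℝ) (fun _ : Fin 3 × Fin 3 => 𝕂) i))).hasTemperateGrowth

/-- Diagonal linear maps. -/
noncomputable def diagMul (c : Fin 3 × Fin 3 → 𝕂) : E 𝕂 →L[ℝ] E 𝕂 :=
  LinearMap.toContinuousLinearMap
    { toFun := fun x => WithLp.toLp 2 fun i => c i * x i
      map_add' := fun x y => by ext i; simp [mul_add]
      map_smul' := fun r x => by ext i; simp }

@[simp] theorem diagMul_apply (c : Fin 3 × Fin 3 → 𝕂) (x : E 𝕂) (i) : diagMul c x i = c i * x i := rfl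

/-- The diagonal torus `diag(a, 1, a)`. -/
def torusWeight (a : 𝕂ˣ) (i : Fin 3 × Fin 3) : 𝕂ˣ := ![a, 1, a] i.1 * (![a, 1, a] i.2)⁻¹

/-- Conjugation by the diagonal torus. -/
noncomputable def tor (a : 𝕂ˣ) : E 𝕂 ≃L[ℝ] E 𝕂 :=
  ContinuousLinearEquiv.equivOfInverse (diagMul fun i => (torusWeight a i : 𝕂))
    (diagMul fun i => ((torusWeight a i)⁻¹ : 𝕂ˣ))
    (fun x => by ext i; simp) (fun x => by ext i; simp)

@[simp] theorem tor_apply (a : 𝕂ˣ) (x : E 𝕂) (i) : tor a x i = torusWeight a i * x i := rfl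

/-- Transposition. -/
noncomputable def swapMap : E 𝕂 →L[ℝ] E 𝕂 :=
  LinearMap.toContinuousLinearMap
    { toFun := fun x => WithLp.toLp 2 fun i => x i.swap
      map_add' := fun x y => by ext i; simp
      map_smul' := fun r x => by ext i; simp }

/-- Transposition. -/
noncomputable def tau : E 𝕂 ≃L[ℝ] E 𝕂 :=
  ContinuousLinearEquiv.equivOfInverse swapMap swapMap
    (fun x => by ext i; simp [swapMap]) (fun x => by ext i; simp [swapMap])

@[simp] theorem tau_apply (x : E 𝕂) (i) : tau x i = x i.swap := rfl

theorem tau_tau (x : E 𝕂) : tau (tau x) = x := by ext i; simp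

theorem inner_eq (x y : E 𝕂) : (inner ℝ x y : ℝ) = ∑ i, (inner ℝ (x i) (y i) : ℝ) := by
  rw [PiLp.inner_apply]

theorem inner_re (a b : 𝕂) : (inner ℝ a b : ℝ) = RCLike.re (star a * b) := by
  rw [real_inner_eq_re_inner 𝕂 a b, RCLike.inner_apply, mul_comm]; rfl

@[simp] theorem X_tau (i) (x : E 𝕂) : X i (tau x) = X i.swap x := rfl

@[simp] theorem X_tor (i) (a : 𝕂ˣ) (x : E 𝕂) :
    X i (tor a x) = cx 𝕂 (torusWeight a i) * X i x := by
  rw [X, tor_apply, map_mul]; rfl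

theorem norm_sq_eq (x : E 𝕂) : ‖x‖ ^ 2 = ∑ i, ‖x i‖ ^ 2 := EuclideanSpace.norm_sq_eq x

theorem norm_tau (x : E 𝕂) : ‖tau x‖ = ‖x‖ := by
  rw [← sq_eq_sq₀ (norm_nonneg _) (norm_nonneg _), norm_sq_eq, norm_sq_eq]
  exact Fintype.sum_equiv (Equiv.prodComm _ _) _ _ fun i => by simp

theorem norm_tor {a : 𝕂ˣ} (ha : ‖(a : 𝕂)‖ = 1) (x : E 𝕂) : ‖tor a x‖ = ‖x‖ := by
  have hw : ∀ i, ‖((torusWeight a i : 𝕂ˣ) : 𝕂)‖ = 1 := by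
    rintro ⟨i, j⟩
    fin_cases i <;> fin_cases j <;> simp [torusWeight, ha]
  rw [← sq_eq_sq₀ (norm_nonneg _) (norm_nonneg _), norm_sq_eq, norm_sq_eq]
  exact Finset.sum_congr rfl fun i _ => by rw [tor_apply, norm_mul, hw, one_mul]

/-- The exponents of the action of the real part of the torus. -/
def torExponent (i : Fin 3 × Fin 3) : ℝ := ![1, 0, 1] i.1 - ![1, 0, 1] i.2

/-- The generator of the real part of the torus. -/
noncomputable def torN : E 𝕂 →L[ℝ] E 𝕂 :=
  diagMul fun i => (torExponent i : 𝕂)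

noncomputable def expUnit (t : ℝ) : 𝕂ˣ :=
  Units.mk0 ((Real.exp t : ℝ) : 𝕂) (by simp [Real.exp_ne_zero])

theorem torusWeight_expUnit (s : ℝ) (i : Fin 3 × Fin 3) :
    ((torusWeight (expUnit s) i : 𝕂ˣ) : 𝕂) = ((Real.exp (torExponent i * s) : ℝ) : 𝕂) := by
  obtain ⟨i, j⟩ := i
  fin_cases i <;> fin_cases j <;>
    simp [torusWeight, torExponent, expUnit, Real.exp_neg]

theorem hasDerivAt_tor (s : ℝ) (x : E 𝕂) :
    HasDerivAt (fun s => tor (expUnit s) x) (torN (tor (expUnit s) x)) s := by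
  have hp : HasDerivAt (fun s i => ((torusWeight (expUnit s) i : 𝕂ˣ) : 𝕂) * x i)
      (torN (tor (expUnit s) x)).ofLp s := ?_
  · exact (PiLp.hasFDerivAt_toLp (𝕜 := ℝ) (E := fun _ => 𝕂) 2 _).comp_hasDerivAt s hp
  refine hasDerivAt_pi.2 fun i => ?_
  have h1 : HasDerivAt (fun s => Real.exp (torExponent i * s))
      (Real.exp (torExponent i * s) * (torExponent i * 1)) s :=
    ((hasDerivAt_id s).const_mul _).exp
  have h2 := ((RCLike.ofRealCLM (K := 𝕂)).hasFDerivAt.comp_hasDerivAt s h1).mul_const (x i)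
  refine (h2.congr_of_eventuallyEq (Eventually.of_forall fun t => ?_)).congr_deriv ?_
  · simp only [Function.comp_apply, RCLike.ofRealCLM_apply, ← torusWeight_expUnit]
  · simp only [RCLike.ofRealCLM_apply, torN, diagMul_apply, tor_apply, torusWeight_expUnit]
    push_cast
    ring

theorem tor_neg (s : ℝ) (x : E 𝕂) : tor (expUnit (-s)) (tor (expUnit s) x) = x := by
  ext i
  rw [tor_apply, tor_apply, ← mul_assoc, ← Units.val_mul]
  have : torusWeight (expUnit (-s)) i * torusWeight (expUnit s : 𝕂ˣ) i = 1 := by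
    have h : (expUnit (-s) : 𝕂ˣ) = (expUnit s)⁻¹ := by
      ext; simp [expUnit, Real.exp_neg]
    obtain ⟨i, j⟩ := i
    fin_cases i <;> fin_cases j <;> simp [torusWeight, h]
  rw [this]; simp

theorem tor_zero (x : E 𝕂) : tor (expUnit 0) x = x := by
  have h : (expUnit 0 : 𝕂ˣ) = 1 := by ext; simp [expUnit]
  ext ⟨i, j⟩
  fin_cases i <;> fin_cases j <;> simp [torusWeight, h]

end Coordinates

end GL3

namespace GL3

open SchwartzMap

section Moments

variable {𝕂 : Type*} [RCLike 𝕂]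

/-- Invariance of a tempered distribution under the diagonal torus. -/
def TorusInvariant (T : 𝓢(E 𝕂, ℂ) →L[ℂ] ℂ) : Prop :=
  ∀ (a : 𝕂ˣ) (φ φ' : 𝓢(E 𝕂, ℂ)), (∀ x, φ' x = φ (tor a x)) → T φ' = T φ

/-- Skew-invariance of a tempered distribution under transposition. -/
def TransposeSkew (T : 𝓢(E 𝕂, ℂ) →L[ℂ] ℂ) : Prop :=
  ∀ φ φ' : 𝓢(E 𝕂, ℂ), (∀ x, φ' x = φ (tau x)) → T φ' = - T φ

/-- Temperate functions invariant under the torus and transposition. -/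
structure Invariant (h : E 𝕂 → ℂ) : Prop where
  temperate : h.HasTemperateGrowth
  map_tor : ∀ a x, h (tor a x) = h x
  map_tau : ∀ x, h (tau x) = h x

namespace Invariant

variable {g h : E 𝕂 → ℂ}

theorem const (c : ℂ) : Invariant (fun _ : E 𝕂 => c) := ⟨.const c, fun _ _ => rfl, fun _ => rfl⟩

theorem mul (hg : Invariant g) (hh : Invariant h) : Invariant (fun x => g x * h x) :=
  ⟨hg.1.mul hh.1, fun a x => by rw [hg.2, hh.2], fun x => by rw [hg.3, hh.3]⟩

end Invariant

theorem conj_X_temperate (i : Fin 3 × Fin 3) :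
    (fun x : E 𝕂 => conj (X i x)).HasTemperateGrowth := by
  have h := ((Complex.conjCLE : ℂ →L[ℝ] ℂ).comp (((RCLike.map 𝕂 ℂ).comp
    ((PiLp.proj 2 (𝕜 := ℝ) (fun _ : Fin 3 × Fin 3 => 𝕂) i))))).hasTemperateGrowth
  exact h

/-- The moment of `T` against `g` times the standard Gaussian. -/
noncomputable def moment (T : 𝓢(E 𝕂, ℂ) →L[ℂ] ℂ) (g : E 𝕂 → ℂ) : ℂ :=
  T (smulLeftCLM ℂ g (gaussian (E 𝕂) 1 one_pos))

variable {T : 𝓢(E 𝕂, ℂ) →L[ℂ] ℂ}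

theorem moment_eq {g : E 𝕂 → ℂ} (hg : g.HasTemperateGrowth) (φ : 𝓢(E 𝕂, ℂ))
    (hφ : ∀ x, φ x = g x * gaussian (E 𝕂) 1 one_pos x) : moment T g = T φ := by
  rw [moment]
  congr 1
  ext x
  rw [smulLeftCLM_apply_apply hg, hφ, smul_eq_mul]

theorem moment_add {g h : E 𝕂 → ℂ} (hg : g.HasTemperateGrowth) (hh : h.HasTemperateGrowth) :
    moment T (fun x => g x + h x) = moment T g + moment T h := by
  rw [moment_eq (g := fun x => g x + h x) (hg.add hh) (smulLeftCLM ℂ g (gaussian (E 𝕂) 1 one_pos) +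
    smulLeftCLM ℂ h (gaussian (E 𝕂) 1 one_pos)), map_add]
  · rfl
  · intro x
    rw [_root_.add_apply, smulLeftCLM_apply_apply hg, smulLeftCLM_apply_apply hh]
    simp only [smul_eq_mul]; ring

theorem moment_const_mul {g : E 𝕂 → ℂ} (hg : g.HasTemperateGrowth) (c : ℂ) :
    moment T (fun x => c * g x) = c * moment T g := by
  rw [moment_eq (g := fun x => c * g x) ((Function.HasTemperateGrowth.const c).mul hg)
    (c • smulLeftCLM ℂ g (gaussian (E 𝕂) 1 one_pos)), map_smul]
  · rfl
  · intro x
    rw [_root_.smul_apply, smulLeftCLM_apply_apply hg]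
    simp only [smul_eq_mul]; ring

theorem _root_.SchwartzMap.Kills.moment_eq_zero {g : E 𝕂 → ℂ} (H : Kills T g) :
    moment T g = 0 :=
  H.2 (gaussian (E 𝕂) 1 one_pos) _ fun x => by
    rw [smulLeftCLM_apply_apply H.1, smul_eq_mul]

theorem gaussian_congr {x y : E 𝕂} (h : ‖x‖ = ‖y‖) :
    gaussian (E 𝕂) 1 one_pos x = gaussian (E 𝕂) 1 one_pos y := by
  rw [gaussian_apply, gaussian_apply, h]

theorem TransposeSkew.moment_comp (hT : TransposeSkew T) {g h : E 𝕂 → ℂ}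
    (hg : g.HasTemperateGrowth) (hh : h.HasTemperateGrowth) (hgh : ∀ x, h x = g (tau x)) :
    moment T h = - moment T g := by
  refine hT _ _ fun x => ?_
  rw [smulLeftCLM_apply_apply hg, smulLeftCLM_apply_apply hh, hgh, gaussian_congr (norm_tau x)]

theorem TorusInvariant.moment_comp (hT : TorusInvariant T) {a : 𝕂ˣ} (ha : ‖(a : 𝕂)‖ = 1)
    {g h : E 𝕂 → ℂ} (hg : g.HasTemperateGrowth) (hh : h.HasTemperateGrowth)
    (hgh : ∀ x, h x = g (tor a x)) : moment T h = moment T g := by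
  refine hT a _ _ fun x => ?_
  rw [smulLeftCLM_apply_apply hg, smulLeftCLM_apply_apply hh, hgh, gaussian_congr (norm_tor ha x)]

/-- Monomials in the coordinates `(i, 1)`, `(1, i)` and their conjugates. -/
noncomputable def mono (i₀ : Fin 3) (i j k l : ℕ) (x : E 𝕂) : ℂ :=
  X (i₀, 1) x ^ i * conj (X (i₀, 1) x) ^ j * X (1, i₀) x ^ k * conj (X (1, i₀) x) ^ l

theorem mono_temperate (i₀ : Fin 3) (i j k l : ℕ) :
    (mono i₀ i j k l : E 𝕂 → ℂ).HasTemperateGrowth := by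
  have h1 := X_temperate (𝕂 := 𝕂) (i₀, 1)
  have h2 := conj_X_temperate (𝕂 := 𝕂) (i₀, 1)
  have h3 := X_temperate (𝕂 := 𝕂) (1, i₀)
  have h4 := conj_X_temperate (𝕂 := 𝕂) (1, i₀)
  unfold mono
  fun_prop

theorem mono_tau (i₀ : Fin 3) (i j k l : ℕ) (x : E 𝕂) :
    mono i₀ i j k l (tau x) = mono i₀ k l i j x := by
  simp only [mono, X_tau, Prod.swap_prod_mk]; ring

theorem mono_tor {i₀ : Fin 3} (h0 : i₀ ≠ 1) (i j k l : ℕ) (a : 𝕂ˣ) (x : E 𝕂) :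
    mono i₀ i j k l (tor a x) = (cx 𝕂 a ^ i * conj (cx 𝕂 a) ^ j *
      (cx 𝕂 a)⁻¹ ^ k * conj (cx 𝕂 a)⁻¹ ^ l) * mono i₀ i j k l x := by
  have h1 : torusWeight a (i₀, 1) = a := by
    fin_cases i₀ <;> simp_all [torusWeight]
  have h2 : torusWeight a (1, i₀) = a⁻¹ := by
    fin_cases i₀ <;> simp_all [torusWeight]
  have h3 : cx 𝕂 ((a⁻¹ : 𝕂ˣ) : 𝕂) = (cx 𝕂 a)⁻¹ := by
    rw [Units.val_inv_eq_inv_val, map_inv₀]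
  simp only [mono, X_tor, h1, h2, h3, map_mul, mul_pow]
  ring

theorem TorusInvariant.annihilates (hT : TorusInvariant T) :
    Annihilates T (fun _ => 0) (torN : E 𝕂 →L[ℝ] E 𝕂) := by
  refine (annihilates_of_flow T torN (fun s => ((tor (expUnit s : 𝕂ˣ)) : E 𝕂 →L[ℝ] E 𝕂)) 0
    tor_zero tor_neg (fun s x => hasDerivAt_tor s x) fun s φ φ' h => ?_).congr (fun x => by simp) fun x => rfl
  rw [hT _ φ φ' h]; simp

/-- The infinitesimal torus invariance evaluated on moments. -/
theorem TorusInvariant.moment_inner {i₀ : Fin 3} (h0 : i₀ ≠ 1) (hT : TorusInvariant T)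
    {h : E 𝕂 → ℂ} (hh : Invariant h) (i j k l : ℕ) :
    2 * moment T (fun x => ((inner ℝ x (torN x) : ℝ) : ℂ) * (mono i₀ i j k l x * h x)) =
      ((i : ℂ) + j - k - l) * moment T (fun x => mono i₀ i j k l x * h x) := by
  have hm : (fun x : E 𝕂 => mono i₀ i j k l x * h x).HasTemperateGrowth :=
    (mono_temperate i₀ i j k l).mul hh.1
  have hN : (fun x : E 𝕂 => ((inner ℝ x (torN x) : ℝ) : ℂ)).HasTemperateGrowth := by
    refine Function.HasTemperateGrowth.ofReal ?_
    have := (torN (𝕂 := 𝕂)).hasTemperateGrowth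
    exact (innerSL ℝ).bilinear_hasTemperateGrowth .id this
  set m : E 𝕂 → ℂ := fun x => mono i₀ i j k l x * h x with hmdef
  have hg : (fun x : E 𝕂 => ((inner ℝ x (torN x) : ℝ) : ℂ) * m x).HasTemperateGrowth :=
    hN.mul hm
  set φ := smulLeftCLM ℂ m (gaussian (E 𝕂) 1 one_pos) with hφ
  have hφx : ∀ x, φ x = m x * Complex.exp ((-(1 * ‖x‖ ^ 2) : ℝ) : ℂ) := fun x => by
    rw [hφ, smulLeftCLM_apply_apply hm, gaussian_apply, smul_eq_mul]
  have key := hT.annihilates φ (((i : ℂ) + j - k - l) • φ - (2 : ℂ) • smulLeftCLM ℂ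
    (fun x => ((inner ℝ x (torN x) : ℝ) : ℂ) * m x) (gaussian (E 𝕂) 1 one_pos)) fun x => ?_
  · rw [map_sub, map_smul, map_smul, sub_eq_zero] at key
    exact key.symm
  have h1 : HasDerivAt (fun s : ℝ => φ (tor (expUnit s) x)) (fderiv ℝ φ x (torN x)) 0 := by
    have h2 := hasDerivAt_tor 0 x
    have h3 := (φ.differentiableAt (x := tor (expUnit 0) x)).hasFDerivAt.comp_hasDerivAt 0 h2
    rw [tor_zero] at h3
    exact h3
  have hm' : ∀ s : ℝ, m (tor (expUnit s) x) =
      Complex.exp (((i : ℂ) + j - k - l) * s) * m x := fun s => by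
    have h4 : cx 𝕂 (expUnit s : 𝕂ˣ) = Complex.exp s := by
      simp [expUnit, cx_apply]
    rw [hmdef]
    simp only [mono_tor h0, hh.2, h4, ← Complex.exp_conj, ← Complex.exp_nat_mul, ← Complex.exp_neg,
      Complex.conj_ofReal, ← Complex.exp_add, map_neg]
    rw [← mul_assoc]
    congr 3
    ring
  have h5 : HasDerivAt (fun s : ℝ => φ (tor (expUnit s) x))
      (((i : ℂ) + j - k - l) * φ x - 2 * (((inner ℝ x (torN x) : ℝ) : ℂ) * φ x)) 0 := by
    have h6 : HasDerivAt (fun s : ℝ => Complex.exp (((i : ℂ) + j - k - l) * s))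
        (Complex.exp (((i : ℂ) + j - k - l) * (0 : ℝ)) * (((i : ℂ) + j - k - l) * 1)) (0 : ℝ) :=
      (((hasDerivAt_id ((0 : ℝ) : ℂ)).const_mul ((i : ℂ) + j - k - l)).cexp).comp_ofReal
    have h7 := (((((hasDerivAt_tor 0 x).norm_sq).const_mul 1).neg).ofReal_comp).cexp
    have h8 := (h6.mul_const (m x)).mul h7
    refine (h8.congr_of_eventuallyEq (Eventually.of_forall fun s => ?_)).congr_deriv ?_
    · simp [hφx, hm']
    · rw [hφx]
      simp [tor_zero]
      ring
  rw [h1.unique h5, _root_.sub_apply, _root_.smul_apply, _root_.smul_apply,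
    smulLeftCLM_apply_apply hg, hφx, gaussian_apply]
  simp only [smul_eq_mul]
  ring

theorem Kills.moment_congr {g g' : E 𝕂 → ℂ} (H : Kills T (fun x => g x - g' x))
    (hg' : g'.HasTemperateGrowth) : moment T g = moment T g' := by
  have h := moment_add (T := T) H.1 hg'
  rw [H.moment_eq_zero, zero_add] at h
  rw [← h]
  congr 1
  ext x
  ring

/-- The exchange relation between the two pairs of coordinates. -/
theorem moment_exchange {i₀ : Fin 3} (h0 : i₀ ≠ 1) (hT : TorusInvariant T) {κ κ' : E 𝕂 → ℂ}
    (hκ' : Invariant κ') (hκ : ∀ x, κ x * κ' x = 1)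
    (hK : Kills T fun x => ((inner ℝ x (torN x) : ℝ) : ℂ) -
      κ x * (X (i₀, 1) x * conj (X (i₀, 1) x) - X (1, i₀) x * conj (X (1, i₀) x)))
    {i j k l : ℕ} (IH : ∀ h : E 𝕂 → ℂ, Invariant h → moment T (fun x => mono i₀ i j k l x * h x) = 0)
    {h : E 𝕂 → ℂ} (hh : Invariant h) :
    moment T (fun x => mono i₀ (i + 1) (j + 1) k l x * h x) =
      moment T (fun x => mono i₀ i j (k + 1) (l + 1) x * h x) := by
  have hh' := hκ'.mul hh
  have h1 := hT.moment_inner h0 hh' i j k l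
  rw [IH _ hh', mul_zero] at h1
  have h1 := (mul_eq_zero.1 h1).resolve_left two_ne_zero
  have ht : ∀ i j k l : ℕ, (fun x : E 𝕂 => mono i₀ i j k l x * h x).HasTemperateGrowth :=
    fun i j k l => (mono_temperate i₀ i j k l).mul hh.1
  have h2 := hK.mul_left (h := fun x => mono i₀ i j k l x * (κ' x * h x))
    ((mono_temperate i₀ i j k l).mul hh'.1)
  have h3 := Kills.moment_congr (T := T)
    (g := fun x => ((inner ℝ x (torN x) : ℝ) : ℂ) * (mono i₀ i j k l x * (κ' x * h x)))
    (g' := fun x => mono i₀ (i + 1) (j + 1) k l x * h x +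
      (-1) * (mono i₀ i j (k + 1) (l + 1) x * h x)) (h2.congr fun x => ?_)
    ((ht _ _ _ _).add ((Function.HasTemperateGrowth.const _).mul (ht _ _ _ _)))
  · rw [h1, moment_add (ht _ _ _ _) (h := fun x => (-1) * (mono i₀ i j (k + 1) (l + 1) x * h x))
      ((Function.HasTemperateGrowth.const _).mul (ht _ _ _ _)),
      moment_const_mul (ht _ _ _ _)] at h3
    linear_combination -h3
  · simp only [mono]
    linear_combination (X (i₀, 1) x ^ i * conj (X (i₀, 1) x) ^ j * X (1, i₀) x ^ k *
      conj (X (1, i₀) x) ^ l * h x *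
      (X (i₀, 1) x * conj (X (i₀, 1) x) - X (1, i₀) x * conj (X (1, i₀) x))) * hκ x

/-- All mixed moments of `T` vanish. -/
theorem moment_mono_eq_zero {i₀ : Fin 3} (h0 : i₀ ≠ 1) (hT : TorusInvariant T)
    (hS : TransposeSkew T) {κ κ' : E 𝕂 → ℂ}
    (hκ' : Invariant κ') (hκ : ∀ x, κ x * κ' x = 1)
    (hK : Kills T fun x => ((inner ℝ x (torN x) : ℝ) : ℂ) -
      κ x * (X (i₀, 1) x * conj (X (i₀, 1) x) - X (1, i₀) x * conj (X (1, i₀) x)))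
    (D : ℕ) : ∀ i j k l : ℕ, i + j + k + l = D → ∀ h : E 𝕂 → ℂ, Invariant h →
      moment T (fun x => mono i₀ i j k l x * h x) = 0 := by
  induction D using Nat.strong_induction_on with
  | _ D IH =>
  have ht : ∀ (i j k l : ℕ) {h : E 𝕂 → ℂ}, Invariant h →
      (fun x : E 𝕂 => mono i₀ i j k l x * h x).HasTemperateGrowth :=
    fun i j k l h hh => (mono_temperate i₀ i j k l).mul hh.1
  have hex : ∀ (m i j k l : ℕ), i + m + (j + m) + k + l = D → ∀ h : E 𝕂 → ℂ, Invariant h →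
      moment T (fun x => mono i₀ (i + m) (j + m) k l x * h x) =
      moment T (fun x => mono i₀ i j (k + m) (l + m) x * h x) := by
    intro m
    induction m with
    | zero => intros; rfl
    | succ m ih =>
      intro i j k l hD h hh
      have h1 := moment_exchange h0 hT hκ' hκ hK (i := i + m) (j := j + m) (k := k) (l := l)
        (IH (i + m + (j + m) + k + l) (by omega) _ _ _ _ rfl) hh
      have h2 := ih i j (k + 1) (l + 1) (by omega) h hh
      rw [← add_assoc, ← add_assoc, h1, h2]
      congr 1
      ext x
      congr 2 <;> omega
  have hsk : ∀ (i j k l : ℕ), ∀ h : E 𝕂 → ℂ, Invariant h →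
      moment T (fun x => mono i₀ i j k l x * h x) =
      - moment T (fun x => mono i₀ k l i j x * h x) := fun i j k l h hh =>
    hS.moment_comp (ht _ _ _ _ hh) (ht _ _ _ _ hh) fun x => by rw [mono_tau, hh.3]
  have hmatch : ∀ (i j k l : ℕ), i + j + k + l = D → i + l = j + k → ∀ h : E 𝕂 → ℂ, Invariant h →
      moment T (fun x => mono i₀ i j k l x * h x) = 0 := by
    intro i j k l hD hij h hh
    rcases le_total k i with hki | hki
    · obtain ⟨m, rfl⟩ := Nat.exists_eq_add_of_le hki
      obtain rfl : j = l + m := by omega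
      have h1 := hex m k l k l (by omega) h hh
      have h2 := hsk (k + m) (l + m) k l h hh
      linear_combination (h1 + h2) / 2
    · obtain ⟨m, rfl⟩ := Nat.exists_eq_add_of_le hki
      obtain rfl : l = j + m := by omega
      have h1 := hex m i j i j (by omega) h hh
      have h2 := hsk (i + m) (j + m) i j h hh
      linear_combination (h2 - h1) / 2
  have hneg : ∀ (i j k l : ℕ) (a : 𝕂ˣ), ‖(a : 𝕂)‖ = 1 → (cx 𝕂 a ^ i * conj (cx 𝕂 a) ^ j *
      (cx 𝕂 a)⁻¹ ^ k * conj (cx 𝕂 a)⁻¹ ^ l) = -1 → ∀ h : E 𝕂 → ℂ, Invariant h →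
      moment T (fun x => mono i₀ i j k l x * h x) = 0 := by
    intro i j k l a ha hm h hh
    have h1 := hT.moment_comp ha (ht i j k l hh)
      (((Function.HasTemperateGrowth.const (-1)).mul (ht i j k l hh))) fun x => by
        simp only [Pi.mul_apply]
        rw [mono_tor h0, hm, hh.2, mul_assoc]
    have h2 := moment_const_mul (T := T) (ht i j k l hh) (-1)
    have h3 := h2.symm.trans h1
    linear_combination -h3 / 2
  intro i j k l hD h hh
  rcases RCLike.I_eq_zero_or_im_I_eq_one (K := 𝕂) with hI | hI
  · have hreal : ∀ z : 𝕂, conj (cx 𝕂 z) = cx 𝕂 z := fun z => by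
      have : RCLike.im z = 0 := by rw [← RCLike.mul_im_I_ax z, hI]; simp
      simp [cx_apply, this]
    rcases Nat.even_or_odd D with hev | hodd
    · obtain ⟨i', j', k', l', h1, h2, h3⟩ : ∃ i' j' k' l' : ℕ, i' + j' = i + j ∧ k' + l' = k + l ∧
          i' + l' = j' + k' := by
        rcases Nat.even_or_odd' (i + j) with ⟨a, ha | ha⟩
        · rcases Nat.even_or_odd' (k + l) with ⟨b, hb | hb⟩
          · exact ⟨a, a, b, b, by omega, by omega, by omega⟩
          · exact absurd hev (by rw [Nat.not_even_iff_odd]; exact ⟨a + b, by omega⟩)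
        · rcases Nat.even_or_odd' (k + l) with ⟨b, hb | hb⟩
          · exact absurd hev (by rw [Nat.not_even_iff_odd]; exact ⟨a + b, by omega⟩)
          · exact ⟨a + 1, a, b + 1, b, by omega, by omega, by omega⟩
      rw [← hmatch i' j' k' l' (by omega) h3 h hh]
      congr 1
      ext x
      simp only [mono, X, hreal]
      rw [← pow_add, mul_assoc _ _ (cx 𝕂 _ ^ l), ← pow_add, ← h1, ← h2]
      ring
    · refine hneg i j k l (-1) (by simp) ?_ h hh
      simp only [hreal, Units.val_neg, Units.val_one, map_neg, map_one, inv_neg, inv_one]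
      rw [← pow_add, ← pow_add, ← pow_add, hD, hodd.neg_one_pow]
  · by_cases hij : i + l = j + k
    · exact hmatch i j k l hD hij h hh
    set n : ℝ := (i : ℝ) + l - j - k with hn
    have hn0 : n ≠ 0 := fun h0 => hij (by
      have : ((i + l : ℕ) : ℝ) = ((j + k : ℕ) : ℝ) := by push_cast; linarith
      exact_mod_cast this)
    set z : 𝕂 := (Real.cos (Real.pi / n) : 𝕂) + (Real.sin (Real.pi / n) : 𝕂) * RCLike.I with hz
    have hcz : cx 𝕂 z = Complex.exp ((Real.pi / n : ℝ) * Complex.I) := by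
      rw [Complex.exp_mul_I, ← Complex.ofReal_cos, ← Complex.ofReal_sin, cx_apply, hz]
      simp [hI]
    have hz1 : ‖z‖ = 1 := by rw [← norm_cx, hcz, Complex.norm_exp_ofReal_mul_I]
    refine hneg i j k l (Units.mk0 z (by rw [← norm_ne_zero_iff, hz1]; exact one_ne_zero)) hz1
      ?_ h hh
    rw [Units.val_mk0, hcz, ← Complex.exp_conj, ← Complex.exp_neg, ← Complex.exp_conj,
      ← Complex.exp_nat_mul, ← Complex.exp_nat_mul, ← Complex.exp_nat_mul, ← Complex.exp_nat_mul,
      ← Complex.exp_add, ← Complex.exp_add, ← Complex.exp_add, ← Complex.exp_pi_mul_I]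
    congr 1
    simp only [map_mul, map_neg, Complex.conj_ofReal, Complex.conj_I]
    have h1 : ((Real.pi / n : ℝ) : ℂ) * (((i : ℂ) + l - j - k)) = Real.pi := by
      rw [show ((i : ℂ) + l - j - k) = (n : ℂ) by rw [hn]; push_cast; ring, ← Complex.ofReal_mul,
        div_mul_cancel₀ _ hn0]
    linear_combination Complex.I * h1

/-- Finite sums of monomials with invariant coefficients. -/
inductive Nice (i₀ : Fin 3) : (E 𝕂 → ℂ) → Prop
  | mono (i j k l : ℕ) (h : E 𝕂 → ℂ) (hh : Invariant h) :
      Nice i₀ (fun x => GL3.mono i₀ i j k l x * h x)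
  | add (f g : E 𝕂 → ℂ) : Nice i₀ f → Nice i₀ g → Nice i₀ (fun x => f x + g x)

namespace Nice

variable {i₀ : Fin 3} {f g : E 𝕂 → ℂ}

theorem congr (hf : Nice i₀ f) (h : ∀ x, g x = f x) : Nice i₀ g := by
  rwa [show g = f from funext h]

theorem temperate (hf : Nice i₀ f) : f.HasTemperateGrowth := by
  induction hf with
  | mono i j k l h hh => exact (mono_temperate i₀ i j k l).mul hh.1
  | add f g _ _ h1 h2 => exact h1.add h2

theorem mul (hf : Nice i₀ f) (hg : Nice i₀ g) : Nice i₀ (fun x => f x * g x) := by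
  induction hf with
  | mono i j k l h hh =>
    induction hg with
    | mono i' j' k' l' h' hh' =>
      refine (Nice.mono (i + i') (j + j') (k + k') (l + l') _ (hh.mul hh')).congr fun x => ?_
      simp only [GL3.mono]; ring
    | add f g _ _ h1 h2 => exact (h1.add _ _ h2).congr fun x => by ring
  | add f g _ _ h1 h2 => exact (h1.add _ _ h2).congr fun x => by ring

end Nice

/-- `g` agrees with a sum of monomials with invariant coefficients modulo functions killed by
`T`. -/
def Reduces (i₀ : Fin 3) (T : 𝓢(E 𝕂, ℂ) →L[ℂ] ℂ) (g : E 𝕂 → ℂ) : Prop :=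
  ∃ s, Nice i₀ s ∧ Kills T (fun x => g x - s x)

namespace Reduces

variable {i₀ : Fin 3} {f g : E 𝕂 → ℂ}

theorem congr (hf : Reduces i₀ T f) (h : ∀ x, g x = f x) : Reduces i₀ T g := by
  rwa [show g = f from funext h]

theorem temperate (hf : Reduces i₀ T f) : f.HasTemperateGrowth := by
  obtain ⟨s, hs, H⟩ := hf
  rw [show f = fun x => (f x - s x) + s x from funext fun x => by ring]
  exact H.1.add hs.temperate

theorem kills_zero : Kills T (fun _ => 0) :=
  ⟨.const 0, fun φ φ' h => by
    rw [show φ' = 0 from SchwartzMap.ext fun x => by rw [h, zero_mul]; rfl, map_zero]⟩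

theorem of_nice (hf : Nice i₀ f) : Reduces i₀ T f := ⟨f, hf, kills_zero.congr fun x => by ring⟩

theorem of_invariant (hf : Invariant f) : Reduces i₀ T f :=
  of_nice ((Nice.mono 0 0 0 0 f hf).congr fun x => by simp [mono])

theorem of_kills (hf : Kills T f) : Reduces i₀ T f :=
  ⟨fun _ => 0, (Nice.mono 0 0 0 0 _ (.const 0)).congr fun x => by simp,
    hf.congr fun x => by ring⟩

theorem add (hf : Reduces i₀ T f) (hg : Reduces i₀ T g) : Reduces i₀ T (fun x => f x + g x) := by
  obtain ⟨s, hs, H⟩ := hf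
  obtain ⟨t, ht, K⟩ := hg
  exact ⟨_, hs.add _ _ ht, (H.add K).congr fun x => by ring⟩

theorem mul (hf : Reduces i₀ T f) (hg : Reduces i₀ T g) : Reduces i₀ T (fun x => f x * g x) := by
  have hft := hf.temperate
  obtain ⟨s, hs, H⟩ := hf
  obtain ⟨t, ht, K⟩ := hg
  exact ⟨_, hs.mul ht, ((K.mul_left hft).add (H.mul_left ht.temperate)).congr fun x => by ring⟩

theorem const_mul (hf : Reduces i₀ T f) (c : ℂ) : Reduces i₀ T (fun x => c * f x) :=
  (of_invariant (.const c)).mul hf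

theorem sub_kills (hf : Reduces i₀ T f) (H : Kills T (fun x => g x - f x)) : Reduces i₀ T g :=
  (hf.add (of_kills H)).congr fun x => by ring

theorem pow (hf : Reduces i₀ T f) (n : ℕ) : Reduces i₀ T (fun x => f x ^ n) := by
  induction n with
  | zero => exact (of_invariant (.const 1)).congr fun x => by simp
  | succ n ih => exact (ih.mul hf).congr fun x => by ring

theorem sum {ι : Type*} (s : Finset ι) {f : ι → E 𝕂 → ℂ} (hf : ∀ i, Reduces i₀ T (f i)) :
    Reduces i₀ T (fun x => ∑ i ∈ s, f i x) := by
  classical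
  induction s using Finset.induction_on with
  | empty => exact (of_invariant (.const 0)).congr fun x => by simp
  | insert a s ha ih => exact ((hf a).add ih).congr fun x => by rw [Finset.sum_insert ha]

end Reduces

/-- A torus-invariant, transpose-skew distribution on which all coordinates reduce to those of
one pair of off-diagonal entries vanishes. -/
theorem eq_zero_of_reduces {i₀ : Fin 3} (h0 : i₀ ≠ 1) (hT : TorusInvariant T)
    (hS : TransposeSkew T) {κ κ' : E 𝕂 → ℂ}
    (hκ' : Invariant κ') (hκ : ∀ x, κ x * κ' x = 1)
    (hK : Kills T fun x => ((inner ℝ x (torN x) : ℝ) : ℂ) -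
      κ x * (X (i₀, 1) x * conj (X (i₀, 1) x) - X (1, i₀) x * conj (X (1, i₀) x)))
    (hX : ∀ i, Reduces i₀ T (X i)) (hX' : ∀ i, Reduces i₀ T (fun x => conj (X i x))) : T = 0 := by
  refine clm_eq_zero_of_gaussian_moments T fun y k => ?_
  have hred : Reduces i₀ T (fun x => ((inner ℝ x y : ℝ) : ℂ)) := by
    refine (Reduces.sum Finset.univ (f := fun i x => (1 / 2 : ℂ) *
      (cx 𝕂 (y i) * conj (X i x) + conj (cx 𝕂 (y i)) * X i x))
      fun i => (((hX' i).const_mul _).add ((hX i).const_mul _)).const_mul _).congr fun x => ?_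
    rw [inner_eq, Complex.ofReal_sum]
    refine Finset.sum_congr rfl fun i _ => ?_
    rw [inner_re, ← re_cx, map_mul, map_star, Complex.re_eq_add_conj]
    simp only [X, map_mul, Complex.star_def, Complex.conj_conj]
    ring
  obtain ⟨s, hs, H⟩ := hred.pow k
  refine (Kills.moment_congr H hs.temperate).trans ?_
  clear H
  induction hs with
  | mono i j k l h hh => exact moment_mono_eq_zero h0 hT hS hκ' hκ hK _ i j k l rfl h hh
  | add f g hf hg h1 h2 => rw [moment_add hf.temperate hg.temperate, h1, h2, add_zero]

end Moments

end GL3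

namespace GL3

open SchwartzMap

section Relations

variable {𝕂 : Type*} [RCLike 𝕂]

/-- The matrix with a single nonzero entry `w` at position `i`, linearly in `w`. -/
noncomputable def e (i : Fin 3 × Fin 3) : 𝕂 →L[ℝ] E 𝕂 :=
  LinearMap.toContinuousLinearMap
    { toFun := fun w => EuclideanSpace.single i w
      map_add' := fun x y => by ext j; by_cases h : j = i <;> simp [h]
      map_smul' := fun r x => by ext j; by_cases h : j = i <;> simp [h] }

@[simp] theorem e_apply (i j : Fin 3 × Fin 3) (w : 𝕂) : e i w j = if j = i then w else 0 := by
  simp [e]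

@[simp] theorem tau_e (i : Fin 3 × Fin 3) (w : 𝕂) : tau (e i w) = e i.swap w := by
  ext j
  simp [Prod.swap_eq_iff_eq_swap]

theorem inner_e (i : Fin 3 × Fin 3) (w : 𝕂) (x : E 𝕂) :
    (inner ℝ x (e i w) : ℝ) = RCLike.re (star (x i) * w) := by
  rw [inner_eq, Finset.sum_eq_single i]
  · rw [e_apply, if_pos rfl, inner_re]
  · intro j _ hj
    rw [e_apply, if_neg hj, inner_zero_right]
  · simp

theorem coord_temperate (i : Fin 3 × Fin 3) : (fun x : E 𝕂 => x i).HasTemperateGrowth :=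
  (PiLp.proj 2 (𝕜 := ℝ) (fun _ : Fin 3 × Fin 3 => 𝕂) i).hasTemperateGrowth

theorem e_temperate {k : E 𝕂 → 𝕂} (hk : k.HasTemperateGrowth) (i : Fin 3 × Fin 3) :
    (fun x => e i (k x)).HasTemperateGrowth :=
  Function.HasTemperateGrowth.comp (g := fun w : 𝕂 => e i w) (e (𝕂 := 𝕂) i).hasTemperateGrowth hk

theorem re_temperate {k : E 𝕂 → 𝕂} (hk : k.HasTemperateGrowth) :
    (fun x => RCLike.re (k x)).HasTemperateGrowth :=
  (RCLike.reCLM (K := 𝕂)).hasTemperateGrowth.comp hk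

theorem im_temperate {k : E 𝕂 → 𝕂} (hk : k.HasTemperateGrowth) :
    (fun x => RCLike.im (k x)).HasTemperateGrowth :=
  (RCLike.imCLM (K := 𝕂)).hasTemperateGrowth.comp hk

/-- The functions `x ↦ 2πi Re(w)` giving the symbols of the relations. -/
noncomputable def symb (w : 𝕂) : ℂ := 2 * Real.pi * Complex.I * ((RCLike.re w : ℝ) : ℂ)

theorem symb_temperate {k : E 𝕂 → 𝕂} (hk : k.HasTemperateGrowth) :
    (fun x => symb (k x)).HasTemperateGrowth :=
  (Function.HasTemperateGrowth.const _).mul (re_temperate hk).ofReal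

/-- The relations satisfied by the partial Fourier transform of an equivariant distribution. -/
structure Rel (α : 𝕂) (T : 𝓢(E 𝕂, ℂ) →L[ℂ] ℂ) : Prop where
  torus : TorusInvariant T
  skew : TransposeSkew T
  rel_p (d : 𝕂) : Annihilates T (fun x => symb (d * (x (2, 0) * x (0, 0) + x (2, 1) * x (1, 0) - α)))
    (fun x => e (0, 2) (d * x (2, 2)))
  rel_q (c : 𝕂) : Annihilates T (fun x => symb (c * (x (2, 0) * x (0, 1) + x (2, 1) * x (1, 1))))
    (fun x => e (1, 2) (c * x (2, 2)))

variable {T : 𝓢(E 𝕂, ℂ) →L[ℂ] ℂ} {α : 𝕂}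

theorem TransposeSkew.annihilates (hT : TransposeSkew T) {g : E 𝕂 → ℂ} {W : E 𝕂 → E 𝕂}
    (H : Annihilates T g W) : Annihilates T (fun x => g (tau x)) (fun x => tau (W (tau x))) := by
  intro φ φ' h
  obtain ⟨χ, hχ⟩ := exists_comp_equiv tau φ
  obtain ⟨χ', hχ'⟩ := exists_comp_equiv tau φ'
  have h1 := hT φ' χ' hχ'
  rw [H χ χ' fun x => ?_] at h1
  · exact neg_eq_zero.1 h1.symm
  have h2 : (χ : E 𝕂 → ℂ) = φ ∘ tau := funext hχ
  rw [hχ', h, hχ, h2]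
  simp only [tau_tau]
  rw [ContinuousLinearEquiv.comp_right_fderiv]
  rfl

theorem Rel.rel_r (H : Rel α T) (d : 𝕂) :
    Annihilates T (fun x => symb (d * (x (0, 2) * x (0, 0) + x (1, 2) * x (0, 1) - α)))
      (fun x => e (2, 0) (d * x (2, 2))) :=
  (H.skew.annihilates (H.rel_p d)).congr (fun x => by simp) (fun x => by simp)

theorem Rel.rel_s (H : Rel α T) (c : 𝕂) :
    Annihilates T (fun x => symb (c * (x (0, 2) * x (1, 0) + x (1, 2) * x (1, 1))))
      (fun x => e (2, 1) (c * x (2, 2))) :=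
  (H.skew.annihilates (H.rel_q c)).congr (fun x => by simp) (fun x => by simp)

theorem TorusInvariant.comp_smulLeftCLM (hT : TorusInvariant T) {h : E 𝕂 → ℂ} (hh : Invariant h) :
    TorusInvariant (T.comp (smulLeftCLM ℂ h)) := fun a φ φ' H =>
  hT a _ _ fun x => by
    change smulLeftCLM ℂ h φ' x = smulLeftCLM ℂ h φ (tor a x)
    rw [smulLeftCLM_apply_apply hh.1, smulLeftCLM_apply_apply hh.1, H, hh.2]

theorem TransposeSkew.comp_smulLeftCLM (hT : TransposeSkew T) {h : E 𝕂 → ℂ} (hh : Invariant h) :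
    TransposeSkew (T.comp (smulLeftCLM ℂ h)) := fun φ φ' H =>
  hT _ _ fun x => by
    change smulLeftCLM ℂ h φ' x = smulLeftCLM ℂ h φ (tau x)
    rw [smulLeftCLM_apply_apply hh.1, smulLeftCLM_apply_apply hh.1, H, hh.3]

theorem fderiv_eq_of_forall_add_smul {V F : Type*} [NormedAddCommGroup V] [NormedSpace ℝ V]
    [NormedAddCommGroup F] [NormedSpace ℝ F] {h : V → F} (hd : Differentiable ℝ h) {x w : V} {c : F}
    (H : ∀ t : ℝ, h (x + t • w) = h x + t • c) : fderiv ℝ h x w = c := by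
  have h1 := (hd x).hasFDerivAt.hasLineDerivAt w
  have h2 : HasDerivAt (fun t : ℝ => h (x + t • w)) c 0 := by
    rw [funext H]
    simpa using ((hasDerivAt_id (0 : ℝ)).smul_const c).const_add (h x)
  exact h1.unique h2

theorem _root_.Function.HasTemperateGrowth.differentiable {V F : Type*} [NormedAddCommGroup V]
    [NormedSpace ℝ V] [NormedAddCommGroup F] [NormedSpace ℝ F] {h : V → F}
    (hh : h.HasTemperateGrowth) : Differentiable ℝ h :=
  hh.1.differentiable (by simp)

theorem invariant_of_corner {θ : 𝕂 → ℂ} (hθ : (fun x : E 𝕂 => θ (x (2, 2))).HasTemperateGrowth) :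
    Invariant (fun x : E 𝕂 => θ (x (2, 2))) :=
  ⟨hθ, fun a x => by simp [torusWeight], fun x => by simp⟩

theorem Rel.comp_smulLeftCLM (H : Rel α T) {θ : 𝕂 → ℂ}
    (hθ : (fun x : E 𝕂 => θ (x (2, 2))).HasTemperateGrowth) :
    Rel α (T.comp (smulLeftCLM ℂ (fun x : E 𝕂 => θ (x (2, 2))))) := by
  have hi := invariant_of_corner hθ
  refine ⟨H.torus.comp_smulLeftCLM hi, H.skew.comp_smulLeftCLM hi,
    fun d => (H.rel_p d).comp_smulLeftCLM hθ fun x => ?_,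
    fun c => (H.rel_q c).comp_smulLeftCLM hθ fun x => ?_⟩ <;>
  · rw [fderiv_eq_of_forall_add_smul (c := 0) hθ.differentiable, add_zero]
    intro t
    simp

theorem Kills.of_annihilates {g : E 𝕂 → ℂ} {i : Fin 3 × Fin 3} {k : E 𝕂 → 𝕂}
    (H : Annihilates T g (fun x => e i (k x))) (hg : g.HasTemperateGrowth)
    (h1 : Kills T (fun x => ((RCLike.re (k x) : ℝ) : ℂ)))
    (h2 : Kills T (fun x => ((RCLike.im (k x) : ℝ) : ℂ))) : Kills T g := by
  refine ⟨hg, fun φ φ' h => ?_⟩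
  obtain ⟨φ₁, hφ₁⟩ := exists_fderiv_apply (Function.HasTemperateGrowth.const (e i (1 : 𝕂))) φ
  obtain ⟨φ₂, hφ₂⟩ := exists_fderiv_apply (Function.HasTemperateGrowth.const (e i (RCLike.I : 𝕂))) φ
  obtain ⟨χ₁, hχ₁⟩ := exists_mul h1.1 φ₁
  obtain ⟨χ₂, hχ₂⟩ := exists_mul h2.1 φ₂
  have h3 := H φ (φ' + χ₁ + χ₂) fun x => ?_
  · rwa [map_add, map_add, h1.2 _ _ hχ₁, h2.2 _ _ hχ₂, add_zero, add_zero] at h3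
  · have h4 : e i (k x) = RCLike.re (k x) • e i (1 : 𝕂) + RCLike.im (k x) • e i (RCLike.I : 𝕂) := by
      rw [← map_smul, ← map_smul, ← map_add]
      congr 1
      conv_lhs => rw [← RCLike.re_add_im (k x)]
      simp [RCLike.real_smul_eq_coe_mul]
    beta_reduce
    rw [h4, map_add, map_smul, map_smul, ← hφ₁, ← hφ₂]
    simp only [_root_.add_apply, h, hχ₁, hχ₂, Complex.real_smul]
    ring

/-- `T` kills a function and its complex conjugate. -/
def Kills₂ (T : 𝓢(E 𝕂, ℂ) →L[ℂ] ℂ) (g : E 𝕂 → ℂ) : Prop :=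
  Kills T g ∧ Kills T (fun x => conj (g x))

theorem _root_.Function.HasTemperateGrowth.conj {h : E 𝕂 → ℂ} (hh : h.HasTemperateGrowth) :
    (fun x => conj (h x)).HasTemperateGrowth :=
  (Complex.conjCLE : ℂ →L[ℝ] ℂ).hasTemperateGrowth.comp hh

namespace Kills₂

variable {f g h : E 𝕂 → ℂ}

theorem congr (H : Kills₂ T f) (h : ∀ x, g x = f x) : Kills₂ T g := by
  rwa [show g = f from funext h]

theorem add (H : Kills₂ T f) (K : Kills₂ T g) : Kills₂ T (fun x => f x + g x) :=
  ⟨H.1.add K.1, (H.2.add K.2).congr fun x => by simp⟩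

theorem sub (H : Kills₂ T f) (K : Kills₂ T g) : Kills₂ T (fun x => f x - g x) :=
  ⟨H.1.sub K.1, (H.2.sub K.2).congr fun x => by simp⟩

theorem mul_left (H : Kills₂ T g) (hh : h.HasTemperateGrowth) : Kills₂ T (fun x => h x * g x) :=
  ⟨H.1.mul_left hh, (H.2.mul_left hh.conj).congr fun x => by simp⟩

theorem re (H : Kills₂ T g) : Kills T (fun x => (((g x).re : ℝ) : ℂ)) :=
  ((H.1.add H.2).const_mul (1 / 2)).congr fun x => by rw [Complex.re_eq_add_conj]; ring

theorem im (H : Kills₂ T g) : Kills T (fun x => (((g x).im : ℝ) : ℂ)) :=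
  ((H.1.sub H.2).const_mul (1 / (2 * Complex.I))).congr fun x => by
    rw [Complex.im_eq_sub_conj]; ring

theorem of_re_im {f : E 𝕂 → 𝕂} (h1 : Kills T (fun x => ((RCLike.re (f x) : ℝ) : ℂ)))
    (h2 : Kills T (fun x => ((RCLike.im (f x) : ℝ) : ℂ))) : Kills₂ T (fun x => cx 𝕂 (f x)) :=
  ⟨(h1.add (h2.const_mul Complex.I)).congr fun x => by rw [cx_apply]; ring,
    (h1.sub (h2.const_mul Complex.I)).congr fun x => by simp only [cx_apply]; simp; ring⟩

theorem of_symb {f : E 𝕂 → 𝕂} (H : ∀ d : 𝕂, Kills T (fun x => symb (d * f x))) :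
    Kills₂ T (fun x => cx 𝕂 (f x)) := by
  refine of_re_im ?_ ?_
  · refine ((H 1).const_mul (2 * Real.pi * Complex.I)⁻¹).congr fun x => ?_
    rw [one_mul, symb, ← mul_assoc, inv_mul_cancel₀ Complex.two_pi_I_ne_zero, one_mul]
  · refine ((H (-RCLike.I)).const_mul (2 * Real.pi * Complex.I)⁻¹).congr fun x => ?_
    rw [symb, ← mul_assoc, inv_mul_cancel₀ Complex.two_pi_I_ne_zero, one_mul]
    congr 1
    rcases RCLike.I_eq_zero_or_im_I_eq_one (K := 𝕂) with hI | hI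
    · rw [← RCLike.mul_im_I_ax (f x), hI]; simp
    · simp [hI]

end Kills₂

end Relations

end GL3

namespace GL3

open SchwartzMap

section Corner

variable {𝕂 : Type*} [RCLike 𝕂] {T : 𝓢(E 𝕂, ℂ) →L[ℂ] ℂ} {α : 𝕂}

theorem Kills₂.of_annihilates (hz : Kills₂ T (X (2, 2))) {f : E 𝕂 → 𝕂} (hf : f.HasTemperateGrowth)
    {i : Fin 3 × Fin 3}
    (H : ∀ d : 𝕂, Annihilates T (fun x => symb (d * f x)) (fun x => e i (d * x (2, 2)))) :
    Kills₂ T (fun x => cx 𝕂 (f x)) := by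
  refine .of_symb fun d => ?_
  have hd : Kills₂ T (fun x => cx 𝕂 (d * x (2, 2))) :=
    (hz.mul_left (.const (cx 𝕂 d))).congr fun x => by rw [map_mul]; rfl
  exact Kills.of_annihilates (H d) (symb_temperate ((Function.HasTemperateGrowth.const d).mul hf))
    (hd.re.congr fun x => by rw [re_cx]) (hd.im.congr fun x => by rw [im_cx])

theorem Kills₂.const_mul {g : E 𝕂 → ℂ} (H : Kills₂ T g) (c : ℂ) : Kills₂ T (fun x => c * g x) :=
  H.mul_left (.const c)

/-- The determinant of the upper left block. -/
noncomputable def blockDet (x : E 𝕂) : ℂ := X (0, 0) x * X (1, 1) x - X (0, 1) x * X (1, 0) x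

theorem cx_mul_cx_inv (a : 𝕂ˣ) :
    cx 𝕂 a * cx 𝕂 ((a⁻¹ : 𝕂ˣ) : 𝕂) = 1 := by
  rw [← map_mul]; simp

theorem invariant_X (i : Fin 3) : Invariant (X (i, i) : E 𝕂 → ℂ) :=
  ⟨X_temperate _, fun a x => by rw [X_tor]; simp [torusWeight], fun x => by simp⟩

theorem invariant_blockDet : Invariant (blockDet : E 𝕂 → ℂ) where
  temperate := ((X_temperate _).mul (X_temperate _)).sub ((X_temperate _).mul (X_temperate _))
  map_tor a x := by
    simp only [blockDet, X_tor, torusWeight]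
    have := cx_mul_cx_inv a
    simp [-map_units_inv, -Units.val_inv_eq_inv_val]
    linear_combination X (0, 1) x * X (1, 0) x * this
  map_tau x := by simp only [blockDet, X_tau, Prod.swap_prod_mk]; ring

theorem Invariant.conj {h : E 𝕂 → ℂ} (hh : Invariant h) : Invariant (fun x => conj (h x)) :=
  ⟨hh.1.conj, fun a x => by rw [hh.2], fun x => by rw [hh.3]⟩

theorem X_mul_conj (i : Fin 3 × Fin 3) (x : E 𝕂) : X i x * conj (X i x) = ((‖x i‖ ^ 2 : ℝ) : ℂ) := by
  rw [Complex.mul_conj', X, norm_cx, Complex.ofReal_pow]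

theorem inner_torN (x : E 𝕂) : ((inner ℝ x (torN x) : ℝ) : ℂ) =
    X (0, 1) x * conj (X (0, 1) x) + X (2, 1) x * conj (X (2, 1) x)
      - X (1, 0) x * conj (X (1, 0) x) - X (1, 2) x * conj (X (1, 2) x) := by
  have h : ∀ (c : ℝ) (w : 𝕂), (inner ℝ w ((c : 𝕂) * w) : ℝ) = c * ‖w‖ ^ 2 := fun c w => by
    rw [← RCLike.real_smul_eq_coe_mul, inner_smul_right, real_inner_self_eq_norm_sq]
  simp only [X_mul_conj]
  rw [inner_eq, Fintype.sum_prod_type]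
  simp only [torN, diagMul_apply, h, Fin.sum_univ_three, torExponent]
  push_cast
  simp
  ring

/-- A distribution satisfying the relations and killed by the corner coordinate vanishes. -/
theorem Rel.eq_zero_of_kills (H : Rel α T) (hα : α ≠ 0) (hz : Kills₂ T (X (2, 2))) : T = 0 := by
  have ht := fun i j : Fin 3 × Fin 3 => (coord_temperate (𝕂 := 𝕂) i).mul (coord_temperate j)
  have hα' : cx 𝕂 α ≠ 0 := (map_ne_zero_iff _ cx_injective).2 hα
  have K1 : Kills₂ T (fun x => X (2, 0) x * X (0, 0) x + X (2, 1) x * X (1, 0) x - cx 𝕂 α) :=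
    (hz.of_annihilates (((ht _ _).add (ht _ _)).sub (.const α)) H.rel_p).congr fun x => by
      simp [X]
  have K2 : Kills₂ T (fun x => X (2, 0) x * X (0, 1) x + X (2, 1) x * X (1, 1) x) :=
    (hz.of_annihilates ((ht _ _).add (ht _ _)) H.rel_q).congr fun x => by simp [X]
  have K3 : Kills₂ T (fun x => X (0, 2) x * X (0, 0) x + X (1, 2) x * X (0, 1) x - cx 𝕂 α) :=
    (hz.of_annihilates (((ht _ _).add (ht _ _)).sub (.const α)) H.rel_r).congr fun x => by
      simp [X]
  have K4 : Kills₂ T (fun x => X (0, 2) x * X (1, 0) x + X (1, 2) x * X (1, 1) x) :=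
    (hz.of_annihilates ((ht _ _).add (ht _ _)) H.rel_s).congr fun x => by simp [X]
  have tX := X_temperate (𝕂 := 𝕂)
  set β := (cx 𝕂 α)⁻¹ with hβ
  have hβα : β * cx 𝕂 α = 1 := inv_mul_cancel₀ hα'
  have hu : Kills₂ T (fun x => X (0, 1) x + β * blockDet x * X (2, 1) x) :=
    (((K2.mul_left (tX (0, 0))).sub (K1.mul_left (tX (0, 1)))).const_mul β).congr fun x => by
      simp only [blockDet]; linear_combination (-X (0, 1) x) * hβα
  have hv : Kills₂ T (fun x => X (1, 0) x + β * blockDet x * X (1, 2) x) :=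
    (((K4.mul_left (tX (0, 0))).sub (K3.mul_left (tX (1, 0)))).const_mul β).congr fun x => by
      simp only [blockDet]; linear_combination (-X (1, 0) x) * hβα
  have hp : Kills₂ T (fun x => X (2, 0) x - X (0, 2) x) :=
    (((((K1.mul_left (tX (0, 2))).sub (K3.mul_left (tX (2, 0)))).sub
      (K4.mul_left (tX (2, 1)))).add (K2.mul_left (tX (1, 2)))).const_mul β).congr fun x => by
      linear_combination (-X (2, 0) x + X (0, 2) x) * hβα
  have hD : Invariant (fun x : E 𝕂 => β * blockDet x) := (Invariant.const β).mul invariant_blockDet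
  have hN' : Invariant (fun x : E 𝕂 => (((1 + ‖β * blockDet x‖ ^ 2) ^ (-1 : ℝ) : ℝ) : ℂ)) := by
    refine ⟨?_, fun a x => by rw [hD.2 a x], fun x => by rw [hD.3 x]⟩
    exact Function.HasTemperateGrowth.ofReal
      ((Function.hasTemperateGrowth_one_add_norm_sq_rpow ℂ (-1)).comp hD.1)
  have hs : Reduces 2 T (X (2, 1)) :=
    .of_nice ((Nice.mono 1 0 0 0 _ (.const 1)).congr fun x => by simp [mono])
  have hs' : Reduces 2 T (fun x => conj (X (2, 1) x)) :=
    .of_nice ((Nice.mono 0 1 0 0 _ (.const 1)).congr fun x => by simp [mono])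
  have hq : Reduces 2 T (X (1, 2)) :=
    .of_nice ((Nice.mono 0 0 1 0 _ (.const 1)).congr fun x => by simp [mono])
  have hq' : Reduces 2 T (fun x => conj (X (1, 2) x)) :=
    .of_nice ((Nice.mono 0 0 0 1 _ (.const 1)).congr fun x => by simp [mono])
  have hpr : Invariant (fun x : E 𝕂 => 2⁻¹ * (X (0, 2) x + X (2, 0) x)) := by
    refine ⟨(Function.HasTemperateGrowth.const _).mul ((tX _).add (tX _)), fun a x => ?_,
      fun x => ?_⟩
    · simp [X_tor, torusWeight]
    · simp [add_comm]
  have rp : Reduces 2 T (X (0, 2)) := (Reduces.of_invariant hpr).sub_kills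
    ((hp.1.const_mul (-2⁻¹)).congr fun x => by ring)
  have rp' : Reduces 2 T (fun x => conj (X (0, 2) x)) := (Reduces.of_invariant hpr.conj).sub_kills
    ((hp.2.const_mul (-2⁻¹)).congr fun x => by simp [Complex.conj_ofNat]; ring)
  have rr : Reduces 2 T (X (2, 0)) := (Reduces.of_invariant hpr).sub_kills
    ((hp.1.const_mul (2⁻¹)).congr fun x => by ring)
  have rr' : Reduces 2 T (fun x => conj (X (2, 0) x)) := (Reduces.of_invariant hpr.conj).sub_kills
    ((hp.2.const_mul (2⁻¹)).congr fun x => by simp [Complex.conj_ofNat]; ring)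
  have ru : Reduces 2 T (X (0, 1)) := (((Reduces.of_invariant hD).mul hs).const_mul (-1)).sub_kills
    (hu.1.congr fun x => by ring)
  have ru' : Reduces 2 T (fun x => conj (X (0, 1) x)) :=
    (((Reduces.of_invariant hD.conj).mul hs').const_mul (-1)).sub_kills
      (hu.2.congr fun x => by simp)
  have rv : Reduces 2 T (X (1, 0)) := (((Reduces.of_invariant hD).mul hq).const_mul (-1)).sub_kills
    (hv.1.congr fun x => by ring)
  have rv' : Reduces 2 T (fun x => conj (X (1, 0) x)) :=
    (((Reduces.of_invariant hD.conj).mul hq').const_mul (-1)).sub_kills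
      (hv.2.congr fun x => by simp)
  have key : Kills T (fun x => ((inner ℝ x (torN x) : ℝ) : ℂ)
      - ((1 + ‖β * blockDet x‖ ^ 2 : ℝ) : ℂ) * (X (2, 1) x * conj (X (2, 1) x)
        - X (1, 2) x * conj (X (1, 2) x))) := by
    refine (((hu.1.mul_left (tX (0, 1)).conj).sub (hu.2.mul_left (hD.1.mul (tX (2, 1))))).sub
      ((hv.1.mul_left (tX (1, 0)).conj).sub (hv.2.mul_left (hD.1.mul (tX (1, 2)))))).congr
      fun x => ?_
    rw [inner_torN, Complex.ofReal_add, Complex.ofReal_pow, ← Complex.mul_conj']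
    simp only [Pi.mul_apply, map_add, map_mul, Complex.ofReal_one]
    ring
  refine eq_zero_of_reduces (i₀ := 2) (by decide) H.torus H.skew hN' (fun x => ?_) key ?_ ?_
  · rw [← Complex.ofReal_mul, Real.rpow_neg_one, mul_inv_cancel₀ (by positivity), Complex.ofReal_one]
  · rintro ⟨i, j⟩
    fin_cases i <;> fin_cases j <;>
      first | exact .of_invariant (invariant_X _) | exact .of_kills hz.1 | assumption
  · rintro ⟨i, j⟩
    fin_cases i <;> fin_cases j <;>
      first | exact .of_invariant (invariant_X _).conj | exact .of_kills hz.2 | assumption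

end Corner

end GL3

namespace GL3

open SchwartzMap

section OpenPart

variable {𝕂 : Type*} [RCLike 𝕂] {T : 𝓢(E 𝕂, ℂ) →L[ℂ] ℂ} {α : 𝕂}

theorem tor_tor (a b : 𝕂ˣ) (x : E 𝕂) : tor a (tor b x) = tor (a * b) x := by
  ext ⟨i, j⟩
  fin_cases i <;> fin_cases j <;> simp [torusWeight] <;> ring

theorem tor_one (x : E 𝕂) : tor 1 x = x := by
  ext ⟨i, j⟩
  fin_cases i <;> fin_cases j <;> simp [torusWeight]

theorem tau_tor_tau (a : 𝕂ˣ) (x : E 𝕂) : tau (tor a (tau x)) = tor a⁻¹ x := by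
  ext ⟨i, j⟩
  fin_cases i <;> fin_cases j <;> simp [torusWeight]

theorem abs_det_tau : |LinearMap.det ((tau : E 𝕂 ≃L[ℝ] E 𝕂) : E 𝕂 →ₗ[ℝ] E 𝕂)| = 1 := by
  have h : ((tau : E 𝕂 ≃L[ℝ] E 𝕂) : E 𝕂 →ₗ[ℝ] E 𝕂) ∘ₗ ((tau : E 𝕂 ≃L[ℝ] E 𝕂) : E 𝕂 →ₗ[ℝ] E 𝕂)
      = LinearMap.id := LinearMap.ext tau_tau
  have h1 := congrArg LinearMap.det h
  rw [LinearMap.det_comp, LinearMap.det_id] at h1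
  rw [← abs_one, ← sq_eq_sq_iff_abs_eq_abs, one_pow, sq, h1]

theorem abs_det_tor (a : 𝕂ˣ) :
    |LinearMap.det ((tor a : E 𝕂 ≃L[ℝ] E 𝕂) : E 𝕂 →ₗ[ℝ] E 𝕂)| = 1 := by
  have h : ((tor a⁻¹ : E 𝕂 ≃L[ℝ] E 𝕂) : E 𝕂 →ₗ[ℝ] E 𝕂) ∘ₗ
      ((tor a : E 𝕂 ≃L[ℝ] E 𝕂) : E 𝕂 →ₗ[ℝ] E 𝕂) = LinearMap.id :=
    LinearMap.ext fun x => by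
      change tor a⁻¹ (tor a x) = x
      rw [tor_tor, inv_mul_cancel, tor_one]
  have h' : ((tau : E 𝕂 ≃L[ℝ] E 𝕂) : E 𝕂 →ₗ[ℝ] E 𝕂) ∘ₗ
      (((tor a : E 𝕂 ≃L[ℝ] E 𝕂) : E 𝕂 →ₗ[ℝ] E 𝕂) ∘ₗ
      ((tau : E 𝕂 ≃L[ℝ] E 𝕂) : E 𝕂 →ₗ[ℝ] E 𝕂)) = ((tor a⁻¹ : E 𝕂 ≃L[ℝ] E 𝕂) : E 𝕂 →ₗ[ℝ] E 𝕂) :=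
    LinearMap.ext (tau_tor_tau a)
  have h1 := congrArg (fun f => |LinearMap.det f|) h
  simp only at h1
  rw [← h', LinearMap.det_comp, LinearMap.det_comp, LinearMap.det_comp, LinearMap.det_id, abs_mul,
    abs_mul, abs_mul, abs_det_tau, abs_one, one_mul, mul_one] at h1
  rw [← abs_abs, ← abs_one, ← sq_eq_sq_iff_abs_eq_abs, one_pow, sq, h1]

/-- The element dual to `a` for the real inner product. -/
noncomputable def dualUnit (a : 𝕂ˣ) : 𝕂ˣ := (star a)⁻¹

theorem inner_tor_tor (a : 𝕂ˣ) (x y : E 𝕂) :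
    (inner ℝ (tor a x) (tor (dualUnit a) y) : ℝ) = inner ℝ x y := by
  rw [inner_eq, inner_eq]
  refine Finset.sum_congr rfl fun i _ => ?_
  rw [inner_re, inner_re, tor_apply, tor_apply]
  have h : star ((torusWeight a i : 𝕂ˣ) : 𝕂) * (torusWeight (dualUnit a) i : 𝕂ˣ) = 1 := by
    have h1 : star (torusWeight a i) * torusWeight (dualUnit a) i = 1 := by
      obtain ⟨i, j⟩ := i
      fin_cases i <;> fin_cases j <;> simp [torusWeight, dualUnit]
    rw [← Units.coe_star, ← Units.val_mul, h1, Units.val_one]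
  congr 1
  rw [star_mul']
  linear_combination (star (x i) * y i) * h

theorem inner_tau_tau (x y : E 𝕂) : (inner ℝ (tau x) (tau y) : ℝ) = inner ℝ x y := by
  rw [inner_eq, inner_eq]
  exact Fintype.sum_equiv (Equiv.prodComm _ _) _ _ fun i => by simp

theorem TorusInvariant.comp_fourier (hT : TorusInvariant T) :
    TorusInvariant (T.comp (FourierTransform.fourierCLM ℂ 𝓢(E 𝕂, ℂ))) := fun a φ φ' h =>
  hT (dualUnit a) _ _ fun x => by
    change (𝓕 φ' : 𝓢(E 𝕂, ℂ)) x = (𝓕 φ : 𝓢(E 𝕂, ℂ)) _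
    rw [show φ' = compCLMOfContinuousLinearEquiv ℂ (tor a) φ from SchwartzMap.ext h,
      fourier_compCLMOfContinuousLinearEquiv (abs_det_tor a) (inner_tor_tor a)]
    rfl

theorem TransposeSkew.comp_fourier (hT : TransposeSkew T) :
    TransposeSkew (T.comp (FourierTransform.fourierCLM ℂ 𝓢(E 𝕂, ℂ))) := fun φ φ' h =>
  hT _ _ fun x => by
    change (𝓕 φ' : 𝓢(E 𝕂, ℂ)) x = (𝓕 φ : 𝓢(E 𝕂, ℂ)) _
    rw [show φ' = compCLMOfContinuousLinearEquiv ℂ tau φ from SchwartzMap.ext h,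
      fourier_compCLMOfContinuousLinearEquiv abs_det_tau inner_tau_tau]
    rfl

/-- The symbol as a continuous linear map. -/
noncomputable def symbCLM (𝕂 : Type*) [RCLike 𝕂] : 𝕂 →L[ℝ] ℂ :=
  (2 * Real.pi * Complex.I) • (Complex.ofRealCLM.comp RCLike.reCLM)

theorem symbCLM_apply (w : 𝕂) : symbCLM 𝕂 w = symb w := rfl

theorem eq_re_smul_add_im_smul {F : Type*} [AddCommGroup F] [Module ℝ F] (ℓ : 𝕂 →ₗ[ℝ] F) (w v : 𝕂) :
    ℓ (w * v) = RCLike.re w • ℓ (1 * v) + RCLike.im w • ℓ (RCLike.I * v) := by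
  rw [← map_smul, ← map_smul, ← map_add]
  congr 1
  conv_lhs => rw [← RCLike.re_add_im w]
  simp only [RCLike.real_smul_eq_coe_mul]
  ring

theorem annihilates_variable {i : Fin 3 × Fin 3} {f m k : E 𝕂 → 𝕂} (hf : f.HasTemperateGrowth)
    (hm : m.HasTemperateGrowth) (hk : k.HasTemperateGrowth)
    (H : ∀ d : 𝕂, Annihilates T (fun x => symb (d * f x)) (fun x => e i (d * m x)))
    (hki : ∀ x w, fderiv ℝ k x (e i w) = 0) :
    Annihilates T (fun x => symb (k x * f x)) (fun x => e i (k x * m x)) := by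
  have h1 : ∀ x w, fderiv ℝ (fun x => RCLike.re (k x)) x (e i w) = 0 := fun x w => by
    have := (RCLike.reCLM (K := 𝕂)).hasFDerivAt.comp x (hk.differentiable x).hasFDerivAt
    rw [show (fun x => RCLike.re (k x)) = RCLike.reCLM (K := 𝕂) ∘ k from rfl, this.fderiv,
      ContinuousLinearMap.comp_apply, hki, map_zero]
  have h2 : ∀ x w, fderiv ℝ (fun x => RCLike.im (k x)) x (e i w) = 0 := fun x w => by
    have := (RCLike.imCLM (K := 𝕂)).hasFDerivAt.comp x (hk.differentiable x).hasFDerivAt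
    rw [show (fun x => RCLike.im (k x)) = RCLike.imCLM (K := 𝕂) ∘ k from rfl, this.fderiv,
      ContinuousLinearMap.comp_apply, hki, map_zero]
  have hd : ∀ d : 𝕂, (fun x => symb (d * f x)).HasTemperateGrowth := fun d =>
    symb_temperate ((Function.HasTemperateGrowth.const d).mul hf)
  have hd' : ∀ d : 𝕂, (fun x => e i (d * m x)).HasTemperateGrowth := fun d =>
    e_temperate ((Function.HasTemperateGrowth.const d).mul hm) i
  refine (((H 1).smul (re_temperate hk) fun x => h1 x _).add
    ((H RCLike.I).smul (im_temperate hk) fun x => h2 x _)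
    ((re_temperate hk).ofReal.mul (hd 1)) ((re_temperate hk).smul (hd' 1))).congr
    (fun x => ?_) (fun x => ?_)
  · simp only [← symbCLM_apply]
    exact (eq_re_smul_add_im_smul (symbCLM 𝕂 : 𝕂 →ₗ[ℝ] ℂ) (k x) (f x)).trans
      (by simp only [Complex.real_smul]; rfl)
  · exact eq_re_smul_add_im_smul (e (𝕂 := 𝕂) i).toLinearMap (k x) (m x)

theorem fderiv_cexp_symb {Q : E 𝕂 → 𝕂} (hQ : Q.HasTemperateGrowth) (x w : E 𝕂) :
    fderiv ℝ (fun x => Complex.exp (symb (Q x))) x w =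
      Complex.exp (symb (Q x)) * symb (fderiv ℝ Q x w) := by
  have h := (((symbCLM 𝕂).hasFDerivAt.comp x (hQ.differentiable x).hasFDerivAt)).cexp
  rw [show (fun x => Complex.exp (symb (Q x))) = fun x => Complex.exp ((symbCLM 𝕂 ∘ Q) x) from rfl,
    h.fderiv]
  rfl

theorem symb_re (w : 𝕂) : (symb w).re = 0 := by simp [symb]

theorem cexp_symb_temperate {Q : E 𝕂 → 𝕂} (hQ : Q.HasTemperateGrowth) :
    (fun x => Complex.exp (symb (Q x))).HasTemperateGrowth :=
  (symb_temperate hQ).cexp_of_re_eq_zero fun _ => symb_re _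

/-- The phase which straightens the relations away from the vanishing locus of the corner. -/
noncomputable def phase (α : 𝕂) (η : 𝕂 → 𝕂) (x : E 𝕂) : 𝕂 :=
  η (x (2, 2)) * (α * (x (0, 2) + x (2, 0)) - x (0, 2) * x (0, 0) * x (2, 0)
    - x (0, 2) * x (1, 0) * x (2, 1) - x (1, 2) * x (0, 1) * x (2, 0)
    - x (1, 2) * x (1, 1) * x (2, 1))

theorem phase_temperate {η : 𝕂 → 𝕂} (hη : (fun x : E 𝕂 => η (x (2, 2))).HasTemperateGrowth) :
    (phase α η).HasTemperateGrowth := by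
  have h := coord_temperate (𝕂 := 𝕂)
  have h3 := fun i j k => ((h i).mul (h j)).mul (h k)
  exact hη.mul ((((((Function.HasTemperateGrowth.const α).mul ((h _).add (h _))).sub
    (h3 _ _ _)).sub (h3 _ _ _)).sub (h3 _ _ _)).sub (h3 _ _ _))

theorem phase_tau (η : 𝕂 → 𝕂) (x : E 𝕂) : phase α η (tau x) = phase α η x := by
  simp only [phase, tau_apply, Prod.swap_prod_mk]; ring

theorem phase_tor (η : 𝕂 → 𝕂) (a : 𝕂ˣ) (x : E 𝕂) : phase α η (tor a x) = phase α η x := by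
  have h : (a : 𝕂) * ((a⁻¹ : 𝕂ˣ) : 𝕂) = 1 := by simp
  simp [phase, torusWeight, -Units.val_inv_eq_inv_val]
  left
  linear_combination (-x.ofLp (0, 2) * x.ofLp (1, 0) * x.ofLp (2, 1)
    - x.ofLp (1, 2) * x.ofLp (0, 1) * x.ofLp (2, 0) - x.ofLp (1, 2) * x.ofLp (1, 1) * x.ofLp (2, 1)) * h

/-- A distribution satisfying the relations vanishes where the corner is invertible. -/
theorem Rel.comp_eq_zero (H : Rel α T) {θ : 𝕂 → ℂ}
    (hθ : (fun x : E 𝕂 => θ (x (2, 2))).HasTemperateGrowth) {η : 𝕂 → 𝕂}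
    (hη : (fun x : E 𝕂 => η (x (2, 2))).HasTemperateGrowth)
    (hθη : ∀ z, θ z ≠ 0 → η z * z = 1) :
    T.comp (smulLeftCLM ℂ (fun x : E 𝕂 => θ (x (2, 2)))) = 0 := by
  have ht := fun i j : Fin 3 × Fin 3 => (coord_temperate (𝕂 := 𝕂) i).mul (coord_temperate j)
  set T₁ := T.comp (smulLeftCLM ℂ (fun x : E 𝕂 => θ (x (2, 2)))) with hT₁
  have H₁ : Rel α T₁ := H.comp_smulLeftCLM hθ
  set Q : E 𝕂 → 𝕂 := phase α η with hQ
  have hQt : Q.HasTemperateGrowth := phase_temperate hη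
  set h : E 𝕂 → ℂ := fun x => Complex.exp (symb (Q x)) with hh
  have hht : h.HasTemperateGrowth := cexp_symb_temperate hQt
  have hhi : Invariant h := ⟨hht, fun a x => by simp only [hh, hQ, phase_tor],
    fun x => by simp only [hh, hQ, phase_tau]⟩
  set T₂ := T₁.comp (smulLeftCLM ℂ h) with hT₂
  have straight : ∀ (i : Fin 3 × Fin 3) (f : E 𝕂 → 𝕂), f.HasTemperateGrowth → i ≠ (2, 2) →
      (∀ d : 𝕂, Annihilates T₁ (fun x => symb (d * f x)) (fun x => e i (d * x (2, 2)))) →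
      (∀ (x : E 𝕂) (w : 𝕂) (t : ℝ), Q (x + t • e i w) = Q x + t • -(η (x (2, 2)) * w * f x)) →
      ∀ w, Annihilates T₂ (fun _ => 0) (fun _ => e i w) := by
    intro i f hf hi hrel hQd w
    have hkt : (fun x : E 𝕂 => η (x (2, 2)) * w).HasTemperateGrowth := hη.mul (.const w)
    have h1 := annihilates_variable hf (coord_temperate (2, 2)) hkt hrel fun x v => by
      refine fderiv_eq_of_forall_add_smul hkt.differentiable fun t => ?_
      simp [hi.symm]
    have h2 : Annihilates T₁ (fun x => symb (η (x (2, 2)) * w * f x)) (fun _ => e i w) :=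
      h1.of_eq_on_support hθ (symb_temperate (hkt.mul hf))
        (e_temperate (hkt.mul (coord_temperate (2, 2))) i) (fun x _ => rfl) fun x hx => by
          rw [mul_right_comm, hθη _ hx, one_mul]
    refine h2.comp_smulLeftCLM hht fun x => ?_
    rw [hh, fderiv_cexp_symb hQt,
      fderiv_eq_of_forall_add_smul hQt.differentiable (hQd x w), ← symbCLM_apply (-_), map_neg,
      symbCLM_apply]
    ring
  have hp := straight (0, 2) _ (((ht _ _).add (ht _ _)).sub (.const α)) (by decide) H₁.rel_p
    fun x w t => by
      simp [hQ, phase, RCLike.real_smul_eq_coe_mul]; ring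
  have hq := straight (1, 2) _ ((ht _ _).add (ht _ _)) (by decide) H₁.rel_q
    fun x w t => by
      simp [hQ, phase, RCLike.real_smul_eq_coe_mul]; ring
  have hr := straight (2, 0) _ (((ht _ _).add (ht _ _)).sub (.const α)) (by decide) H₁.rel_r
    fun x w t => by
      simp [hQ, phase, RCLike.real_smul_eq_coe_mul]; ring
  have hs := straight (2, 1) _ ((ht _ _).add (ht _ _)) (by decide) H₁.rel_s
    fun x w t => by
      simp [hQ, phase, RCLike.real_smul_eq_coe_mul]; ring
  set T₃ := T₂.comp (FourierTransform.fourierCLM ℂ 𝓢(E 𝕂, ℂ)) with hT₃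
  have kill : ∀ i : Fin 3 × Fin 3, (∀ w, Annihilates T₂ (fun _ => 0) (fun _ => e i w)) →
      Kills₂ T₃ (X i) := by
    intro i hi
    have h1 : ∀ w : 𝕂, Kills T₃ (fun x => ((RCLike.re (star (x i) * w) : ℝ) : ℂ)) := fun w => by
      have h2 := Function.hasTemperateGrowth_inner_left (e i w)
      simp only [← inner_e]
      refine ⟨h2.ofReal, fun φ φ' hφ => ?_⟩
      rw [show φ' = smulLeftCLM ℂ (inner ℝ · (e i w)) φ from SchwartzMap.ext fun x => by
        rw [smulLeftCLM_apply_apply h2, hφ, Complex.real_smul]]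
      change T₂ (𝓕 (smulLeftCLM ℂ (inner ℝ · (e i w)) φ)) = 0
      rw [fourier_smulLeftCLM_inner, map_smul, hi w (𝓕 φ) _ fun x => ?_, smul_zero]
      rw [zero_mul, zero_add, lineDerivOp_apply_eq_fderiv]
    refine Kills₂.of_re_im ((h1 1).congr fun x => by simp) ((h1 RCLike.I).congr fun x => ?_)
    rcases RCLike.I_eq_zero_or_im_I_eq_one (K := 𝕂) with hI | hI
    · rw [← RCLike.mul_im_I_ax (x i), hI]; simp
    · simp [hI]
  have kp := kill _ hp
  have kq := kill _ hq
  have kr := kill _ hr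
  have ks := kill _ hs
  have hT₃0 : T₃ = 0 := by
    have ru : Reduces 0 T₃ (X (0, 1)) :=
      .of_nice ((Nice.mono 1 0 0 0 _ (.const 1)).congr fun x => by simp [mono])
    have ru' : Reduces 0 T₃ (fun x => conj (X (0, 1) x)) :=
      .of_nice ((Nice.mono 0 1 0 0 _ (.const 1)).congr fun x => by simp [mono])
    have rv : Reduces 0 T₃ (X (1, 0)) :=
      .of_nice ((Nice.mono 0 0 1 0 _ (.const 1)).congr fun x => by simp [mono])
    have rv' : Reduces 0 T₃ (fun x => conj (X (1, 0) x)) :=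
      .of_nice ((Nice.mono 0 0 0 1 _ (.const 1)).congr fun x => by simp [mono])
    refine eq_zero_of_reduces (i₀ := 0) (κ := fun _ => 1) (by decide)
      (H₁.torus.comp_smulLeftCLM hhi).comp_fourier (H₁.skew.comp_smulLeftCLM hhi).comp_fourier
      (.const 1) (fun x => one_mul 1)
      (((ks.2.mul_left (X_temperate (2, 1))).sub (kq.2.mul_left (X_temperate (1, 2)))).congr
        fun x => by rw [inner_torN]; ring) ?_ ?_
    · rintro ⟨i, j⟩
      fin_cases i <;> fin_cases j <;>
        first | exact .of_invariant (invariant_X _) | assumption | exact .of_kills (kill _ ‹_›).1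
    · rintro ⟨i, j⟩
      fin_cases i <;> fin_cases j <;>
        first | exact .of_invariant (invariant_X _).conj | assumption | exact .of_kills (kill _ ‹_›).2
  have hT₂0 : ∀ φ, T₂ φ = 0 := fun φ => by
    have h1 := DFunLike.congr_fun hT₃0 (𝓕⁻ φ)
    rw [hT₃] at h1
    change T₂ (𝓕 (𝓕⁻ φ)) = 0 at h1
    rwa [FourierTransform.fourier_fourierInv_eq] at h1
  ext φ
  have ht' : (fun x => Complex.exp (symb (-Q x))).HasTemperateGrowth := cexp_symb_temperate hQt.neg
  obtain ⟨φ', hφ'⟩ := exists_mul ht' φ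
  rw [_root_.zero_apply, ← hT₂0 φ', hT₂]
  change T₁ φ = T₁ (smulLeftCLM ℂ h φ')
  congr 1
  ext x
  rw [smulLeftCLM_apply_apply hht, hφ', smul_eq_mul, ← mul_assoc, hh, ← Complex.exp_add,
    ← symbCLM_apply, ← symbCLM_apply, ← map_add, add_neg_cancel, map_zero, Complex.exp_zero,
    one_mul]

end OpenPart

end GL3

namespace SchwartzMap

section FiniteOrder

variable {V W : Type*} [NormedAddCommGroup V] [NormedSpace ℝ V] [NormedAddCommGroup W]
  [NormedSpace ℝ W]

/-- Tempered distributions have finite order. -/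
theorem exists_order (T : 𝓢(V, ℂ) →L[ℂ] ℂ) : ∃ N : ℕ, ∀ Φ : ℕ → 𝓢(V, ℂ),
    (∀ k n, n ≤ N → Tendsto (fun i => SchwartzMap.seminorm ℝ k n (Φ i)) atTop (𝓝 0)) →
    Tendsto (fun i => T (Φ i)) atTop (𝓝 0) := by
  obtain ⟨s, C, -, hC⟩ := Seminorm.bound_of_continuous (schwartz_withSeminorms ℝ V ℂ)
    ((normSeminorm ℝ ℂ).comp (T.restrictScalars ℝ).toLinearMap)
    (continuous_norm.comp T.continuous)
  refine ⟨∑ m ∈ s, m.2, fun Φ hΦ => ?_⟩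
  have h1 : Tendsto (fun i => C * ∑ m ∈ s, SchwartzMap.seminorm ℝ m.1 m.2 (Φ i)) atTop (𝓝 0) := by
    have := (tendsto_finsetSum s fun m hm => hΦ m.1 m.2
      (Finset.single_le_sum (f := fun m : ℕ × ℕ => m.2) (fun _ _ => Nat.zero_le _) hm)).const_mul
      (C : ℝ)
    simpa using this
  refine squeeze_zero_norm (fun i => ?_) h1
  refine (hC (Φ i)).trans ?_
  change (C : ℝ) * (s.sup (schwartzSeminormFamily ℝ V ℂ)) (Φ i) ≤ _
  gcongr
  refine Seminorm.finset_sup_apply_le (Finset.sum_nonneg fun _ _ => apply_nonneg _ _) fun m hm => ?_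
  exact Finset.single_le_sum (f := fun m : ℕ × ℕ => SchwartzMap.seminorm ℝ m.1 m.2 (Φ i))
    (fun _ _ => apply_nonneg _ _) hm

theorem tendsto_seminorm_of_shrinking {θ : W → ℂ} (hθ : ContDiff ℝ ∞ θ) (hc : HasCompactSupport θ)
    (ℓ : V →L[ℝ] W) (φ : 𝓢(V, ℂ)) {Φ : ℕ → 𝓢(V, ℂ)} {m n : ℕ} (hnm : n < m) {ε : ℕ → ℝ}
    (hε0 : ∀ i, 0 < ε i) (hε1 : ∀ i, ε i ≤ 1) (hε : Tendsto ε atTop (𝓝 0))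
    (hΦ : ∀ i x, Φ i x = ((ε i : ℂ) ^ m * θ ((ε i)⁻¹ • ℓ x)) * φ x) (k : ℕ) :
    Tendsto (fun i => SchwartzMap.seminorm ℝ k n (Φ i)) atTop (𝓝 0) := by
  choose C hC0 hC using exists_norm_iteratedFDeriv_le_of_hasCompactSupport hθ hc
  set D := ∑ j ∈ Finset.range (n + 1), C j * ‖ℓ‖ ^ j with hD
  have hD0 : ∀ j ∈ Finset.range (n + 1), 0 ≤ C j * ‖ℓ‖ ^ j := fun j _ =>
    mul_nonneg (hC0 j) (by positivity)
  have hcd : ∀ i, ContDiff ℝ ∞ fun x => θ (((ε i)⁻¹ • ℓ) x) := fun i => hθ.comp ((ε i)⁻¹ • ℓ).contDiff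
  have key : ∀ i, SchwartzMap.seminorm ℝ k n (Φ i) ≤ (ε i * D) * 2 ^ n * (2 ^ (k + 0) *
      ((Finset.Iic (k + 0, n)).sup fun m => SchwartzMap.seminorm ℝ m.1 m.2) φ) := fun i => by
    refine seminorm_le_of_eq_mul k n 0 (mul_nonneg (hε0 i).le (Finset.sum_nonneg hD0))
      (g := fun x => ((ε i : ℂ) ^ m) • θ (((ε i)⁻¹ • ℓ) x)) ((hcd i).const_smul _)
      (fun j hj x => ?_) (hΦ i)
    have h1 : iteratedFDeriv ℝ j (fun x => ((ε i : ℂ) ^ m) • θ (((ε i)⁻¹ • ℓ) x)) x =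
        ((ε i : ℂ) ^ m) • iteratedFDeriv ℝ j (fun x => θ (((ε i)⁻¹ • ℓ) x)) x := by
      have h : (fun x => ((ε i : ℂ) ^ m) • θ (((ε i)⁻¹ • ℓ) x)) =
        ((ε i : ℂ) ^ m) • fun x => θ (((ε i)⁻¹ • ℓ) x) := rfl
      rw [h]
      exact iteratedFDeriv_const_smul_apply
        (((hcd i).of_le (m := (j : WithTop ℕ∞)) (mod_cast le_top)).contDiffAt)
    rw [h1, norm_smul, norm_pow, Complex.norm_real, Real.norm_of_nonneg (hε0 i).le, pow_zero, mul_one]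
    calc ε i ^ m * ‖iteratedFDeriv ℝ j (fun x => θ (((ε i)⁻¹ • ℓ) x)) x‖
        ≤ ε i ^ m * (C j * ((ε i)⁻¹ * ‖ℓ‖) ^ j) := by
          have := hε0 i
          gcongr
          refine (norm_iteratedFDeriv_comp_clm_le hθ _ j x).trans ?_
          gcongr
          · exact hC0 j
          · exact hC j _
          · rw [norm_smul, norm_inv, Real.norm_of_nonneg (hε0 i).le]
      _ = ε i ^ (m - j) * (C j * ‖ℓ‖ ^ j) := by
          have h2 : ε i ^ m = ε i ^ (m - j) * ε i ^ j := by rw [← pow_add]; congr 1; omega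
          have h3 : ε i ^ j * ((ε i)⁻¹) ^ j = 1 := by
            rw [← mul_pow, mul_inv_cancel₀ (hε0 i).ne', one_pow]
          rw [h2, mul_pow]
          linear_combination (ε i ^ (m - j) * C j * ‖ℓ‖ ^ j) * h3
      _ ≤ ε i * D := by
          refine mul_le_mul ?_ ?_ (hD0 j (by simp; omega)) (hε0 i).le
          · exact (pow_le_pow_of_le_one (hε0 i).le (hε1 i) (by omega : 1 ≤ m - j)).trans_eq (pow_one _)
          · exact Finset.single_le_sum (f := fun j => C j * ‖ℓ‖ ^ j) hD0 (by simp; omega)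
  refine squeeze_zero (fun i => apply_nonneg _ _) key ?_
  have := ((hε.mul_const D).mul_const ((2 : ℝ) ^ n)).mul_const (2 ^ (k + 0) *
      ((Finset.Iic (k + 0, n)).sup fun m => SchwartzMap.seminorm ℝ m.1 m.2) φ)
  simpa using this

end FiniteOrder

end SchwartzMap

namespace GL3

open SchwartzMap

section Cutoff

variable {𝕂 : Type*} [RCLike 𝕂] {T : 𝓢(E 𝕂, ℂ) →L[ℂ] ℂ} {α : 𝕂}

theorem exists_temperate_inverse {δ : ℝ} (hδ : 0 < δ) (M : ℝ) :
    ∃ η : 𝕂 → 𝕂, η.HasTemperateGrowth ∧ ∀ z, δ < ‖z‖ → ‖z‖ ≤ M → η z * z = 1 := by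
  obtain ⟨B, hB, hBc, hB1, -⟩ := exists_contDiff_bump 𝕂
  obtain ⟨ρ, hρ⟩ := hBc.isCompact.isBounded.exists_norm_le
  have hρ' : ∀ z, ρ < ‖z‖ → B z = 0 := fun z hz =>
    image_eq_zero_of_notMem_tsupport fun h => absurd (hρ z h) (not_le.2 hz)
  set r := (|ρ| + 1) / δ with hr
  have hr0 : 0 < r := by positivity
  set R := (|M| + 1)⁻¹ with hR
  have hR0 : 0 < R := by positivity
  set k : 𝕂 → ℂ := fun z => (1 - B (r • z)) * B (R • z) * (((‖z‖ ^ 2)⁻¹ : ℝ) : ℂ) with hk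
  have hkc : HasCompactSupport k := by
    refine HasCompactSupport.mul_right (HasCompactSupport.mul_left ?_)
    exact hBc.comp_homeomorph (Homeomorph.smulOfNeZero R hR0.ne')
  have hks : ContDiff ℝ ∞ k := by
    rw [contDiff_iff_contDiffAt]
    intro z
    by_cases hz : z = 0
    · have h0 : k =ᶠ[𝓝 z] fun _ => 0 := by
        have h1 : ∀ᶠ y in 𝓝 z, ‖r • y‖ < 1 := by
          refine (isOpen_lt (by fun_prop) continuous_const).mem_nhds ?_
          simp [hz]
        filter_upwards [h1] with y hy
        simp [hk, hB1 _ hy.le]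
      exact contDiffAt_const.congr_of_eventuallyEq h0
    · have hn : ContDiffAt ℝ ∞ (fun z : 𝕂 => (‖z‖ ^ 2)⁻¹) z :=
        (contDiff_norm_sq ℝ).contDiffAt.inv (by simpa using hz)
      have h1 : ContDiff ℝ ∞ fun z : 𝕂 => B (r • z) := hB.comp (by fun_prop)
      have h2 : ContDiff ℝ ∞ fun z : 𝕂 => B (R • z) := hB.comp (by fun_prop)
      exact ((contDiff_const.sub h1).mul h2).contDiffAt.mul
        ((Complex.ofRealCLM.contDiff.contDiffAt).comp z hn)
  have hkt := Function.HasTemperateGrowth.of_hasCompactSupport hks hkc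
  refine ⟨fun z => (k z).re • star z, ?_, fun z h1 h2 => ?_⟩
  · exact (Complex.reCLM.hasTemperateGrowth.comp hkt).smul
      (RCLike.conjCLE (K := 𝕂) : 𝕂 →L[ℝ] 𝕂).hasTemperateGrowth
  · have hz0 : 0 < ‖z‖ := hδ.trans h1
    have h3 : B (r • z) = 0 := hρ' _ (by
      rw [norm_smul, Real.norm_of_nonneg hr0.le, hr, div_mul_eq_mul_div, lt_div_iff₀ hδ]
      nlinarith [le_abs_self ρ, abs_nonneg ρ])
    have h4 : B (R • z) = 1 := hB1 _ (by
      rw [norm_smul, Real.norm_of_nonneg hR0.le, hR, inv_mul_le_iff₀ (by positivity)]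
      linarith [le_abs_self M])
    simp only [hk, h3, h4, sub_zero, one_mul, Complex.ofReal_re]
    rw [smul_mul_assoc, RCLike.star_def, RCLike.conj_mul, RCLike.real_smul_eq_coe_mul]
    norm_cast
    rw [inv_mul_cancel₀ (by positivity)]

/-- The corner entry as a continuous linear map. -/
noncomputable def cornerCLM (𝕂 : Type*) [RCLike 𝕂] : E 𝕂 →L[ℝ] 𝕂 :=
  PiLp.proj 2 (𝕜 := ℝ) (fun _ : Fin 3 × Fin 3 => 𝕂) (2, 2)

theorem cutoff_temperate {B : 𝕂 → ℂ} (hB : ContDiff ℝ ∞ B) (hBc : HasCompactSupport B) (c : ℝ) :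
    (fun x : E 𝕂 => B (c • x (2, 2))).HasTemperateGrowth :=
  (Function.HasTemperateGrowth.of_hasCompactSupport hB hBc).comp
    (c • cornerCLM 𝕂).hasTemperateGrowth

/-- A distribution satisfying the relations is supported on the vanishing locus of the corner. -/
theorem Rel.apply_eq_zero_of_cutoff (H : Rel α T) {B : 𝕂 → ℂ} (hB : ContDiff ℝ ∞ B)
    (hBc : HasCompactSupport B) (hB1 : ∀ z, ‖z‖ ≤ 1 → B z = 1) {ε : ℝ} (hε : 0 < ε)
    {φ φ' : 𝓢(E 𝕂, ℂ)} (hφ : ∀ x, φ' x = (1 - B (ε⁻¹ • x (2, 2))) * φ x) : T φ' = 0 := by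
  obtain ⟨ρ, hρ⟩ := hBc.isCompact.isBounded.exists_norm_le
  have hB0 : ∀ z, B z ≠ 0 → ‖z‖ ≤ ρ := fun z hz => hρ z (subset_tsupport _ hz)
  have hct := cutoff_temperate hB hBc
  choose Φ hΦ using fun n : ℕ => exists_mul (hct ((n + 1 : ℝ)⁻¹)) φ'
  have hΦb : IsSeminormBounded Φ := by
    refine (isSeminormBounded_const φ').of_eq_mul (isUniformlyTemperate_comp_clm hB hBc
      (ℓ := fun n : ℕ => (n + 1 : ℝ)⁻¹ • cornerCLM 𝕂) (M := ‖cornerCLM 𝕂‖) fun n => ?_) hΦ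
    rw [norm_smul, norm_inv, Real.norm_of_nonneg (by positivity)]
    exact mul_le_of_le_one_left (norm_nonneg _) (inv_le_one_of_one_le₀ (by linarith [n.cast_nonneg (α := ℝ)]))
  have hlim : Tendsto Φ atTop (𝓝 φ') := hΦb.tendsto fun x => by
    refine tendsto_const_nhds.congr' ?_
    filter_upwards [eventually_ge_atTop ⌈‖x (2, 2)‖⌉₊] with n hn
    rw [hΦ, hB1, one_mul]
    rw [norm_smul, norm_inv, Real.norm_of_nonneg (by positivity), inv_mul_le_iff₀ (by positivity)]
    linarith [Nat.ceil_le.1 hn]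
  have h0 : ∀ n, T (Φ n) = 0 := fun n => by
    obtain ⟨η, hη, hη1⟩ := exists_temperate_inverse (𝕂 := 𝕂) hε ((n + 1) * ρ)
    have hθ : (fun x : E 𝕂 => (fun z => (1 - B (ε⁻¹ • z)) * B ((n + 1 : ℝ)⁻¹ • z)) (x (2, 2)))
        |>.HasTemperateGrowth :=
      ((Function.HasTemperateGrowth.const 1).sub (hct _)).mul (hct _)
    have h1 := H.comp_eq_zero (θ := fun z => (1 - B (ε⁻¹ • z)) * B ((n + 1 : ℝ)⁻¹ • z))
      (η := η) hθ (hη.comp (cornerCLM 𝕂).hasTemperateGrowth) fun z hz => ?_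
    · have h2 := DFunLike.congr_fun h1 φ
      rw [_root_.zero_apply] at h2
      rw [← h2]
      change T (Φ n) = T (smulLeftCLM ℂ _ φ)
      congr 1
      ext x
      rw [smulLeftCLM_apply_apply hθ, hΦ, hφ, smul_eq_mul]
      ring
    · refine hη1 z ?_ ?_
      · by_contra! h
        refine left_ne_zero_of_mul hz ?_
        rw [hB1, sub_self]
        rwa [norm_smul, norm_inv, Real.norm_of_nonneg hε.le, inv_mul_le_iff₀ hε, mul_one]
      · have := hB0 _ (right_ne_zero_of_mul hz)
        rwa [norm_smul, norm_inv, Real.norm_of_nonneg (by positivity),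
          inv_mul_le_iff₀ (by positivity)] at this
  exact tendsto_nhds_unique (((T.continuous.tendsto φ').comp hlim).congr h0) tendsto_const_nhds

/-- Monomials in the corner entry and its conjugate. -/
noncomputable def cornerMono (a b : ℕ) (z : 𝕂) : ℂ := cx 𝕂 z ^ a * conj (cx 𝕂 z) ^ b

theorem cornerMono_temperate (a b : ℕ) :
    (fun x : E 𝕂 => cornerMono a b (x (2, 2))).HasTemperateGrowth := by
  have h1 := X_temperate (𝕂 := 𝕂) (2, 2)
  have h2 := h1.conj
  exact (h1.pow a).mul (h2.pow b)

theorem cornerMono_smul (a b : ℕ) (r : ℝ) (z : 𝕂) :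
    cornerMono a b (r • z) = (r : ℂ) ^ (a + b) * cornerMono a b z := by
  have h : cx 𝕂 (r • z) = (r : ℂ) * cx 𝕂 z := by
    rw [Algebra.smul_def, map_mul, AlgHomClass.commutes]; rfl
  simp only [cornerMono, h, map_mul, Complex.conj_ofReal]
  ring

theorem cornerMono_contDiff (a b : ℕ) : ContDiff ℝ ∞ (cornerMono a b : 𝕂 → ℂ) := by
  have h1 : ContDiff ℝ ∞ fun z : 𝕂 => cx 𝕂 z := (RCLike.map 𝕂 ℂ).contDiff
  have h2 : ContDiff ℝ ∞ fun z : 𝕂 => conj (cx 𝕂 z) := Complex.conjCLE.contDiff.comp h1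
  exact (h1.pow a).mul (h2.pow b)

theorem Rel.exists_comp_cornerMono_eq_zero (H : Rel α T) : ∃ N : ℕ, ∀ a b, N < a + b →
    T.comp (smulLeftCLM ℂ fun x : E 𝕂 => cornerMono a b (x (2, 2))) = 0 := by
  obtain ⟨N, hN⟩ := exists_order T
  obtain ⟨B, hB, hBc, hB1, -⟩ := exists_contDiff_bump 𝕂
  refine ⟨N, fun a b hab => ?_⟩
  ext φ
  have hg := cornerMono_temperate (𝕂 := 𝕂) a b
  set φ₁ := smulLeftCLM ℂ (fun x : E 𝕂 => cornerMono a b (x (2, 2))) φ with hφ₁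
  set ε : ℕ → ℝ := fun i => 1 / ((i : ℝ) + 1) with hε
  have hε0 : ∀ i, 0 < ε i := fun i => by positivity
  have hε1 : ∀ i, ε i ≤ 1 := fun i => by
    rw [hε]; exact (div_le_one (by positivity)).2 (by linarith [i.cast_nonneg (α := ℝ)])
  choose Φ hΦ using fun i : ℕ => exists_mul (cutoff_temperate hB hBc (ε i)⁻¹) φ₁
  have h1 : ∀ i, T (Φ i) = T φ₁ := fun i => by
    have := H.apply_eq_zero_of_cutoff hB hBc hB1 (hε0 i) (φ := φ₁) (φ' := φ₁ - Φ i) fun x => by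
      rw [_root_.sub_apply, hΦ]; ring
    rw [map_sub, sub_eq_zero] at this
    exact this.symm
  have h2 : Tendsto (fun i => T (Φ i)) atTop (𝓝 0) := hN Φ fun k n hn =>
    tendsto_seminorm_of_shrinking (θ := fun z => cornerMono a b z * B z)
      ((cornerMono_contDiff a b).mul hB) hBc.mul_left (cornerCLM 𝕂) φ (m := a + b) (by omega) hε0
      hε1 tendsto_one_div_add_atTop_nhds_zero_nat (fun i x => by
        have hc : (ε i : ℂ) ≠ 0 := Complex.ofReal_ne_zero.2 (hε0 i).ne'
        rw [hΦ, hφ₁, smulLeftCLM_apply_apply hg, cornerMono_smul]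
        change B ((ε i)⁻¹ • x (2, 2)) * (cornerMono a b (x (2, 2)) * φ x) =
          (ε i : ℂ) ^ (a + b) * ((((ε i)⁻¹ : ℝ) : ℂ) ^ (a + b) * cornerMono a b (x (2, 2)) *
            B ((ε i)⁻¹ • x (2, 2))) * φ x
        have h : (ε i : ℂ) ^ (a + b) * ((ε i : ℂ)⁻¹) ^ (a + b) = 1 := by
          rw [← mul_pow, mul_inv_cancel₀ hc, one_pow]
        rw [Complex.ofReal_inv]
        linear_combination (-(B ((ε i)⁻¹ • x (2, 2)) * cornerMono a b (x (2, 2)) * φ x)) * h) k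
  exact tendsto_nhds_unique (tendsto_const_nhds.congr fun i => (h1 i).symm) h2

/-- A distribution satisfying the relations with a nonzero parameter vanishes. -/
theorem Rel.eq_zero (H : Rel α T) (hα : α ≠ 0) : T = 0 := by
  obtain ⟨N, hN⟩ := H.exists_comp_cornerMono_eq_zero
  have hg := cornerMono_temperate (𝕂 := 𝕂)
  have key : ∀ n a b : ℕ, N < a + b + n →
      T.comp (smulLeftCLM ℂ fun x : E 𝕂 => cornerMono a b (x (2, 2))) = 0 := by
    intro n
    induction n with
    | zero => exact hN
    | succ n ih =>
      intro a b hab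
      refine (H.comp_smulLeftCLM (hg a b)).eq_zero_of_kills hα ⟨⟨X_temperate _, fun φ φ' h => ?_⟩,
        ⟨(X_temperate _).conj, fun φ φ' h => ?_⟩⟩
      · have h1 := DFunLike.congr_fun (ih (a + 1) b (by omega)) φ
        rw [_root_.zero_apply] at h1
        rw [← h1]
        change T (smulLeftCLM ℂ _ _) = T (smulLeftCLM ℂ _ _)
        congr 1
        ext x
        rw [smulLeftCLM_apply_apply (hg _ _), smulLeftCLM_apply_apply (hg _ _), h]
        simp only [cornerMono, X, smul_eq_mul]
        ring
      · have h1 := DFunLike.congr_fun (ih a (b + 1) (by omega)) φ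
        rw [_root_.zero_apply] at h1
        rw [← h1]
        change T (smulLeftCLM ℂ _ _) = T (smulLeftCLM ℂ _ _)
        congr 1
        ext x
        rw [smulLeftCLM_apply_apply (hg _ _), smulLeftCLM_apply_apply (hg _ _), h]
        simp only [cornerMono, X, smul_eq_mul]
        ring
  have h0 := key (N + 1) 0 0 (by omega)
  ext φ
  rw [← h0]
  change T _ = T _
  congr 1
  ext x
  change _ = smulLeftCLM ℂ _ φ x
  rw [smulLeftCLM_apply_apply (hg _ _)]
  simp [cornerMono]

end Cutoff

end GL3

namespace GL3

open SchwartzMap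

section UpperLeftFourier

variable {𝕂 : Type*} [RCLike 𝕂]

/-- Conjugate transposition of the upper left `2 × 2` block, killing the other entries. -/
noncomputable def upperLeft (𝕂 : Type*) [RCLike 𝕂] : E 𝕂 →L[ℝ] E 𝕂 :=
  LinearMap.toContinuousLinearMap
    { toFun := fun x => WithLp.toLp 2 fun i => if i.1 = 2 ∨ i.2 = 2 then 0 else star (x i.swap)
      map_add' := fun x y => by ext i; by_cases h : i.1 = 2 ∨ i.2 = 2 <;> simp [h]
      map_smul' := fun r x => by ext i; by_cases h : i.1 = 2 ∨ i.2 = 2 <;> simp [h] }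

theorem upperLeft_apply (x : E 𝕂) (i : Fin 3 × Fin 3) :
    upperLeft 𝕂 x i = if i.1 = 2 ∨ i.2 = 2 then 0 else star (x i.swap) := rfl

theorem upperLeft_symm (x y : E 𝕂) :
    (inner ℝ (upperLeft 𝕂 x) y : ℝ) = inner ℝ x (upperLeft 𝕂 y) := by
  simp only [inner_eq, inner_re, Fintype.sum_prod_type, Fin.sum_univ_three, upperLeft_apply]
  simp
  ring

theorem upperLeft_tor (a : 𝕂ˣ) (x : E 𝕂) :
    (inner ℝ (upperLeft 𝕂 (tor a x)) (tor a x) : ℝ) = inner ℝ (upperLeft 𝕂 x) x := by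
  rw [inner_eq, inner_eq]
  refine Finset.sum_congr rfl fun i _ => ?_
  rw [inner_re, inner_re, upperLeft_apply, upperLeft_apply]
  split_ifs
  · simp
  · rw [star_star, star_star, tor_apply, tor_apply]
    have h : ((torusWeight a i.swap : 𝕂ˣ) : 𝕂) * (torusWeight a i : 𝕂ˣ) = 1 := by
      rw [← Units.val_mul, ← Units.val_one]
      congr 1
      obtain ⟨i, j⟩ := i
      simp [torusWeight]
    congr 1
    linear_combination (x i.swap * x i) * h

theorem upperLeft_tau (x : E 𝕂) :
    (inner ℝ (upperLeft 𝕂 (tau x)) (tau x) : ℝ) = inner ℝ (upperLeft 𝕂 x) x := by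
  simp only [inner_eq, inner_re, Fintype.sum_prod_type, Fin.sum_univ_three, upperLeft_apply]
  simp
  ring

theorem upperLeft_e_of_eq_two {i : Fin 3 × Fin 3} (hi : i.1 = 2 ∨ i.2 = 2) (w : 𝕂) :
    upperLeft 𝕂 (e i w) = 0 := by
  ext j
  rw [upperLeft_apply, e_apply]
  split_ifs with h h'
  · rfl
  · exact absurd (by rw [← h'] at hi; simpa [or_comm] using hi) h
  · simp

theorem upperLeft_e {i : Fin 3 × Fin 3} (hi : ¬ (i.1 = 2 ∨ i.2 = 2)) (w : 𝕂) :
    upperLeft 𝕂 (e i w) = e i.swap (star w) := by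
  ext j
  rw [upperLeft_apply, e_apply, e_apply]
  split_ifs with h h' h' h'
  · exact absurd (by rw [h'] at h; simpa [or_comm] using h) hi
  · rfl
  · rfl
  · exact absurd (Prod.swap_eq_iff_eq_swap.1 ‹_›) h'
  · exact absurd (Prod.swap_eq_iff_eq_swap.2 ‹_›) ‹_›
  · simp

theorem TorusInvariant.comp_partialFourier {T : 𝓢(E 𝕂, ℂ) →L[ℂ] ℂ} (hT : TorusInvariant T) :
    TorusInvariant (T.comp (partialFourier (upperLeft 𝕂))) := fun a φ φ' h =>
  hT a _ _ fun x => by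
    change partialFourier (upperLeft 𝕂) φ' x = partialFourier (upperLeft 𝕂) φ _
    rw [show φ' = compCLMOfContinuousLinearEquiv ℂ (tor a) φ from SchwartzMap.ext h,
      partialFourier_compCLMOfContinuousLinearEquiv (abs_det_tor a) (inner_tor_tor a)
        (upperLeft_tor a) (upperLeft_tor _)]
    rfl

theorem TransposeSkew.comp_partialFourier {T : 𝓢(E 𝕂, ℂ) →L[ℂ] ℂ} (hT : TransposeSkew T) :
    TransposeSkew (T.comp (partialFourier (upperLeft 𝕂))) := fun φ φ' h =>
  hT _ _ fun x => by
    change partialFourier (upperLeft 𝕂) φ' x = partialFourier (upperLeft 𝕂) φ _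
    rw [show φ' = compCLMOfContinuousLinearEquiv ℂ tau φ from SchwartzMap.ext h,
      partialFourier_compCLMOfContinuousLinearEquiv abs_det_tau inner_tau_tau
        upperLeft_tau upperLeft_tau]
    rfl

theorem re_mul_partialFourier {i : Fin 3 × Fin 3} (hi : i.1 = 2 ∨ i.2 = 2) (d : 𝕂)
    {φ φ' : 𝓢(E 𝕂, ℂ)} (h : ∀ x, φ' x = (RCLike.re (d * x i) : ℝ) * φ x) (x : E 𝕂) :
    partialFourier (upperLeft 𝕂) φ' x =
      (RCLike.re (d * x i) : ℝ) * partialFourier (upperLeft 𝕂) φ x := by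
  have h1 : ∀ x : E 𝕂, (inner ℝ x (e i (star d)) : ℝ) = RCLike.re (d * x i) := fun x => by
    rw [inner_e, ← star_mul', RCLike.star_def, RCLike.conj_re, mul_comm]
  have h2 : (inner ℝ · (e i (star d)) : E 𝕂 → ℝ).HasTemperateGrowth := by fun_prop
  have h3 := smulLeftCLM_inner_partialFourier upperLeft_symm
    (upperLeft_e_of_eq_two hi (star d)) φ
  have h4 : φ' = smulLeftCLM ℂ (inner ℝ · (e i (star d))) φ := by
    ext x
    rw [smulLeftCLM_apply_apply h2, h, h1, Complex.real_smul]
  rw [h4, ← h3, smulLeftCLM_apply_apply h2, h1, Complex.real_smul]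

theorem re_I_mul (w : 𝕂) : RCLike.re (RCLike.I * w) = - RCLike.im w := by
  rw [RCLike.mul_re, RCLike.I_re, zero_mul, zero_sub, mul_comm, RCLike.mul_im_I_ax]

theorem fderiv_partialFourier {i j : Fin 3 × Fin 3} (hi : i.1 = 2 ∨ i.2 = 2) (d : 𝕂)
    {φ φ₁ φ₂ φ' : 𝓢(E 𝕂, ℂ)}
    (h₁ : ∂_{e j (1 : 𝕂)} (partialFourier (upperLeft 𝕂) φ) = partialFourier (upperLeft 𝕂) φ₁)
    (h₂ : ∂_{e j (RCLike.I : 𝕂)} (partialFourier (upperLeft 𝕂) φ) =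
      partialFourier (upperLeft 𝕂) φ₂)
    (h : ∀ x, φ' x = (RCLike.re (d * x i) : ℝ) * φ₁ x + (RCLike.im (d * x i) : ℝ) * φ₂ x)
    (x : E 𝕂) : partialFourier (upperLeft 𝕂) φ' x =
      fderiv ℝ (partialFourier (upperLeft 𝕂) φ) x (e j (d * x i)) := by
  have ht : ∀ w : 𝕂, (fun x : E 𝕂 => ((RCLike.re (w * x i) : ℝ) : ℂ)).HasTemperateGrowth := fun w =>
    (re_temperate ((Function.HasTemperateGrowth.const w).mul (coord_temperate i))).ofReal
  obtain ⟨χ₁, hχ₁⟩ := exists_mul (ht d) φ₁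
  obtain ⟨χ₂, hχ₂⟩ := exists_mul (ht (-RCLike.I * d)) φ₂
  have him : ∀ x : E 𝕂, RCLike.re (-RCLike.I * d * x i) = RCLike.im (d * x i) := fun x => by
    rw [mul_assoc, neg_mul, map_neg, re_I_mul, neg_neg]
  have h3 : φ' = χ₁ + χ₂ := by
    ext x
    rw [_root_.add_apply, h, hχ₁, hχ₂, him]
  have h4 := eq_re_smul_add_im_smul
    ((fderiv ℝ (partialFourier (upperLeft 𝕂) φ) x).comp (e j)).toLinearMap (d * x i) 1
  simp only [mul_one] at h4
  rw [h3, map_add, _root_.add_apply, re_mul_partialFourier hi d hχ₁,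
    re_mul_partialFourier hi _ hχ₂, him, ← h₁, ← h₂, lineDerivOp_apply_eq_fderiv,
    lineDerivOp_apply_eq_fderiv, ← Complex.real_smul, ← Complex.real_smul]
  exact h4.symm

theorem fderiv_partialFourier_of_ne_two {i j : Fin 3 × Fin 3} (hi : i.1 = 2 ∨ i.2 = 2)
    (hj : ¬ (j.1 = 2 ∨ j.2 = 2)) (d : 𝕂) {φ φ' : 𝓢(E 𝕂, ℂ)}
    (h : ∀ x, φ' x = symb (d * (x i * x j.swap)) * φ x) (x : E 𝕂) :
    partialFourier (upperLeft 𝕂) φ' x =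
      fderiv ℝ (partialFourier (upperLeft 𝕂) φ) x (e j (d * x i)) := by
  have hj' : ¬ (j.swap.1 = 2 ∨ j.swap.2 = 2) := fun h => hj (by simpa [or_comm] using h)
  have hw : ∀ w : 𝕂, upperLeft 𝕂 (upperLeft 𝕂 (e j w)) = e j w := fun w => by
    rw [upperLeft_e hj, upperLeft_e hj', star_star, Prod.swap_swap]
  have hg : ∀ w : 𝕂, (inner ℝ · (upperLeft 𝕂 (e j w)) : E 𝕂 → ℝ).HasTemperateGrowth := fun w => by
    fun_prop
  have hin : ∀ (w : 𝕂) (x : E 𝕂), (inner ℝ x (upperLeft 𝕂 (e j w)) : ℝ) =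
      RCLike.re (w * x j.swap) := fun w x => by
    rw [upperLeft_e hj, inner_e, ← star_mul', RCLike.star_def, RCLike.conj_re, mul_comm]
  refine fderiv_partialFourier hi d (lineDerivOp_partialFourier_of_involutive upperLeft_symm (hw 1) φ)
    (lineDerivOp_partialFourier_of_involutive upperLeft_symm (hw RCLike.I) φ) (fun x => ?_) x
  rw [h, _root_.smul_apply, _root_.smul_apply, smulLeftCLM_apply_apply (hg _),
    smulLeftCLM_apply_apply (hg _), hin, hin, one_mul, re_I_mul, symb, ← mul_assoc, RCLike.mul_re]
  simp only [smul_eq_mul, Complex.real_smul]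
  push_cast
  ring

theorem fderiv_partialFourier_of_eq_two {i j : Fin 3 × Fin 3} (hi : i.1 = 2 ∨ i.2 = 2)
    (hj : j.1 = 2 ∨ j.2 = 2) (d : 𝕂) {φ φ' : 𝓢(E 𝕂, ℂ)}
    (h : ∀ x, φ' x = fderiv ℝ φ x (e j (d * x i))) (x : E 𝕂) :
    partialFourier (upperLeft 𝕂) φ' x =
      fderiv ℝ (partialFourier (upperLeft 𝕂) φ) x (e j (d * x i)) := by
  refine fderiv_partialFourier hi d
    (lineDerivOp_partialFourier_of_map_eq_zero upperLeft_symm (upperLeft_e_of_eq_two hj _) φ)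
    (lineDerivOp_partialFourier_of_map_eq_zero upperLeft_symm (upperLeft_e_of_eq_two hj _) φ)
    (fun x => ?_) x
  have h4 := eq_re_smul_add_im_smul ((fderiv ℝ φ x).comp (e j)).toLinearMap (d * x i) 1
  simp only [mul_one] at h4
  rw [h, lineDerivOp_apply_eq_fderiv, lineDerivOp_apply_eq_fderiv, ← Complex.real_smul,
    ← Complex.real_smul]
  exact h4

/-- The infinitesimal row operation adding `d` times the last row to row `k`. -/
noncomputable def rowOp (k : Fin 3) (d : 𝕂) : E 𝕂 →L[ℝ] E 𝕂 :=
  LinearMap.toContinuousLinearMap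
    { toFun := fun x => WithLp.toLp 2 fun i => if i.1 = k then d * x (2, i.2) else 0
      map_add' := fun x y => by ext i; by_cases h : i.1 = k <;> simp [h, mul_add]
      map_smul' := fun r x => by ext i; by_cases h : i.1 = k <;> simp [h] }

theorem rowOp_apply (k : Fin 3) (d : 𝕂) (x : E 𝕂) (i : Fin 3 × Fin 3) :
    rowOp k d x i = if i.1 = k then d * x (2, i.2) else 0 := rfl

theorem rowOp_eq (k : Fin 3) (d : 𝕂) (x : E 𝕂) :
    rowOp k d x = e (k, 0) (d * x (2, 0)) + e (k, 1) (d * x (2, 1)) + e (k, 2) (d * x (2, 2)) := by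
  ext ⟨i, j⟩
  by_cases h : i = k
  · fin_cases j <;> simp [rowOp_apply, h]
  · simp [rowOp_apply, h]

theorem rowOp_rowOp {k : Fin 3} (hk : k ≠ 2) (d : 𝕂) (x : E 𝕂) : rowOp k d (rowOp k d x) = 0 := by
  ext i
  simp [rowOp_apply, hk.symm]

theorem annihilates_rowOp {T : 𝓢(E 𝕂, ℂ) →L[ℂ] ℂ} {k : Fin 3} (hk : k ≠ 2) (d : 𝕂) (c : ℂ)
    (hT : ∀ (s : ℝ) (φ φ' : 𝓢(E 𝕂, ℂ)), (∀ x, φ' x = φ (x + s • rowOp k d x)) →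
      T φ' = Complex.exp (c * s) * T φ) : Annihilates T (fun _ => -c) (rowOp k d) := by
  refine annihilates_of_flow T (rowOp k d)
    (fun s => ContinuousLinearMap.id ℝ _ + s • rowOp k d) c (fun x => ?_) (fun s x => ?_)
    (fun s x => ?_) hT
  · simp
  · simp [rowOp_rowOp hk]
  · have h : rowOp k d ((ContinuousLinearMap.id ℝ (E 𝕂) + s • rowOp k d) x) = rowOp k d x := by
      simp [rowOp_rowOp hk]
    rw [h]
    have := ((hasDerivAt_id s).smul_const (rowOp k d x)).const_add x
    simpa using this

theorem annihilates_comp_partialFourier {T : 𝓢(E 𝕂, ℂ) →L[ℂ] ℂ} {k : Fin 3} (hk : k ≠ 2) {d : 𝕂}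
    {g : ℂ} (H : Annihilates T (fun _ => g) (rowOp k d)) :
    Annihilates (T.comp (partialFourier (upperLeft 𝕂)))
      (fun x => g + symb (d * (x (2, 0) * x (0, k) + x (2, 1) * x (1, k))))
      (fun x => e (k, 2) (d * x (2, 2))) := by
  intro φ φ' h
  have ht : ∀ i j : Fin 3 × Fin 3, (fun x : E 𝕂 => symb (d * (x i * x j))).HasTemperateGrowth :=
    fun i j => symb_temperate ((Function.HasTemperateGrowth.const d).mul
      ((coord_temperate i).mul (coord_temperate j)))
  obtain ⟨φ₀, h₀⟩ := exists_mul (ht (2, 0) (0, k)) φ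
  obtain ⟨φ₁, h₁⟩ := exists_mul (ht (2, 1) (1, k)) φ
  obtain ⟨φ₂, h₂⟩ : ∃ φ₂ : 𝓢(E 𝕂, ℂ), ∀ x, φ₂ x = fderiv ℝ φ x (e (k, 2) (d * x (2, 2))) :=
    exists_fderiv_apply (e_temperate ((Function.HasTemperateGrowth.const d).mul
    (coord_temperate (2, 2))) (k, 2)) φ
  have h3 : φ' = g • φ + φ₀ + φ₁ + φ₂ := by
    ext x
    simp only [_root_.add_apply, _root_.smul_apply, h, h₀, h₁, h₂, mul_add, ← symbCLM_apply,
      map_add, smul_eq_mul]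
    ring
  refine H (partialFourier (upperLeft 𝕂) φ) _ fun x => ?_
  change partialFourier (upperLeft 𝕂) φ' x = _
  rw [h3, rowOp_eq, map_add, map_add, map_add, map_smul, map_add, map_add, _root_.add_apply,
    _root_.add_apply, _root_.add_apply, _root_.smul_apply,
    fderiv_partialFourier_of_ne_two (i := (2, 0)) (j := (k, 0)) (by simp) (by simpa using hk) d h₀,
    fderiv_partialFourier_of_ne_two (i := (2, 1)) (j := (k, 1)) (by simp) (by simpa using hk) d h₁,
    fderiv_partialFourier_of_eq_two (i := (2, 2)) (j := (k, 2)) (by simp) (by simp) d h₂,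
    smul_eq_mul]
  ring

end UpperLeftFourier

end GL3

namespace GL3

open SchwartzMap

section Assembly

variable {𝕂 : Type*} [RCLike 𝕂]

/-- A continuous unitary character is the exponential of a real linear form. -/
theorem exists_character_parameter {ψ : 𝕂 → ℂ} (hadd : ∀ s t, ψ (s + t) = ψ s * ψ t)
    (hu : ∀ t, ‖ψ t‖ = 1) (hc : Continuous ψ) :
    ∃ α : 𝕂, ∀ d (s : ℝ), ψ (s • d) = Complex.exp (symb (d * α) * s) := by
  have key : ∀ v : 𝕂, ∃ r : ℝ, ∀ t : ℝ, ψ (t • v) = Complex.exp (Complex.I * ((r * t : ℝ) : ℂ)) :=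
    fun v => exists_eq_cexp_of_map_add (h := fun t : ℝ => ψ (t • v)) (by fun_prop)
      (fun s t => by rw [add_smul, hadd]) fun t => hu _
  obtain ⟨r₁, h₁⟩ := key 1
  obtain ⟨r₂, h₂⟩ := key RCLike.I
  refine ⟨((r₁ / (2 * Real.pi) : ℝ) : 𝕂) - ((r₂ / (2 * Real.pi) : ℝ) : 𝕂) * RCLike.I, fun d s => ?_⟩
  have h3 : s • d = (s * RCLike.re d) • (1 : 𝕂) + (s * RCLike.im d) • (RCLike.I : 𝕂) := by
    conv_lhs => rw [← RCLike.re_add_im d]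
    simp only [RCLike.real_smul_eq_coe_mul]
    push_cast
    ring
  have h4 : RCLike.re (d * (((r₁ / (2 * Real.pi) : ℝ) : 𝕂) -
      ((r₂ / (2 * Real.pi) : ℝ) : 𝕂) * RCLike.I)) =
      (r₁ * RCLike.re d + r₂ * RCLike.im d) / (2 * Real.pi) := by
    have h5 : RCLike.im d * RCLike.im (RCLike.I : 𝕂) = RCLike.im d := RCLike.mul_im_I_ax d
    simp only [RCLike.mul_re, map_sub, RCLike.ofReal_re, RCLike.I_re,
      RCLike.ofReal_im, RCLike.im_ofReal_mul]
    linear_combination (r₂ / (2 * Real.pi)) * h5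
  rw [h3, hadd, h₁, h₂, ← Complex.exp_add, symb, h4]
  congr 1
  have : (Real.pi : ℂ) ≠ 0 := Complex.ofReal_ne_zero.2 Real.pi_ne_zero
  push_cast
  field_simp

theorem symb_zero : symb (0 : 𝕂) = 0 := by simp [symb]

/-- The Euclidean space of matrix entries is the space of matrices. -/
noncomputable def toMatrix (𝕂 : Type*) [RCLike 𝕂] : E 𝕂 ≃L[ℝ] Matrix (Fin 3) (Fin 3) 𝕂 :=
  LinearEquiv.toContinuousLinearEquiv
    { toFun := fun x => Matrix.of fun i j => x (i, j)
      invFun := fun m => WithLp.toLp 2 fun i => m i.1 i.2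
      map_add' := fun _ _ => rfl
      map_smul' := fun _ _ => rfl
      left_inv := fun _ => rfl
      right_inv := fun _ => rfl }

theorem toMatrix_apply (x : E 𝕂) (i j : Fin 3) : toMatrix 𝕂 x i j = x (i, j) := rfl

/-- Distributions on matrices as distributions on the Euclidean space of entries. -/
noncomputable def pullback (f : 𝓢(Matrix (Fin 3) (Fin 3) 𝕂, ℂ) →L[ℂ] ℂ) : 𝓢(E 𝕂, ℂ) →L[ℂ] ℂ :=
  f.comp (compCLMOfContinuousLinearEquiv ℂ (toMatrix 𝕂).symm)

theorem pullback_eq_smul {f : 𝓢(Matrix (Fin 3) (Fin 3) 𝕂, ℂ) →L[ℂ] ℂ} {A : E 𝕂 → E 𝕂}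
    {B : Matrix (Fin 3) (Fin 3) 𝕂 → Matrix (Fin 3) (Fin 3) 𝕂} {k : ℂ}
    (hf : ∀ φ φ' : 𝓢(Matrix (Fin 3) (Fin 3) 𝕂, ℂ), (∀ x, φ' x = φ (B x)) → f φ' = k * f φ)
    (hAB : ∀ x, toMatrix 𝕂 (A x) = B (toMatrix 𝕂 x)) {φ φ' : 𝓢(E 𝕂, ℂ)}
    (h : ∀ x, φ' x = φ (A x)) : pullback f φ' = k * pullback f φ :=
  hf _ _ fun m => by
    change φ' ((toMatrix 𝕂).symm m) = φ ((toMatrix 𝕂).symm (B m))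
    obtain ⟨x, rfl⟩ := (toMatrix 𝕂).surjective m
    rw [← hAB, ContinuousLinearEquiv.symm_apply_apply, ContinuousLinearEquiv.symm_apply_apply, h]

theorem eq_zero_of_pullback_eq_zero {f : 𝓢(Matrix (Fin 3) (Fin 3) 𝕂, ℂ) →L[ℂ] ℂ}
    (h : pullback f = 0) : f = 0 := by
  ext φ
  have h1 := DFunLike.congr_fun h (compCLMOfContinuousLinearEquiv ℂ (toMatrix 𝕂) φ)
  rw [_root_.zero_apply] at h1 ⊢
  rw [← h1]
  change f φ = f _
  congr 1

/-- The equivariance of a distribution under the left and right actions. -/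
def Equivariant (ψ : 𝕂 → ℂ) (f : 𝓢(Matrix (Fin 3) (Fin 3) 𝕂, ℂ) →L[ℂ] ℂ) : Prop :=
  ∀ (a : 𝕂ˣ), ∀ g₁ ∈ N3 𝕂, ∀ g₂ ∈ N3 𝕂, ∀ φ φ' : 𝓢(Matrix (Fin 3) (Fin 3) 𝕂, ℂ),
    (∀ x, φ' x = φ (Matrix.diagonal ![(a : 𝕂), 1, (a : 𝕂)] * g₁ * x * g₂ᵀ *
      Matrix.diagonal ![((a⁻¹ : 𝕂ˣ) : 𝕂), 1, ((a⁻¹ : 𝕂ˣ) : 𝕂)])) →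
    f φ' = (ψ (g₁ 0 2))⁻¹ * (ψ (g₂ 0 2))⁻¹ * f φ

variable {ψ : 𝕂 → ℂ} {f : 𝓢(Matrix (Fin 3) (Fin 3) 𝕂, ℂ) →L[ℂ] ℂ}

theorem one_mem_N3 : (1 : Matrix (Fin 3) (Fin 3) 𝕂) ∈ N3 𝕂 :=
  ⟨0, 0, by ext i j; fin_cases i <;> fin_cases j <;> simp⟩

theorem Equivariant.torusInvariant (hf : Equivariant ψ f) (h0 : ψ 0 = 1) :
    TorusInvariant (pullback f) := fun a φ φ' h => by
  have := pullback_eq_smul (hf a 1 one_mem_N3 1 one_mem_N3) (A := tor a) (fun x => by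
    ext i j
    rw [toMatrix_apply, tor_apply, mul_one, transpose_one, mul_one, mul_diagonal, diagonal_mul,
      toMatrix_apply]
    have ha : ∀ w : 𝕂, (a : 𝕂) * w * (a : 𝕂)⁻¹ = w := fun w => by
      rw [mul_comm (a : 𝕂), mul_inv_cancel_right₀ a.ne_zero]
    fin_cases i <;> fin_cases j <;> simp [torusWeight, ha, mul_comm]) h
  simpa [h0] using this

theorem Equivariant.map_mul (hf : Equivariant ψ f) (h0 : ψ 0 = 1)
    {g : Matrix (Fin 3) (Fin 3) 𝕂} (hg : g ∈ N3 𝕂) {A : E 𝕂 → E 𝕂}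
    (hA : ∀ x, toMatrix 𝕂 (A x) = g * toMatrix 𝕂 x) {φ φ' : 𝓢(E 𝕂, ℂ)}
    (h : ∀ x, φ' x = φ (A x)) : pullback f φ' = (ψ (g 0 2))⁻¹ * pullback f φ := by
  have h1 : (Matrix.diagonal ![(1 : 𝕂), 1, 1]) = 1 := by
    ext i j; fin_cases i <;> fin_cases j <;> simp
  have := pullback_eq_smul (hf 1 g hg 1 one_mem_N3) (A := A) (fun x => by
    simp only [inv_one, Units.val_one, h1, one_mul, transpose_one, mul_one, hA]) h
  simpa [h0] using this

theorem Equivariant.annihilates_zero (hf : Equivariant ψ f) (h0 : ψ 0 = 1) {α : 𝕂}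
    (hα : ∀ d (s : ℝ), ψ (s • d) = Complex.exp (symb (d * α) * s)) (d : 𝕂) :
    Annihilates (pullback f) (fun _ => symb (d * α)) (rowOp 0 d) := by
  have := annihilates_rowOp (T := pullback f) (k := 0) (by decide) d (-symb (d * α))
    fun s φ φ' h => by
      rw [hf.map_mul h0 (g := !![1, 0, s • d; 0, 1, 0; 0, 0, 1]) ⟨0, _, rfl⟩ (fun x => ?_) h]
      · simp [hα, ← Complex.exp_neg]
      · ext i j
        simp only [toMatrix_apply, Matrix.mul_apply, Fin.sum_univ_three]
        fin_cases i <;> fin_cases j <;> simp [rowOp_apply]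
  simpa using this

theorem Equivariant.annihilates_one (hf : Equivariant ψ f) (h0 : ψ 0 = 1) (c : 𝕂) :
    Annihilates (pullback f) (fun _ => 0) (rowOp 1 c) := by
  have := annihilates_rowOp (T := pullback f) (k := 1) (by decide) c 0
    fun s φ φ' h => by
      rw [hf.map_mul h0 (g := !![1, 0, 0; 0, 1, s • c; 0, 0, 1]) ⟨_, 0, rfl⟩ (fun x => ?_) h]
      · simp [h0]
      · ext i j
        simp only [toMatrix_apply, Matrix.mul_apply, Fin.sum_univ_three]
        fin_cases i <;> fin_cases j <;> simp [rowOp_apply]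
  simpa using this

theorem Equivariant.rel (hf : Equivariant ψ f) (h0 : ψ 0 = 1)
    (hskew : ∀ φ φ' : 𝓢(Matrix (Fin 3) (Fin 3) 𝕂, ℂ), (∀ x, φ' x = φ xᵀ) → f φ' = - f φ) {α : 𝕂}
    (hα : ∀ d (s : ℝ), ψ (s • d) = Complex.exp (symb (d * α) * s)) :
    Rel (-α) ((pullback f).comp (partialFourier (upperLeft 𝕂))) where
  torus := (hf.torusInvariant h0).comp_partialFourier
  skew := TransposeSkew.comp_partialFourier fun φ φ' h => by
    have := pullback_eq_smul (f := f) (k := -1) (A := tau) (B := fun x => xᵀ)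
      (fun φ φ' h => by rw [hskew φ φ' h, neg_one_mul]) (fun x => rfl) h
    rw [this, neg_one_mul]
  rel_p d := (annihilates_comp_partialFourier (by decide) (hf.annihilates_zero h0 hα d)).congr
    (fun x => by
      rw [← symbCLM_apply, ← symbCLM_apply, ← symbCLM_apply, ← map_add]; congr 1; ring)
    fun x => rfl
  rel_q c := (annihilates_comp_partialFourier (by decide) (hf.annihilates_one h0 c)).congr
    (fun x => by rw [zero_add]) fun x => rfl

end Assembly

end GL3

/-- Let `f` be a tempered distribution on `gl₃(𝕂)` such that
`f(x ↦ φ(l·g₁·x·g₂^τ·l⁻¹)) = χ_{N₃}(g₁)⁻¹·χ_{N₃}(g₂)⁻¹·f(φ)` for `l = diag(a,1,a)`,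
`a ∈ 𝕂ˣ`, `g₁, g₂ ∈ N₃`, and such that `f(x ↦ φ(x^τ)) = −f(φ)`.  Then `f = 0`. -/
theorem gl3_tempered_distribution_vanishing {𝕂 : Type*} [RCLike 𝕂]
    (ψ : 𝕂 → ℂ) (hψ_add : ∀ s t, ψ (s + t) = ψ s * ψ t) (hψ_unitary : ∀ t, ‖ψ t‖ = 1)
    (hψ_cont : Continuous ψ) (hψ_nontriv : ∃ t, ψ t ≠ 1)
    (f : SchwartzMap (Matrix (Fin 3) (Fin 3) 𝕂) ℂ →L[ℂ] ℂ)
    (hequiv : ∀ (a : 𝕂ˣ), ∀ g₁ ∈ N3 𝕂, ∀ g₂ ∈ N3 𝕂,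
      ∀ φ φ' : SchwartzMap (Matrix (Fin 3) (Fin 3) 𝕂) ℂ,
      (∀ x, φ' x = φ (Matrix.diagonal ![(a : 𝕂), 1, (a : 𝕂)] * g₁ * x * g₂ᵀ *
          Matrix.diagonal ![((a⁻¹ : 𝕂ˣ) : 𝕂), 1, ((a⁻¹ : 𝕂ˣ) : 𝕂)])) →
      f φ' = (ψ (g₁ 0 2))⁻¹ * (ψ (g₂ 0 2))⁻¹ * f φ)
    (hskew : ∀ φ φ' : SchwartzMap (Matrix (Fin 3) (Fin 3) 𝕂) ℂ,
      (∀ x, φ' x = φ xᵀ) → f φ' = - f φ) :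
    f = 0 := by
  obtain ⟨α, hα⟩ := GL3.exists_character_parameter hψ_add hψ_unitary hψ_cont
  have h0 : ψ 0 = 1 := by simpa using hα 0 0
  have hα0 : α ≠ 0 := by
    rintro rfl
    obtain ⟨t, ht⟩ := hψ_nontriv
    exact ht (by simpa [GL3.symb_zero] using hα t 1)
  have h1 := (GL3.Equivariant.rel hequiv h0 hskew hα).eq_zero (neg_ne_zero.2 hα0)
  refine GL3.eq_zero_of_pullback_eq_zero (ContinuousLinearMap.ext fun φ => ?_)
  obtain ⟨φ', rfl⟩ := SchwartzMap.partialFourier_surjective (J := GL3.upperLeft 𝕂) φ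
  exact DFunLike.congr_fun h1 φ'
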